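/- arXiv:1602.02461 — 3 statements merged into one kernel-verified Lean document; each statement's English description precedes it below -/
import Mathlib

section
/- Let G be a finite simple graph and k a positive integer. If |V(G)| ≥ 3k and the minimum degree δ(G) ≥ 2k, then G contains k pairwise vertex-disjoint cycles. (Corrádi–Hajnal Theorem.) -/
open Finset

/-- `G` contains `k` pairwise vertex-disjoint cycles. -/
def HasDisjointCycles {V : Type*} (G : SimpleGraph V) (k : ℕ) : Prop :=
  ∃ (v : Fin k → V) (c : ∀ i, G.Walk (v i) (v i)),
    (∀ i, (c i).IsCycle) ∧
    ∀ i j, i ≠ j → ∀ x, x ∈ (c i).support → x ∉ (c j).support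

namespace CorradiHajnal

open SimpleGraph (Walk)

variable {V : Type*} {G : SimpleGraph V}

/-- The vertex set `T` contains all the vertices of some cycle of `G`. -/
def ContainsCycle (G : SimpleGraph V) (T : Finset V) : Prop :=
  ∃ (v : V) (c : G.Walk v v), c.IsCycle ∧ ∀ x ∈ c.support, x ∈ T

open scoped Classical in
/-- The number of neighbours of `v` in `T`. -/
noncomputable def nbrCount (G : SimpleGraph V) (v : V) (T : Finset V) : ℕ :=
  #{u ∈ T | G.Adj v u}

theorem containsCycle_of_path_of_adj {a x c : V} (p : G.Walk a x) (hp : p.IsPath)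
    (hc : c ∉ p.support) (hax : a ≠ x) (ha : G.Adj c a) (hx : G.Adj c x) {T : Finset V}
    (hcT : c ∈ T) (hpT : ∀ z ∈ p.support, z ∈ T) : ContainsCycle G T := by
  refine ⟨c, Walk.cons ha (p.concat hx.symm), ?_, ?_⟩
  · rw [Walk.cons_isCycle_iff]
    refine ⟨hp.concat hc hx.symm, ?_⟩
    rw [Walk.edges_concat, List.concat_eq_append, List.mem_append]
    rintro (h | h)
    · exact hc (p.fst_mem_support_of_mem_edges h)
    · simp only [List.mem_singleton, Sym2.eq_iff] at h
      rcases h with ⟨h, _⟩ | ⟨_, h⟩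
      · exact hx.ne h
      · exact hax h
  · intro z hz
    simp only [Walk.support_cons, Walk.support_concat, List.mem_cons,
      List.mem_append, List.not_mem_nil, or_false] at hz
    rcases hz with rfl | hz | rfl
    · exact hcT
    · exact hpT z hz
    · exact hcT

theorem containsCycle_of_path [DecidableEq V] {a x c : V} (p : G.Walk a x) (hp : p.IsPath)
    (hc : c ∉ p.support) {u w : V} (hu : u ∈ p.support) (hw : w ∈ p.support) (huw : u ≠ w)
    (hcu : G.Adj c u) (hcw : G.Adj c w) {T : Finset V}
    (hcT : c ∈ T) (hpT : ∀ z ∈ p.support, z ∈ T) : ContainsCycle G T := by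
  induction p with
  | nil => simp_all
  | @cons s t r h q ih =>
    have start : ∀ {y : V}, s ≠ y → G.Adj c s → G.Adj c y → y ∈ (Walk.cons h q).support →
        ContainsCycle G T := by
      intro y hsy hs hy hyq
      refine containsCycle_of_path_of_adj ((Walk.cons h q).takeUntil y hyq) (hp.takeUntil hyq)
        (fun h' => hc (Walk.support_takeUntil_subset_support _ _ h')) hsy hs hy hcT
        (fun z hz => hpT z (Walk.support_takeUntil_subset_support _ _ hz))
    by_cases hsu : s = u
    · subst hsu; exact start huw hcu hcw hw
    by_cases hsw : s = w
    · subst hsw; exact start huw.symm hcw hcu hu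
    have hne : ∀ y, y ∈ (Walk.cons h q).support → s ≠ y → y ∈ q.support := by
      intro y hy hsy
      simp only [Walk.support_cons, List.mem_cons] at hy
      exact hy.resolve_left (Ne.symm hsy)
    refine ih hp.of_cons (fun h' => hc ?_) (hne u hu hsu) (hne w hw hsw)
      (fun z hz => hpT z ?_)
    · simp [h']
    · simp [hz]

theorem containsCycle_triangle [DecidableEq V] {a b c : V} (hab : G.Adj a b) (hac : G.Adj a c)
    (hbc : G.Adj b c) : ContainsCycle G {a, b, c} := by
  refine containsCycle_of_path_of_adj (c := a) hbc.toWalk (Walk.IsPath.of_adj hbc) ?_ hbc.ne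
    hab hac (by simp) ?_
  · simp [hab.ne, hac.ne]
  · simp

theorem ContainsCycle.three_le_card [DecidableEq V] {T : Finset V} (h : ContainsCycle G T) :
    3 ≤ #T := by
  obtain ⟨v, c, hc, hs⟩ := h
  have h1 : c.support.tail.toFinset ⊆ T := by
    intro x hx
    exact hs x (List.mem_of_mem_tail (List.mem_toFinset.1 hx))
  have h2 := card_le_card h1
  rw [List.toFinset_card_of_nodup hc.support_nodup] at h2
  have := hc.three_le_length
  simp at h2
  omega

theorem nbrCount_triple [DecidableEq V] [DecidableRel G.Adj]
    {v a b c : V} (hab : a ≠ b) (hac : a ≠ c)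
    (hbc : b ≠ c) :
    nbrCount G v {a, b, c} = (if G.Adj v a then 1 else 0) + (if G.Adj v b then 1 else 0) +
      (if G.Adj v c then 1 else 0) := by
  classical
  have : nbrCount G v {a, b, c} = #(({a, b, c} : Finset V).filter (G.Adj v)) := by
    unfold nbrCount; congr
  rw [this, card_filter, sum_insert (by simp [hab, hac]), sum_insert (by simp [hbc]), sum_singleton,
    add_assoc]

theorem nbrCount_le_card (v : V) (T : Finset V) : nbrCount G v T ≤ #T := by
  classical
  unfold nbrCount
  exact card_filter_le _ _

theorem nbrCount_mono {H : SimpleGraph V} (h : G ≤ H) (v : V) (T : Finset V) :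
    nbrCount G v T ≤ nbrCount H v T := by
  classical
  unfold nbrCount
  refine card_le_card fun u hu => ?_
  simp only [mem_filter] at hu ⊢
  exact ⟨hu.1, h hu.2⟩

theorem nbrCount_le_of_subset {v : V} {T S : Finset V}
    (h : ∀ u ∈ T, G.Adj v u → u ∈ S) : nbrCount G v T ≤ #S := by
  classical
  unfold nbrCount
  refine card_le_card fun u hu => ?_
  rw [mem_filter] at hu
  exact h u hu.1 hu.2

theorem exists_adj_of_lt_nbrCount {v : V} {T S : Finset V} (h : #S < nbrCount G v T) :
    ∃ u ∈ T, G.Adj v u ∧ u ∉ S := by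
  by_contra! h'
  exact (nbrCount_le_of_subset h').not_gt h

/-- In a set containing no cycle, an end of a longest path has at most one neighbour. -/
theorem nbrCount_le_one_of_longest [DecidableEq V] {R : Finset V} (hR : ¬ ContainsCycle G R)
    {a b : V} (w : G.Walk a b) (hw : w.IsPath) (hwR : ∀ z ∈ w.support, z ∈ R)
    (hmax : ∀ (a' b' : V) (w' : G.Walk a' b'), w'.IsPath → (∀ z ∈ w'.support, z ∈ R) →
      w'.length ≤ w.length) : nbrCount G a R ≤ 1 := by
  have hin : ∀ u ∈ R, G.Adj a u → u ∈ w.support := by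
    intro u hu hau
    by_contra hn
    have := hmax u b (Walk.cons hau.symm w) (hw.cons hn) (by
      intro z hz
      rcases List.mem_cons.1 hz with rfl | hz
      · exact hu
      · exact hwR z hz)
    simp at this
  cases w with
  | nil =>
    refine (nbrCount_le_of_subset (S := ∅) ?_).trans (by simp)
    intro u hu hau
    have := hin u hu hau
    simp at this
    exact absurd this hau.ne'
  | @cons _ t _ h q =>
    refine (nbrCount_le_of_subset (S := {t}) ?_).trans (by simp)
    intro u hu hau
    by_contra hut
    rw [mem_singleton] at hut
    have h1 := hin u hu hau
    rw [Walk.support_cons, List.mem_cons] at h1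
    rw [Walk.cons_isPath_iff] at hw
    exact hR (containsCycle_of_path q hw.1 hw.2 q.start_mem_support
      (h1.resolve_left hau.ne') (Ne.symm hut) h hau (hwR a (by simp))
      (fun z hz => hwR z (by simp [hz])))

/-- A shortest cycle on at least four vertices sees at most two neighbours of an outside vertex,
unless there is a shorter cycle. -/
theorem exists_containsCycle_card_lt [DecidableEq V] {S : Finset V} (hS : ContainsCycle G S)
    {v : V} (hv : v ∉ S) (h4 : 4 ≤ #S) (h3 : 3 ≤ nbrCount G v S) :
    ∃ T ⊆ insert v S, #T < #S ∧ ContainsCycle G T := by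
  obtain ⟨z, c, hc, hcS⟩ := hS
  by_cases hall : c.support.toFinset = S
  swap
  · refine ⟨c.support.toFinset, ?_, ?_, z, c, hc, by simp⟩
    · intro x hx; exact mem_insert_of_mem (hcS x (List.mem_toFinset.1 hx))
    · refine card_lt_card (Finset.ssubset_iff_subset_ne.2 ⟨?_, hall⟩)
      intro x hx; exact hcS x (List.mem_toFinset.1 hx)
  by_cases hz : ∀ x ∈ S, G.Adj v x
  · have h1 := c.adj_snd hc.not_nil
    have hs : c.snd ∈ S := hcS _ (c.getVert_mem_support 1)
    have hzS : z ∈ S := hcS _ c.start_mem_support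
    refine ⟨{v, z, c.snd}, ?_, ?_, containsCycle_triangle (hz _ hzS) (hz _ hs) h1⟩
    · intro x; simp only [mem_insert, mem_singleton]
      rintro (rfl | rfl | rfl) <;> simp [*]
    · exact lt_of_le_of_lt card_le_three h4
  push Not at hz
  obtain ⟨x, hxS, hx⟩ := hz
  have hxc : x ∈ c.support := by rw [← List.mem_toFinset, hall]; exact hxS
  obtain ⟨d, hd, hdS⟩ : ∃ d : G.Walk x x, d.IsCycle ∧ ∀ y, y ∈ d.support ↔ y ∈ S :=
    ⟨c.rotate x hxc, hc.rotate hxc, fun y => by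
      rw [Walk.mem_support_rotate_iff, ← hall, List.mem_toFinset]⟩
  cases d with
  | nil => exact absurd rfl hd.ne_nil
  | @cons _ s _ h p =>
    have hp := (Walk.cons_isCycle_iff _ _).1 hd |>.1
    have hpS : ∀ y, y ∈ p.support ↔ y ∈ S := by
      intro y
      rw [← hdS, Walk.support_cons, List.mem_cons]
      constructor
      · exact Or.inr
      · rintro (rfl | h)
        · exact p.end_mem_support
        · exact h
    cases p with
    | nil => exact absurd rfl h.ne
    | @cons _ s' _ h' q =>
      rw [Walk.cons_isPath_iff] at hp
      obtain ⟨r, hr, hrS⟩ : ∃ r : G.Walk x s', r.IsPath ∧ ∀ y, y ∈ r.support ↔ y ∈ q.support :=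
        ⟨q.reverse, hp.1.reverse, by simp⟩
      have hsS : s ∈ S := (hpS s).1 (by simp)
      have hrS' : ∀ y, y ∈ r.support ↔ y ∈ S ∧ y ≠ s := by
        intro y
        rw [hrS, ← hpS, Walk.support_cons, List.mem_cons]
        constructor
        · intro hy; exact ⟨Or.inr hy, fun e => hp.2 (e ▸ hy)⟩
        · rintro ⟨h1 | h1, h2⟩
          · exact absurd h1 h2
          · exact h1
      clear hrS
      obtain ⟨u, huS, hvu, hu⟩ := exists_adj_of_lt_nbrCount (S := {s}) (h3.trans_lt' (by simp))
      obtain ⟨w, hwS, hvw, hw⟩ := exists_adj_of_lt_nbrCount (S := {s, u})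
        (h3.trans_lt' (card_le_two.trans_lt (by simp)))
      simp only [mem_insert, mem_singleton, not_or] at hu hw
      have hxs : x ≠ s := h.ne
      have hcard : #((insert v S).erase s |>.erase x) < #S := by
        have h1 : x ∈ (insert v S).erase s := by simp [hxs, hxS]
        have h2 : s ∈ insert v S := by simp [hsS]
        have h0 := card_pos.2 ⟨s, hsS⟩
        rw [card_erase_of_mem h1, card_erase_of_mem h2, card_insert_of_notMem hv]
        omega
      refine ⟨((insert v S).erase s).erase x, (erase_subset _ _).trans (erase_subset _ _),
        hcard, ?_⟩
      cases r with
      | nil =>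
        have := (hrS' u).2 ⟨huS, hu⟩
        simp at this
        exact absurd (this ▸ hvu) hx
      | @cons _ t _ k r =>
        rw [Walk.cons_isPath_iff] at hr
        have hmem : ∀ y ∈ S, y ≠ s → y ≠ x → y ∈ r.support := by
          intro y h1 h2 h3
          have := (hrS' y).2 ⟨h1, h2⟩
          rw [Walk.support_cons, List.mem_cons] at this
          exact this.resolve_left h3
        have hmem' : ∀ y ∈ r.support, y ∈ S ∧ y ≠ s ∧ y ≠ x := by
          intro y hy
          have := (hrS' y).1 (by simp [hy])
          exact ⟨this.1, this.2, fun e => hr.2 (e ▸ hy)⟩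
        refine containsCycle_of_path r hr.1 (fun h => hv (hmem' _ h).1)
          (hmem u huS hu ?_) (hmem w hwS hw.1 ?_) (Ne.symm hw.2) hvu hvw ?_ ?_
        · rintro rfl; exact hx hvu
        · rintro rfl; exact hx hvw
        · have h1 : v ≠ x := by rintro rfl; exact hv hxS
          have h2 : v ≠ s := by rintro rfl; exact hv hsS
          simp [h1, h2]
        · intro y hy
          have := hmem' y hy
          simp [this]

theorem ContainsCycle.eq_triangle [DecidableEq V] {S : Finset V} (hS : ContainsCycle G S)
    (h : #S = 3) : ∃ a b c : V, G.Adj a b ∧ G.Adj a c ∧ G.Adj b c ∧ S = {a, b, c} := by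
  obtain ⟨z, c, hc, hcS⟩ := hS
  have key : ∀ x ∈ c.support, ∀ y ∈ S, y ≠ x → G.Adj x y := by
    intro x hx y hy hyx
    have hd := hc.rotate hx
    set d := c.rotate x hx with hd'
    have hdS : ∀ y ∈ d.support, y ∈ S := fun y hy => hcS y ((Walk.mem_support_rotate_iff ..).1 hy)
    have h1 := d.adj_snd hd.not_nil
    have h2 := d.adj_penultimate hd.not_nil
    have h3 := hd.snd_ne_penultimate
    by_contra hn
    have : ({x, y, d.snd, d.penultimate} : Finset V) ⊆ S := by
      intro t; simp only [mem_insert, mem_singleton]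
      rintro (rfl | rfl | rfl | rfl)
      · exact hcS _ hx
      · exact hy
      · exact hdS _ (d.getVert_mem_support 1)
      · exact hdS _ (d.getVert_mem_support _)
    have h5 := card_le_card this
    rw [card_insert_of_notMem, card_insert_of_notMem, card_insert_of_notMem, card_singleton] at h5
    · omega
    · simpa using h3
    · simp only [mem_insert, mem_singleton, not_or]
      exact ⟨fun e => hn (e ▸ h1), fun e => hn (e ▸ h2.symm)⟩
    · simp only [mem_insert, mem_singleton, not_or]
      exact ⟨hyx.symm, h1.ne, h2.ne'⟩
  have hall : c.support.toFinset = S := by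
    refine eq_of_subset_of_card_le (fun x hx => hcS x (List.mem_toFinset.1 hx)) ?_
    rw [h]
    exact ContainsCycle.three_le_card (G := G) ⟨z, c, hc, by simp⟩
  have key' : ∀ x ∈ S, ∀ y ∈ S, x ≠ y → G.Adj x y := fun x hx y hy hxy =>
    key x (by rw [← List.mem_toFinset, hall]; exact hx) y hy hxy.symm
  obtain ⟨a, b, d, hab, had, hbd, rfl⟩ := card_eq_three.1 h
  exact ⟨a, b, d, key' _ (by simp) _ (by simp) hab, key' _ (by simp) _ (by simp) had,
    key' _ (by simp) _ (by simp) hbd, rfl⟩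

variable {k : ℕ}

/-- `f` is a family of disjoint vertex sets, each of which contains a cycle of `G`. -/
def IsPacking (G : SimpleGraph V) (f : Fin k → Finset V) : Prop :=
  (∀ i, ContainsCycle G (f i)) ∧ ∀ i j, i ≠ j → Disjoint (f i) (f j)

/-- A packing with as few vertices as possible. -/
def IsMinPacking (G : SimpleGraph V) (f : Fin k → Finset V) : Prop :=
  IsPacking G f ∧ ∀ g : Fin k → Finset V, IsPacking G g → ∑ i, #(f i) ≤ ∑ i, #(g i)

theorem IsPacking.update [DecidableEq V] {f : Fin k → Finset V} (hf : IsPacking G f) {i : Fin k}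
    {T : Finset V} (hT : ContainsCycle G T) (hd : ∀ j, j ≠ i → Disjoint T (f j)) :
    IsPacking G (Function.update f i T) := by
  constructor
  · intro j
    by_cases h : j = i
    · subst h; simpa using hT
    · simpa [h] using hf.1 j
  · intro j l hjl
    by_cases hj : j = i
    · subst hj
      simpa [hjl.symm] using hd l hjl.symm
    · by_cases hl : l = i
      · subst hl
        simpa [hj] using (hd j hj).symm
      · simpa [hj, hl] using hf.2 j l hjl

theorem IsPacking.cons {f : Fin k → Finset V} (hf : IsPacking G f)
    {T : Finset V} (hT : ContainsCycle G T) (hd : ∀ j, Disjoint T (f j)) :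
    IsPacking G (Fin.cons T f : Fin (k + 1) → Finset V) := by
  constructor
  · intro j
    refine Fin.cases ?_ (fun j => ?_) j
    · simpa using hT
    · simpa using hf.1 j
  · intro j l
    refine Fin.cases ?_ (fun j => ?_) j <;> refine Fin.cases ?_ (fun l => ?_) l
    · simp
    · intro _; simpa using hd l
    · intro _; simpa using (hd j).symm
    · intro h; simpa using hf.2 j l (by simpa using h)

theorem sum_card_update [DecidableEq V] (f : Fin k → Finset V) (i : Fin k) (T : Finset V) :
    ∑ j, #(Function.update f i T j) + #(f i) = ∑ j, #(f j) + #T := by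
  rw [← add_sum_erase univ _ (mem_univ i), ← add_sum_erase univ (fun j => #(f j)) (mem_univ i),
    sum_congr rfl (g := fun j => #(f j))]
  · simp only [Function.update_self]; omega
  · intro j hj
    rw [Function.update_of_ne (ne_of_mem_erase hj)]

/-- The vertices `x`, `y`, `z` form a triangle with vertex set `T`. -/
def IsTriangle [DecidableEq V] (G : SimpleGraph V) (T : Finset V) (x y z : V) : Prop :=
  G.Adj x y ∧ G.Adj x z ∧ G.Adj y z ∧ T = {x, y, z}

theorem IsTriangle.rotate [DecidableEq V] {T : Finset V} {x y z : V} (h : IsTriangle G T x y z) :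
    IsTriangle G T y z x := by
  obtain ⟨h1, h2, h3, rfl⟩ := h
  refine ⟨h3, h1.symm, h2.symm, ?_⟩
  ext; simp; tauto

theorem IsTriangle.nbrCount_eq [DecidableEq V] [DecidableRel G.Adj] {T : Finset V} {x y z : V}
    (h : IsTriangle G T x y z) (v : V) :
    nbrCount G v T = (if G.Adj v x then 1 else 0) + (if G.Adj v y then 1 else 0) +
      (if G.Adj v z then 1 else 0) := by
  obtain ⟨h1, h2, h3, rfl⟩ := h
  exact nbrCount_triple h1.ne h2.ne h3.ne

theorem IsTriangle.nbrCount_le [DecidableEq V] {T : Finset V} {x y z : V}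
    (h : IsTriangle G T x y z) (v : V) : nbrCount G v T ≤ 3 := by
  obtain ⟨h1, h2, h3, rfl⟩ := h
  exact (nbrCount_le_card _ _).trans card_le_three

theorem IsTriangle.exists_start [DecidableEq V] {T : Finset V} {a b c x : V}
    (h : IsTriangle G T a b c)
    (hx : x ∈ T) : ∃ y z, IsTriangle G T x y z := by
  have := h.2.2.2
  subst this
  simp only [mem_insert, mem_singleton] at hx
  rcases hx with rfl | rfl | rfl
  · exact ⟨_, _, h⟩
  · exact ⟨_, _, h.rotate⟩
  · exact ⟨_, _, h.rotate.rotate⟩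

theorem IsTriangle.split [DecidableEq V] {T : Finset V} {x y z u v : V} (h : IsTriangle G T x y z)
    (h5 : 5 ≤ nbrCount G v T + nbrCount G u T) :
    (G.Adj v x ∧ G.Adj u y ∧ G.Adj u z) ∨ (G.Adj u x ∧ G.Adj v y ∧ G.Adj v z) := by
  classical
  rw [h.nbrCount_eq, h.nbrCount_eq] at h5
  by_contra hn
  split_ifs at h5 <;> first | omega | tauto

theorem IsTriangle.exists_split [DecidableEq V] {T : Finset V} {x y z u v : V}
    (h : IsTriangle G T x y z)
    (h5 : 5 ≤ nbrCount G v T + nbrCount G u T) :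
    ∃ x y z, IsTriangle G T x y z ∧ G.Adj v x ∧ G.Adj u y ∧ G.Adj u z := by
  rcases h.split h5 with h1 | h1
  · exact ⟨_, _, _, h, h1⟩
  rcases h.rotate.split h5 with h2 | h2
  · exact ⟨_, _, _, h.rotate, h2⟩
  rcases h.rotate.rotate.split h5 with h3 | h3
  · exact ⟨_, _, _, h.rotate.rotate, h3⟩
  exact ⟨_, _, _, h, h2.2.2, h2.1, h3.1⟩

theorem IsTriangle.exists_full [DecidableEq V] {T : Finset V} {x y z u v : V}
    (h : IsTriangle G T x y z)
    (h5 : 5 ≤ nbrCount G v T + nbrCount G u T) :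
    ∃ x y z, IsTriangle G T x y z ∧
      ((G.Adj v x ∧ G.Adj v y ∧ G.Adj v z ∧ G.Adj u x ∧ G.Adj u y) ∨
        (G.Adj u x ∧ G.Adj u y ∧ G.Adj u z ∧ G.Adj v x ∧ G.Adj v y)) := by
  rcases h.split h5 with h1 | h1 <;> rcases h.rotate.split h5 with h2 | h2 <;>
    rcases h.rotate.rotate.split h5 with h3 | h3
  all_goals first
    | exact ⟨x, y, z, h, by tauto⟩
    | exact ⟨y, z, x, h.rotate, by tauto⟩
    | exact ⟨z, x, y, h.rotate.rotate, by tauto⟩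

theorem IsTriangle.adj_of_nbrCount [DecidableEq V] {T : Finset V} {x y z v : V}
    (h : IsTriangle G T x y z)
    (h3 : 3 ≤ nbrCount G v T) : G.Adj v x ∧ G.Adj v y ∧ G.Adj v z := by
  classical
  rw [h.nbrCount_eq] at h3
  split_ifs at h3 <;> first | omega | tauto

theorem IsTriangle.mem [DecidableEq V] {T : Finset V} {x y z : V} (h : IsTriangle G T x y z) :
    x ∈ T ∧ y ∈ T ∧ z ∈ T := by
  obtain ⟨h1, h2, h3, rfl⟩ := h
  simp

theorem IsTriangle.exists_common [DecidableEq V] {T : Finset V} {x₁ x₂ x₃ b c y : V}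
    (hT : IsTriangle G T x₁ x₂ x₃)
    (h : 13 ≤ nbrCount G b T + 2 * (nbrCount G y T + nbrCount G c T)) :
    ∃ x₁ x₂ x₃, IsTriangle G T x₁ x₂ x₃ ∧ G.Adj b x₁ ∧ G.Adj y x₁ ∧ G.Adj c x₂ ∧ G.Adj c x₃ := by
  have hb := hT.nbrCount_le b
  have hc := hT.nbrCount_le c
  have hy := hT.nbrCount_le y
  by_cases h6 : nbrCount G y T + nbrCount G c T = 6
  · obtain ⟨x, hx, hbx, -⟩ := exists_adj_of_lt_nbrCount (S := ∅) (T := T) (v := b)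
      (G := G) (by rw [card_empty]; omega)
    obtain ⟨x', x'', ht⟩ := hT.exists_start hx
    have h1 := ht.adj_of_nbrCount (v := y) (by omega)
    have h2 := ht.adj_of_nbrCount (v := c) (by omega)
    exact ⟨x, x', x'', ht, hbx, h1.1, h2.2⟩
  · obtain ⟨x, x', x'', ht, h1, h2⟩ := hT.exists_split (v := y) (u := c) (by omega)
    exact ⟨x, x', x'', ht, (ht.adj_of_nbrCount (v := b) (by omega)).1, h1, h2⟩

section

variable [Fintype V] [DecidableEq V]

/-- The vertices not covered by the family `f`. -/
def rest (f : Fin k → Finset V) : Finset V := {v | ∀ i, v ∉ f i}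

theorem mem_rest {f : Fin k → Finset V} {v : V} : v ∈ rest f ↔ ∀ i, v ∉ f i := by simp [rest]

theorem IsPacking.disjoint_of_subset {f : Fin k → Finset V} (hf : IsPacking G f) {i j : Fin k}
    {T : Finset V} (hT : ∀ x ∈ T, x ∈ f i ∨ x ∈ rest f) (hij : j ≠ i) : Disjoint T (f j) := by
  rw [Finset.disjoint_left]
  intro x hx hxj
  rcases hT x hx with h | h
  · exact Finset.disjoint_left.1 (hf.2 j i hij) hxj h
  · exact mem_rest.1 h j hxj

theorem IsPacking.mem_rest_update {f : Fin k → Finset V} (hf : IsPacking G f) {i : Fin k}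
    {T : Finset V} {x : V} (hx : x ∈ f i ∨ x ∈ rest f) (hxT : x ∉ T) :
    x ∈ rest (Function.update f i T) := by
  rw [mem_rest]
  intro j
  by_cases h : j = i
  · subst h; simpa using hxT
  · rw [Function.update_of_ne h]
    intro hxj
    rcases hx with h' | h'
    · exact Finset.disjoint_left.1 (hf.2 j i h) hxj h'
    · exact mem_rest.1 h' j hxj

theorem IsPacking.exists_succ {f : Fin k → Finset V} (hf : IsPacking G f) {i : Fin k}
    {X Y : Finset V} (hX : ContainsCycle G X) (hY : ContainsCycle G Y)
    (hXs : ∀ x ∈ X, x ∈ f i ∨ x ∈ rest f) (hYs : ∀ x ∈ Y, x ∈ f i ∨ x ∈ rest f)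
    (hXY : ∀ x ∈ X, x ∉ Y) : ∃ g : Fin (k + 1) → Finset V, IsPacking G g := by
  refine ⟨_, (hf.update hX fun j hj => hf.disjoint_of_subset hXs hj).cons hY fun j => ?_⟩
  by_cases h : j = i
  · subst h
    simpa using (Finset.disjoint_left.2 hXY).symm
  · rw [Function.update_of_ne h]
    exact hf.disjoint_of_subset hYs h

theorem IsMinPacking.card_le {f : Fin k → Finset V} (hf : IsMinPacking G f) {i : Fin k}
    {T : Finset V} (hT : ContainsCycle G T) (hTs : ∀ x ∈ T, x ∈ f i ∨ x ∈ rest f) :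
    #(f i) ≤ #T := by
  have h1 := hf.2 _ (hf.1.update hT fun j hj => hf.1.disjoint_of_subset hTs hj)
  have h2 := sum_card_update f i T
  omega

theorem IsMinPacking.update {f : Fin k → Finset V} (hf : IsMinPacking G f) {i : Fin k}
    {T : Finset V} (hT : ContainsCycle G T) (hTs : ∀ x ∈ T, x ∈ f i ∨ x ∈ rest f)
    (hc : #T ≤ #(f i)) : IsMinPacking G (Function.update f i T) := by
  refine ⟨hf.1.update hT fun j hj => hf.1.disjoint_of_subset hTs hj, fun g hg => ?_⟩
  have h1 := hf.2 g hg
  have h2 := sum_card_update f i T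
  omega

theorem nbrCount_univ_le (f : Fin k → Finset V) (v : V) :
    nbrCount G v univ ≤ ∑ i, nbrCount G v (f i) + nbrCount G v (rest f) := by
  classical
  unfold nbrCount
  calc _ ≤ #((univ.biUnion fun i => {u ∈ f i | G.Adj v u}) ∪ {u ∈ rest f | G.Adj v u}) := by
        refine card_le_card fun u hu => ?_
        have hu' : G.Adj v u := by simpa using hu
        by_cases h : ∃ i, u ∈ f i
        · obtain ⟨i, hi⟩ := h
          simp only [mem_union, mem_biUnion, mem_filter]
          exact Or.inl ⟨i, mem_univ _, hi, hu'⟩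
        · push Not at h
          simp [mem_rest, h, hu']
    _ ≤ _ := (card_union_le _ _).trans (Nat.add_le_add_right card_biUnion_le _)

theorem IsMinPacking.triangle_or_nbrCount_le {f : Fin k → Finset V} (hf : IsMinPacking G f)
    (i : Fin k) :
    (∃ x y z, IsTriangle G (f i) x y z) ∨ ∀ v ∈ rest f, nbrCount G v (f i) ≤ 2 := by
  by_cases h3 : #(f i) = 3
  · left
    obtain ⟨x, y, z, h1, h2, h3, h4⟩ := (hf.1.1 i).eq_triangle h3
    exact ⟨x, y, z, h1, h2, h3, h4⟩
  · right
    have h4 := (hf.1.1 i).three_le_card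
    intro v hv
    by_contra hn
    obtain ⟨T, hT, hc, hcyc⟩ := exists_containsCycle_card_lt (hf.1.1 i) (mem_rest.1 hv i)
      (by omega) (by omega : 3 ≤ nbrCount G v (f i))
    refine absurd (hf.card_le hcyc fun x hx => ?_) hc.not_ge
    rcases mem_insert.1 (hT hx) with rfl | h
    · exact Or.inr hv
    · exact Or.inl h

theorem IsMinPacking.exists_triangle {f : Fin k → Finset V} (hf : IsMinPacking G f)
    {i : Fin k} {u v : V} (hu : u ∈ rest f) (hv : v ∈ rest f)
    (h5 : 5 ≤ nbrCount G u (f i) + nbrCount G v (f i)) : ∃ x y z, IsTriangle G (f i) x y z := by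
  rcases hf.triangle_or_nbrCount_le i with h | h
  · exact h
  · have := h u hu
    have := h v hv
    omega

theorem ne_of_mem_rest {f : Fin k → Finset V} {i : Fin k} {u x : V} (hu : u ∈ rest f)
    (hx : x ∈ f i) : u ≠ x := by
  rintro rfl
  exact mem_rest.1 hu i hx

/-- If the ends of a path outside a minimum packing send at least five edges to a member of the
packing, then the second vertex of the path sends none. -/
theorem IsMinPacking.nbrCount_second_eq_zero {f : Fin k → Finset V} (hf : IsMinPacking G f)
    (hno : ∀ g : Fin (k + 1) → Finset V, ¬ IsPacking G g) {p u t : V} (h : G.Adj p u)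
    (q : G.Walk u t) (hq : q.IsPath) (hp : p ∉ q.support) (hpR : p ∈ rest f)
    (hqR : ∀ z ∈ q.support, z ∈ rest f) (hut : u ≠ t) {i : Fin k}
    (h5 : 5 ≤ nbrCount G p (f i) + nbrCount G t (f i)) : nbrCount G u (f i) = 0 := by
  by_contra hn
  have hu := hqR u q.start_mem_support
  have ht := hqR t q.end_mem_support
  obtain ⟨a, b, c, habc⟩ := hf.exists_triangle hpR ht h5
  obtain ⟨x, hx, hux, -⟩ := exists_adj_of_lt_nbrCount (S := ∅) (T := f i) (v := u)
    (G := G) (by simpa using Nat.pos_of_ne_zero hn)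
  obtain ⟨y, z, hxyz⟩ := habc.exists_start hx
  obtain ⟨-, hy, hz⟩ := hxyz.mem
  have hpt : p ≠ t := by rintro rfl; exact hp q.end_mem_support
  have hne := @ne_of_mem_rest V k _ _ f i
  rcases hxyz.split h5 with ⟨h1, h2, h3⟩ | ⟨h1, h2, h3⟩
  · obtain ⟨g, hg⟩ := hf.1.exists_succ (i := i) (containsCycle_triangle h h1 hux)
      (containsCycle_triangle h2 h3 hxyz.2.2.1) (by simp [*]) (by simp [*]) (by
        have := hxyz.1.ne
        have := hxyz.2.1.ne
        have := hne hpR hy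
        have := hne hpR hz
        have := hne hu hy
        have := hne hu hz
        have := hne ht hx
        intro e he he'
        simp only [mem_insert, mem_singleton] at he he'
        grind)
    exact hno g hg
  · obtain ⟨g, hg⟩ := hf.1.exists_succ (i := i) (X := insert x q.support.toFinset)
      (containsCycle_of_path_of_adj q hq (fun h' => hne (hqR x h') hx rfl) hut hux.symm h1.symm
        (by simp) (by simp +contextual))
      (containsCycle_triangle h2 h3 hxyz.2.2.1) (by
        intro e he
        rcases mem_insert.1 he with rfl | he
        · exact Or.inl hx
        · exact Or.inr (hqR e (List.mem_toFinset.1 he))) (by simp [*]) (by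
        have := hxyz.1.ne
        have := hxyz.2.1.ne
        have := hne hpR hx
        intro e he he'
        simp only [mem_insert, mem_singleton, List.mem_toFinset] at he he'
        rcases he with rfl | he
        · grind
        · have := hne (hqR e he) hy
          have := hne (hqR e he) hz
          grind)
    exact hno g hg

/-- A minimum packing together with a path outside it whose length is largest possible. -/
structure IsOptimal (G : SimpleGraph V) (f : Fin k → Finset V) {a b : V} (w : G.Walk a b) :
    Prop where
  isMin : IsMinPacking G f
  isPath : w.IsPath
  subset : ∀ z ∈ w.support, z ∈ rest f
  longest : ∀ g : Fin k → Finset V, IsMinPacking G g → ∀ (a' b' : V) (w' : G.Walk a' b'),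
    w'.IsPath → (∀ z ∈ w'.support, z ∈ rest g) → w'.length ≤ w.length

theorem IsOptimal.reverse {f : Fin k → Finset V} {a b : V} {w : G.Walk a b}
    (h : IsOptimal G f w) : IsOptimal G f w.reverse :=
  ⟨h.isMin, h.isPath.reverse, by simpa using h.subset, by simpa using h.longest⟩

theorem IsPacking.exists_isOptimal {f₀ : Fin k → Finset V} (hf₀ : IsPacking G f₀)
    (hR : 3 ≤ #(rest f₀)) :
    ∃ (f : Fin k → Finset V) (a b : V) (w : G.Walk a b), IsOptimal G f w ∧ 3 ≤ #(rest f) := by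
  have hcard : ∀ f : Fin k → Finset V, IsPacking G f →
      ∑ i, #(f i) + #(rest f) = Fintype.card V := by
    intro f hf
    rw [← card_biUnion fun i _ j _ hij => hf.2 i j hij, ← card_univ, ← card_union_of_disjoint]
    · congr 1
      ext v
      simp only [mem_union, mem_biUnion, mem_univ, true_and, mem_rest, iff_true]
      by_cases h : ∃ i, v ∈ f i
      · exact Or.inl h
      · push Not at h; exact Or.inr h
    · rw [Finset.disjoint_left]
      intro v hv hv'
      obtain ⟨i, -, hi⟩ := mem_biUnion.1 hv
      exact mem_rest.1 hv' i hi
  have : Nonempty {f : Fin k → Finset V // IsPacking G f} := ⟨⟨f₀, hf₀⟩⟩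
  obtain ⟨⟨f, hf⟩, hmin⟩ := Finite.exists_min
    fun f : {f : Fin k → Finset V // IsPacking G f} => ∑ i, #(f.1 i)
  have hf' : IsMinPacking G f := ⟨hf, fun g hg => hmin ⟨g, hg⟩⟩
  have hrest : ∀ g : Fin k → Finset V, IsMinPacking G g → 3 ≤ #(rest g) := by
    intro g hg
    have := hcard g hg.1
    have := hcard f₀ hf₀
    have := hg.2 f₀ hf₀
    omega
  let L : Set ℕ := {n | ∃ g : Fin k → Finset V, IsMinPacking G g ∧ ∃ (a b : V) (w : G.Walk a b),
    w.IsPath ∧ (∀ z ∈ w.support, z ∈ rest g) ∧ w.length = n}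
  have hbdd : BddAbove L := by
    refine ⟨Fintype.card V, ?_⟩
    rintro n ⟨g, -, a, b, w, hw, -, rfl⟩
    exact hw.length_lt.le
  have hne : L.Nonempty := by
    obtain ⟨v, hv⟩ := card_pos.1 (by have := hrest f hf'; omega : 0 < #(rest f))
    exact ⟨_, f, hf', v, v, Walk.nil, Walk.IsPath.nil, by simpa using hv, rfl⟩
  obtain ⟨g, hg, a, b, w, hw, hwR, hlen⟩ := Nat.sSup_mem hne hbdd
  refine ⟨g, a, b, w, ⟨hg, hw, hwR, ?_⟩, hrest g hg⟩
  intro g' hg' a' b' w' hw' hw'R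
  rw [hlen]
  exact le_csSup hbdd ⟨g', hg', a', b', w', hw', hw'R, rfl⟩

theorem IsOptimal.nbrCount_rest_le_one {f : Fin k → Finset V} {a b : V} {w : G.Walk a b}
    (h : IsOptimal G f w) (hno : ∀ g : Fin (k + 1) → Finset V, ¬ IsPacking G g) :
    nbrCount G a (rest f) ≤ 1 := by
  refine nbrCount_le_one_of_longest (fun hc => ?_) w h.isPath h.subset
    (h.longest f h.isMin)
  refine hno _ (h.isMin.1.cons hc fun i => ?_)
  rw [Finset.disjoint_left]
  exact fun v hv => mem_rest.1 hv i

theorem exists_five_le {f : Fin k → Finset V} (hdeg : ∀ v, 2 * k + 2 ≤ nbrCount G v univ)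
    {u v : V} (hu : nbrCount G u (rest f) ≤ 1) (hv : nbrCount G v (rest f) ≤ 1) :
    ∃ i, 5 ≤ nbrCount G u (f i) + nbrCount G v (f i) := by
  by_contra! hn
  have h1 := (hdeg u).trans (nbrCount_univ_le f u)
  have h2 := (hdeg v).trans (nbrCount_univ_le f v)
  have h3 := sum_le_card_nsmul univ (fun i => nbrCount G u (f i) + nbrCount G v (f i)) 4
    fun i _ => Nat.le_of_lt_succ (hn i)
  simp only [sum_add_distrib, card_univ, Fintype.card_fin, smul_eq_mul] at h3
  omega

theorem IsOptimal.two_le_nbrCount_rest {f : Fin k → Finset V} {a b : V} {w : G.Walk a b}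
    (h : IsOptimal G f w) (hno : ∀ g : Fin (k + 1) → Finset V, ¬ IsPacking G g)
    (hdeg : ∀ v, 2 * k + 2 ≤ nbrCount G v univ) {v : V} (hv : v ∈ rest f)
    (hvw : v ∉ w.support) : 2 ≤ nbrCount G v (rest f) := by
  by_contra hn
  obtain ⟨i, hi⟩ := exists_five_le hdeg (h.nbrCount_rest_le_one hno)
    (by omega : nbrCount G v (rest f) ≤ 1)
  have ha := h.subset a w.start_mem_support
  obtain ⟨_, _, _, ht⟩ := h.isMin.exists_triangle ha hv hi
  obtain ⟨x, y, z, ht, hax, hvy, hvz⟩ := ht.exists_split hi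
  obtain ⟨hx, hy, hz⟩ := ht.mem
  have hmin := h.isMin.update (i := i) (containsCycle_triangle hvy hvz ht.2.2.1)
    (by simp [hv, hy, hz]) (card_le_three.trans (h.isMin.1.1 i).three_le_card)
  have hxw : x ∉ w.support := fun hxw => ne_of_mem_rest (h.subset x hxw) hx rfl
  have := h.longest _ hmin x b (Walk.cons hax.symm w) (h.isPath.cons hxw) (by
    intro s hs
    rcases List.mem_cons.1 hs with rfl | hs
    · refine h.isMin.1.mem_rest_update (Or.inl hx) ?_
      simp [(ne_of_mem_rest hv hx).symm, ht.1.ne, ht.2.1.ne]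
    · refine h.isMin.1.mem_rest_update (Or.inr (h.subset s hs)) ?_
      have h1 := ne_of_mem_rest (h.subset s hs) hy
      have h2 := ne_of_mem_rest (h.subset s hs) hz
      have h3 : s ≠ v := by rintro rfl; exact hvw hs
      simp [h1, h2, h3])
  simp at this

theorem IsOptimal.two_le_length {f : Fin k → Finset V} {a b : V} {w : G.Walk a b}
    (h : IsOptimal G f w) (hno : ∀ g : Fin (k + 1) → Finset V, ¬ IsPacking G g)
    (hdeg : ∀ v, 2 * k + 2 ≤ nbrCount G v univ) (hR : 3 ≤ #(rest f)) : 2 ≤ w.length := by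
  by_contra hn
  have hc : #w.support.toFinset < #(rest f) := by
    refine lt_of_le_of_lt w.support.toFinset_card_le ?_
    rw [Walk.length_support]
    omega
  obtain ⟨v, hv, hvw⟩ := exists_mem_notMem_of_card_lt_card hc
  rw [List.mem_toFinset] at hvw
  have h2 := h.two_le_nbrCount_rest hno hdeg hv hvw
  obtain ⟨x, hx, hvx, -⟩ := exists_adj_of_lt_nbrCount (S := ∅) (h2.trans_lt' (by simp))
  obtain ⟨y, hy, hvy, hyx⟩ := exists_adj_of_lt_nbrCount (S := {x}) (h2.trans_lt' (by simp))
  rw [mem_singleton] at hyx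
  have := h.longest f h.isMin x y (Walk.cons hvx.symm (Walk.cons hvy Walk.nil))
    (by simp [hvx.ne', hvy.ne, Ne.symm hyx]) (by simp [hx, hy, hv])
  simp at this
  omega

theorem IsOptimal.second_nbrCount_rest_le_two {f : Fin k → Finset V} {a b x y : V}
    {hby : G.Adj b y} {hyx : G.Adj y x} {q : G.Walk x a}
    (h : IsOptimal G f (Walk.cons hby (Walk.cons hyx q)))
    (hno : ∀ g : Fin (k + 1) → Finset V, ¬ IsPacking G g)
    (hdeg : ∀ v, 2 * k + 2 ≤ nbrCount G v univ) : nbrCount G y (rest f) ≤ 2 := by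
  refine (nbrCount_le_of_subset (S := {b, x}) ?_).trans card_le_two
  intro z hz hyz
  by_contra hn
  simp only [mem_insert, mem_singleton, not_or] at hn
  have hp := h.isPath
  rw [Walk.cons_isPath_iff, Walk.cons_isPath_iff] at hp
  obtain ⟨⟨hq, hyq⟩, hb⟩ := hp
  have hR : ∀ s, s ∈ q.support → s ∈ rest f := fun s hs => h.subset s (by simp [hs])
  have hy : y ∈ rest f := h.subset y (by simp)
  by_cases hzq : z ∈ q.support
  · have hc : ContainsCycle G (rest f) := containsCycle_of_path q hq hyq q.start_mem_support hzq
      (Ne.symm hn.2) hyx hyz hy hR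
    refine hno _ (h.isMin.1.cons hc fun i => ?_)
    rw [Finset.disjoint_left]
    exact fun v hv => mem_rest.1 hv i
  · have hopt : IsOptimal G f (Walk.cons hyz.symm (Walk.cons hyx q)) := by
      refine ⟨h.isMin, (hq.cons hyq).cons ?_, ?_, ?_⟩
      · simp [hyz.ne', hzq]
      · intro s hs
        rcases List.mem_cons.1 hs with rfl | hs
        · exact hz
        · exact h.subset s (List.mem_cons_of_mem _ hs)
      · simpa using h.longest
    have h1 := hopt.nbrCount_rest_le_one hno
    have h2 := h.two_le_nbrCount_rest hno hdeg hz (by simp [hn.1, hzq, hyz.ne'])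
    omega

theorem IsMinPacking.false_of_triangles {f : Fin k → Finset V} (hf : IsMinPacking G f)
    (hno : ∀ g : Fin (k + 1) → Finset V, ¬ IsPacking G g) {i j : Fin k} (hji : j ≠ i)
    {a b y c₁ c₂ c₃ x₁ x₂ x₃ : V}
    (ha : a ∈ rest f) (hb : b ∈ rest f) (hy : y ∈ rest f) (hab : a ≠ b) (hay : a ≠ y)
    (hby : G.Adj b y)
    (hc : IsTriangle G (f i) c₁ c₂ c₃) (hx : IsTriangle G (f j) x₁ x₂ x₃)
    (hac₁ : G.Adj a c₁) (hac₂ : G.Adj a c₂) (hbx : G.Adj b x₁) (hyx : G.Adj y x₁)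
    (hcx₂ : G.Adj c₃ x₂) (hcx₃ : G.Adj c₃ x₃) : False := by
  obtain ⟨hc₁, hc₂, hc₃⟩ := hc.mem
  obtain ⟨hx₁, hx₂, hx₃⟩ := hx.mem
  have hne := fun {u x : V} {i : Fin k} => @ne_of_mem_rest V k _ _ f i u x
  have hg := hf.1.update (i := i) (containsCycle_triangle hac₁ hac₂ hc.1)
    fun l hl => hf.1.disjoint_of_subset (i := i) (by simp [ha, hc₁, hc₂]) hl
  have hrest : ∀ u ∈ rest f, u ≠ a → u ∈ rest (Function.update f i {a, c₁, c₂}) :=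
    fun u hu hua => hf.1.mem_rest_update (Or.inr hu) (by simp [hua, hne hu hc₁, hne hu hc₂])
  have hb' := hrest b hb hab.symm
  have hy' := hrest y hy hay.symm
  have hc' : c₃ ∈ rest (Function.update f i {a, c₁, c₂}) :=
    hf.1.mem_rest_update (Or.inl hc₃)
      (by simp [(hne ha hc₃).symm, hc.2.1.ne', hc.2.2.1.ne'])
  have hj : Function.update f i {a, c₁, c₂} j = f j := Function.update_of_ne hji _ _
  obtain ⟨g', hg'⟩ := hg.exists_succ (i := j) (containsCycle_triangle hcx₂ hcx₃ hx.2.2.1)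
    (containsCycle_triangle hby hbx hyx) (by rw [hj]; simp [hc', hx₂, hx₃])
    (by rw [hj]; simp [hb', hy', hx₁]) (by
      have := hne hb hc₃
      have := hne hy hc₃
      have := hne hb hx₂
      have := hne hy hx₂
      have := hne hb hx₃
      have := hne hy hx₃
      have := hx.1.ne
      have := hx.2.1.ne
      have := Finset.disjoint_left.1 (hf.1.2 j i hji) hx₁
      intro e he he'
      simp only [mem_insert, mem_singleton] at he he'
      grind)
  exact hno g' hg'

theorem nbrCount_univ_le_erase (f : Fin k → Finset V) (i : Fin k) (v : V) :
    nbrCount G v univ ≤ ∑ j ∈ univ.erase i, nbrCount G v (f j) + nbrCount G v (f i) +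
      nbrCount G v (rest f) := by
  have := nbrCount_univ_le (G := G) f v
  rw [← sum_erase_add _ _ (mem_univ i)] at this
  exact this

theorem IsOptimal.false_of_ends {f : Fin k → Finset V} {a b : V} {w : G.Walk b a}
    (h : IsOptimal G f w) (hno : ∀ g : Fin (k + 1) → Finset V, ¬ IsPacking G g)
    (hdeg : ∀ v, 2 * k + 2 ≤ nbrCount G v univ) (hlen : 2 ≤ w.length) {i : Fin k}
    {c₁ c₂ c₃ : V} (hc : IsTriangle G (f i) c₁ c₂ c₃) (h₁ : G.Adj a c₁) (h₂ : G.Adj a c₂)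
    (h₃ : G.Adj a c₃) (hb₁ : G.Adj b c₁) (hb₂ : G.Adj b c₂) : False := by
  classical
  have hbR := h.nbrCount_rest_le_one hno
  have haR := h.reverse.nbrCount_rest_le_one hno
  cases w with
  | nil => simp at hlen
  | @cons _ y _ hby w =>
  cases w with
  | nil => simp at hlen
  | @cons _ x _ hyx q =>
  have hyR := h.second_nbrCount_rest_le_two hno hdeg
  have hf := h.isMin
  have hp := h.isPath
  rw [Walk.cons_isPath_iff] at hp
  have hsub := h.subset
  have hlong := h.longest
  set P := Walk.cons hyx q with hP
  obtain ⟨hPp, hbP⟩ := hp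
  have hya : y ≠ a := by
    rintro rfl
    rw [hP, Walk.cons_isPath_iff] at hPp
    exact hPp.2 q.end_mem_support
  have hPR : ∀ s ∈ P.support, s ∈ rest f := fun s hs => hsub s (List.mem_cons_of_mem _ hs)
  have hb : b ∈ rest f := hsub b (Walk.start_mem_support _)
  have hy : y ∈ rest f := hPR y P.start_mem_support
  have ha : a ∈ rest f := hPR a P.end_mem_support
  have hab : a ≠ b := by rintro rfl; exact hbP P.end_mem_support
  obtain ⟨hc₁, hc₂, hc₃⟩ := hc.mem
  have hne := fun {u x : V} {i : Fin k} => @ne_of_mem_rest V k _ _ f i u x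
  have hcP : c₃ ∉ P.support := fun h' => hne (hPR _ h') hc₃ rfl
  have hbt := containsCycle_triangle hb₁ hb₂ hc.1
  have hbs : ∀ s ∈ ({b, c₁, c₂} : Finset V), s ∈ f i ∨ s ∈ rest f := by simp [hb, hc₁, hc₂]
  have hg := hf.update (i := i) hbt hbs (card_le_three.trans (hf.1.1 i).three_le_card)
  set g := Function.update f i {b, c₁, c₂} with hgdef
  have hrest : ∀ u ∈ rest f, u ≠ b → u ∈ rest g :=
    fun u hu hub => hf.1.mem_rest_update (Or.inr hu) (by simp [hub, hne hu hc₁, hne hu hc₂])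
  have hPg : ∀ s ∈ P.support, s ∈ rest g :=
    fun s hs => hrest s (hPR s hs) (by rintro rfl; exact hbP hs)
  have hcg : c₃ ∈ rest g := hf.1.mem_rest_update (Or.inl hc₃)
    (by simp [(hne hb hc₃).symm, hc.2.1.ne', hc.2.2.1.ne'])
  -- The only neighbours of `c₃` outside the packing are `a` and possibly `b`.
  have hcz : ∀ z ∈ rest f, G.Adj c₃ z → z ≠ b → z = a := by
    intro z hz hcz hzb
    by_contra hza
    by_cases hzP : z ∈ P.support
    · obtain ⟨g', hg'⟩ := hf.1.exists_succ (i := i) (X := insert c₃ P.support.toFinset)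
        (containsCycle_of_path P hPp hcP hzP P.end_mem_support hza hcz h₃.symm (by simp)
          (by simp +contextual)) hbt (by
          intro e he
          rcases mem_insert.1 he with rfl | he
          · exact Or.inl hc₃
          · exact Or.inr (hPR e (List.mem_toFinset.1 he))) hbs (by
          intro e he he'
          have : e ∈ rest g := by
            rcases mem_insert.1 he with rfl | he
            · exact hcg
            · exact hPg e (List.mem_toFinset.1 he)
          exact mem_rest.1 this i (by simpa [hgdef] using he'))
      exact hno g' hg'
    · have := hlong g hg z y (Walk.cons hcz.symm (Walk.cons h₃.symm P.reverse))
        ((hPp.reverse.cons (by simpa using hcP)).cons (by simp [hzP, hcz.ne'])) (by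
          intro s hs
          simp only [Walk.support_cons, List.mem_cons, Walk.support_reverse,
            List.mem_reverse] at hs
          rcases hs with rfl | rfl | hs
          · exact hrest _ hz hzb
          · exact hcg
          · exact hPg s hs)
      simp at this
  have na : nbrCount G a (f i) = 3 := by simp [hc.nbrCount_eq, h₁, h₂, h₃]
  have nb : nbrCount G b (f i) = 2 + if G.Adj b c₃ then 1 else 0 := by
    simp [hc.nbrCount_eq, hb₁, hb₂]
  have nc : nbrCount G c₃ (f i) ≤ 2 := by
    refine (nbrCount_le_of_subset (S := {c₁, c₂}) ?_).trans card_le_two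
    intro u hu hcu
    rw [hc.2.2.2] at hu
    have := hcu.ne'
    simp only [mem_insert, mem_singleton] at hu ⊢
    tauto
  have ncR : nbrCount G c₃ (rest f) ≤ 1 + if G.Adj b c₃ then 1 else 0 := by
    split_ifs with hbc
    · refine (nbrCount_le_of_subset (S := {a, b}) ?_).trans card_le_two
      intro z hz hz'
      have := hcz z hz hz'
      simp only [mem_insert, mem_singleton]
      tauto
    · refine (nbrCount_le_of_subset (S := {a}) ?_).trans (by simp)
      intro z hz hz'
      exact mem_singleton.2 (hcz z hz hz' (by rintro rfl; exact hbc hz'.symm))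
  have ny : nbrCount G y (f i) = 0 :=
    hf.nbrCount_second_eq_zero hno hby P hPp hbP hb hPR hya (by omega)
  obtain ⟨j, hji, hj⟩ : ∃ j, j ≠ i ∧ 13 ≤ nbrCount G a (f j) + nbrCount G b (f j) +
      2 * (nbrCount G y (f j) + nbrCount G c₃ (f j)) := by
    by_contra! hn
    have h1 := (hdeg a).trans (nbrCount_univ_le_erase f i a)
    have h2 := (hdeg b).trans (nbrCount_univ_le_erase f i b)
    have h3 := (hdeg y).trans (nbrCount_univ_le_erase f i y)
    have h4 := (hdeg c₃).trans (nbrCount_univ_le_erase f i c₃)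
    have h5 := sum_le_card_nsmul (univ.erase i) (fun j => nbrCount G a (f j) + nbrCount G b (f j) +
      2 * (nbrCount G y (f j) + nbrCount G c₃ (f j))) 12
      fun j hj => Nat.le_of_lt_succ (hn j (ne_of_mem_erase hj))
    simp only [sum_add_distrib, ← mul_sum, card_erase_of_mem (mem_univ i), card_univ,
      Fintype.card_fin, smul_eq_mul] at h5
    have := i.pos
    split_ifs at nb ncR <;> omega
  have hgj : g j = f j := Function.update_of_ne hji _ _
  obtain ⟨d₁, d₂, d₃, hd⟩ : ∃ d₁ d₂ d₃, IsTriangle G (f j) d₁ d₂ d₃ := by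
    rcases hf.triangle_or_nbrCount_le j with h' | h'
    · exact h'
    rcases hg.triangle_or_nbrCount_le j with h'' | h''
    · rwa [hgj] at h''
    have := h' a ha
    have := h' b hb
    have := h' y hy
    have := h'' c₃ hcg
    rw [hgj] at this
    omega
  have hle := hd.nbrCount_le
  have hsum : nbrCount G b (f j) + nbrCount G a (f j) ≤ 4 := by
    by_contra hn
    have h0 := hf.nbrCount_second_eq_zero hno hby P hPp hbP hb hPR hya (i := j) (by omega)
    have := hle a
    have := hle b
    have := hle c₃
    omega
  have ha0 : nbrCount G a (g j) = 0 := by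
    refine hg.nbrCount_second_eq_zero hno h₃.symm P.reverse hPp.reverse (by simpa using hcP) hcg
      (by simpa using hPg) hya.symm ?_
    rw [hgj]
    omega
  rw [hgj] at ha0
  obtain ⟨x₁, x₂, x₃, hx, h1, h2, h3, h4⟩ := hd.exists_common (b := b) (c := c₃) (y := y) (by omega)
  exact hf.false_of_triangles hno hji ha hb hy hab hya.symm hby hc hx h₁ h₂ h1 h2 h3 h4

theorem IsPacking.exists_succ_of_three_le_card_rest {f : Fin k → Finset V} (hf : IsPacking G f)
    (hR : 3 ≤ #(rest f)) (hdeg : ∀ v, 2 * k + 2 ≤ nbrCount G v univ) :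
    ∃ g : Fin (k + 1) → Finset V, IsPacking G g := by
  by_contra! hno
  obtain ⟨f, a, b, w, h, hR⟩ := hf.exists_isOptimal hR
  have hlen := h.two_le_length hno hdeg hR
  obtain ⟨i, hi⟩ := exists_five_le hdeg (h.nbrCount_rest_le_one hno)
    (h.reverse.nbrCount_rest_le_one hno)
  obtain ⟨_, _, _, ht⟩ := h.isMin.exists_triangle (h.subset a w.start_mem_support)
    (h.subset b w.end_mem_support) hi
  obtain ⟨c₁, c₂, c₃, hc, ⟨h1, h2, h3, h4, h5⟩ | ⟨h1, h2, h3, h4, h5⟩⟩ := ht.exists_full hi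
  · exact h.reverse.false_of_ends hno hdeg (by simpa using hlen) hc h1 h2 h3 h4 h5
  · exact h.false_of_ends hno hdeg hlen hc h1 h2 h3 h4 h5

end

theorem ContainsCycle.of_sup_edge {x y : V} {T : Finset V}
    (h : ContainsCycle (G ⊔ SimpleGraph.edge x y) T) (hT : ¬ (x ∈ T ∧ y ∈ T)) :
    ContainsCycle G T := by
  obtain ⟨v, c, hc, hcT⟩ := h
  have he : ∀ e ∈ c.edges, e ∈ G.edgeSet := by
    intro e he
    induction e with
    | _ s t =>
    have hadj := c.adj_of_mem_edges he
    rw [SimpleGraph.sup_adj, SimpleGraph.edge_adj] at hadj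
    rcases hadj with hadj | ⟨⟨rfl, rfl⟩ | ⟨rfl, rfl⟩, -⟩
    · exact hadj
    · exact absurd ⟨hcT _ (c.fst_mem_support_of_mem_edges he),
        hcT _ (c.snd_mem_support_of_mem_edges he)⟩ hT
    · exact absurd ⟨hcT _ (c.snd_mem_support_of_mem_edges he),
        hcT _ (c.fst_mem_support_of_mem_edges he)⟩ hT
  exact ⟨v, c.transfer G he, hc.transfer he, by simpa using hcT⟩

theorem exists_isPacking_top [Fintype V] (hcard : 3 * k ≤ Fintype.card V) :
    ∃ f : Fin k → Finset V, IsPacking (⊤ : SimpleGraph V) f := by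
  classical
  obtain ⟨e⟩ : Nonempty (Fin k × Fin 3 ↪ V) := by
    rw [Function.Embedding.nonempty_iff_card_le]
    simpa [mul_comm] using hcard
  refine ⟨fun i => {e (i, 0), e (i, 1), e (i, 2)}, fun i => ?_, fun i j hij => ?_⟩
  · apply containsCycle_triangle <;> simp
  · rw [Finset.disjoint_left]
    intro v hv hv'
    simp only [mem_insert, mem_singleton] at hv hv'
    rcases hv with rfl | rfl | rfl <;> simp [hij] at hv'

theorem exists_isPacking [Fintype V] (hcard : 3 * (k + 1) ≤ Fintype.card V) (G : SimpleGraph V)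
    (hdeg : ∀ v, 2 * k + 2 ≤ nbrCount G v univ) :
    ∃ f : Fin (k + 1) → Finset V, IsPacking G f := by
  classical
  induction G using WellFoundedGT.induction with
  | ind G ih =>
  by_cases htop : G = ⊤
  · subst htop
    exact exists_isPacking_top hcard
  obtain ⟨x, y, hxy, hadj⟩ := SimpleGraph.ne_top_iff_exists_not_adj.1 htop
  obtain ⟨f, hf⟩ := ih _ (G.lt_sup_edge x y hxy hadj) fun v =>
    (hdeg v).trans (nbrCount_mono (G.lt_sup_edge x y hxy hadj).le v univ)
  by_cases hi : ∃ i, x ∈ f i ∧ y ∈ f i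
  · obtain ⟨i, hxi, hyi⟩ := hi
    have hg : IsPacking G (f ∘ i.succAbove) := by
      refine ⟨fun j => (hf.1 _).of_sup_edge fun h => ?_, fun j l hjl => hf.2 _ _ (by simpa using hjl)⟩
      exact Finset.disjoint_left.1 (hf.2 _ _ (i.succAbove_ne j)) h.1 hxi
    refine hg.exists_succ_of_three_le_card_rest
      ((hf.1 i).three_le_card.trans (card_le_card fun v hv => ?_)) hdeg
    rw [mem_rest]
    exact fun j hvj => Finset.disjoint_left.1 (hf.2 _ _ (i.succAbove_ne j)) hvj hv
  · push Not at hi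
    exact ⟨f, fun i => (hf.1 i).of_sup_edge fun h => hi i h.1 h.2, hf.2⟩

end CorradiHajnal

theorem corradi_hajnal {V : Type*} [Fintype V] (G : SimpleGraph V) [DecidableRel G.Adj]
    (k : ℕ) (hk : 0 < k) (hcard : 3 * k ≤ Fintype.card V)
    (hdeg : ∀ v : V, 2 * k ≤ G.degree v) :
    HasDisjointCycles G k := by
  obtain ⟨k, rfl⟩ := Nat.exists_eq_add_one.2 hk
  obtain ⟨f, hf, hd⟩ := CorradiHajnal.exists_isPacking hcard G fun v => by
    refine (hdeg v).trans (le_of_eq ?_)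
    unfold CorradiHajnal.nbrCount
    rw [← G.card_neighborFinset_eq_degree]
    congr 1
    ext u
    simp
  choose v c hc hs using hf
  exact ⟨v, c, hc, fun i j hij x hx hx' =>
    Finset.disjoint_left.1 (hd i j hij) (hs i x hx) (hs j x hx')⟩
end

section
/- Let k ≥ 3 be an integer and G a finite simple graph with |H_k(G)| − |L_k(G)| ≥ k² + 2k − 4. Then G contains k pairwise vertex-disjoint cycles. (Dirac–Erdős Theorem.) -/
open Finset

/-- `H_k(G)`: the set of vertices of degree at least `2k`. -/
def Hset {V : Type*} [Fintype V] (G : SimpleGraph V) [DecidableRel G.Adj] (k : ℕ) : Finset V :=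
  univ.filter fun v => 2 * k ≤ G.degree v

/-- `L_k(G)`: the set of vertices of degree at most `2k - 2`. -/
def Lset {V : Type*} [Fintype V] (G : SimpleGraph V) [DecidableRel G.Adj] (k : ℕ) : Finset V :=
  univ.filter fun v => G.degree v ≤ 2 * k - 2

namespace DisjointCycles

variable {V : Type*}

section

open scoped Classical

/-- The number of neighbours of `v` in the finite set `U`. -/
noncomputable def degIn (G : SimpleGraph V) (U : Finset V) (v : V) : ℕ :=
  (U.filter fun u => G.Adj v u).card

/-- A nonempty finite set of vertices inducing a subgraph of minimum degree at least two. -/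
def IsCore (G : SimpleGraph V) (S : Finset V) : Prop :=
  S.Nonempty ∧ ∀ v ∈ S, 2 ≤ degIn G S v

/-- `U` induces a forest in `G`. -/
def IsForestOn (G : SimpleGraph V) (U : Finset V) : Prop :=
  ∀ S ⊆ U, ¬ IsCore G S

/-- `U` contains `k` pairwise disjoint cores. -/
def Packs (G : SimpleGraph V) : ℕ → Finset V → Prop
  | 0, _ => True
  | k + 1, U => ∃ S ⊆ U, IsCore G S ∧ Packs G k (U \ S)

lemma degIn_mono {G H : SimpleGraph V} (hGH : G ≤ H) {A B : Finset V} (h : A ⊆ B) (v : V) :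
    degIn G A v ≤ degIn H B v :=
  card_le_card fun x hx => by
    simp only [mem_filter] at hx ⊢
    exact ⟨h hx.1, hGH hx.2⟩

lemma degIn_le_card (G : SimpleGraph V) (A : Finset V) (v : V) : degIn G A v ≤ A.card :=
  card_filter_le _ _

lemma degIn_union (G : SimpleGraph V) {A B : Finset V} (h : Disjoint A B) (v : V) :
    degIn G (A ∪ B) v = degIn G A v + degIn G B v := by
  unfold degIn
  rw [filter_union, card_union_of_disjoint (disjoint_filter_filter h)]

lemma degIn_sdiff (G : SimpleGraph V) {S U : Finset V} (h : S ⊆ U) (v : V) :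
    degIn G U v = degIn G (U \ S) v + degIn G S v := by
  rw [← degIn_union G sdiff_disjoint, sdiff_union_of_subset h]

lemma degIn_insert (G : SimpleGraph V) {U : Finset V} {x : V} (h : x ∉ U) (v : V) :
    degIn G (insert x U) v = degIn G U v + if G.Adj v x then 1 else 0 := by
  unfold degIn
  rw [filter_insert]
  split_ifs with hx
  · rw [card_insert_of_notMem (by simp [h])]
  · rfl

lemma degIn_erase (G : SimpleGraph V) {U : Finset V} {x : V} (h : x ∈ U) (v : V) :
    degIn G U v = degIn G (U.erase x) v + if G.Adj v x then 1 else 0 := by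
  rw [← degIn_insert G (notMem_erase x U), insert_erase h]

lemma degIn_empty (G : SimpleGraph V) (v : V) : degIn G ∅ v = 0 := by simp [degIn]

lemma degIn_singleton (G : SimpleGraph V) (x v : V) :
    degIn G {x} v = if G.Adj v x then 1 else 0 := by
  rw [← insert_empty_eq, degIn_insert G (by simp), degIn_empty, zero_add]

lemma degIn_pos {G : SimpleGraph V} {U : Finset V} {v : V} :
    0 < degIn G U v ↔ ∃ u ∈ U, G.Adj v u := by
  simp [degIn, card_pos, Finset.Nonempty]

lemma two_le_degIn {G : SimpleGraph V} {U : Finset V} {v a b : V} (ha : a ∈ U) (hb : b ∈ U)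
    (hab : a ≠ b) (hva : G.Adj v a) (hvb : G.Adj v b) : 2 ≤ degIn G U v := by
  rw [← card_pair hab]
  refine card_le_card fun x hx => ?_
  simp only [mem_insert, mem_singleton] at hx
  rcases hx with rfl | rfl <;> simp [*]

lemma sum_degIn_comm (G : SimpleGraph V) (A B : Finset V) :
    ∑ x ∈ A, degIn G B x = ∑ x ∈ B, degIn G A x := by
  have h := sum_card_bipartiteAbove_eq_sum_card_bipartiteBelow (s := A) (t := B) G.Adj
  simp only [bipartiteAbove, bipartiteBelow] at h
  simp only [degIn, h]
  exact sum_congr rfl fun x _ => by simp only [G.adj_comm]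

lemma IsForestOn.mono {G : SimpleGraph V} {A B : Finset V} (hB : IsForestOn G B) (h : A ⊆ B) :
    IsForestOn G A :=
  fun S hS => hB S (hS.trans h)

lemma IsForestOn.exists_degIn_le_one {G : SimpleGraph V} {A : Finset V} (hA : IsForestOn G A)
    (hne : A.Nonempty) : ∃ v ∈ A, degIn G A v ≤ 1 := by
  by_contra! h
  exact hA A subset_rfl ⟨hne, fun v hv => h v hv⟩

lemma sum_degIn_erase (G : SimpleGraph V) {A : Finset V} {v : V} (hv : v ∈ A) :
    ∑ x ∈ A, degIn G A x = ∑ x ∈ A.erase v, degIn G (A.erase v) x + 2 * degIn G A v := by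
  have hself : degIn G (A.erase v) v = degIn G A v := by
    rw [degIn_erase G hv v]; simp
  have hsum : ∑ x ∈ A.erase v, (if G.Adj x v then 1 else 0) = degIn G A v := by
    rw [← hself, sum_congr rfl fun x _ => (degIn_singleton G v x).symm, sum_degIn_comm,
      sum_singleton]
  rw [← add_sum_erase A _ hv, sum_congr rfl fun x _ => degIn_erase G hv x, sum_add_distrib, hsum]
  ring

lemma IsForestOn.sum_degIn_add_two_le {G : SimpleGraph V} {A : Finset V} (hA : IsForestOn G A)
    (hne : A.Nonempty) : ∑ x ∈ A, degIn G A x + 2 ≤ 2 * A.card := by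
  induction A using Finset.strongInduction with
  | H A ih =>
    obtain ⟨v, hv, hdv⟩ := hA.exists_degIn_le_one hne
    rw [sum_degIn_erase G hv]
    have hcard := card_erase_add_one hv
    rcases (A.erase v).eq_empty_or_nonempty with he | he
    · have h0 : degIn G A v = 0 := by
        rw [degIn_erase G hv v, he, degIn_empty]; simp
      rw [he] at hcard ⊢
      simp [h0] at hcard ⊢
      omega
    · have := ih _ (erase_ssubset hv) (hA.mono (erase_subset _ _)) he
      omega

lemma Packs.mono {G H : SimpleGraph V} (hGH : G ≤ H) {k : ℕ} {A B : Finset V} (h : A ⊆ B)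
    (hA : Packs G k A) : Packs H k B := by
  induction k generalizing A B with
  | zero => trivial
  | succ k ih =>
    obtain ⟨S, hS, hcore, hrest⟩ := hA
    exact ⟨S, hS.trans h, ⟨hcore.1, fun v hv => (hcore.2 v hv).trans (degIn_mono hGH subset_rfl v)⟩,
      ih (sdiff_subset_sdiff h subset_rfl) hrest⟩

lemma Packs.of_core {G : SimpleGraph V} {k : ℕ} {S U : Finset V} (hS : IsCore G S) (hSU : S ⊆ U)
    (h : Packs G k (U \ S)) : Packs G (k + 1) U :=
  ⟨S, hSU, hS, h⟩

lemma packs_one_of_not_isForestOn {G : SimpleGraph V} {U : Finset V} (h : ¬ IsForestOn G U) :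
    Packs G 1 U := by
  simp only [IsForestOn, not_forall, not_not] at h
  obtain ⟨S, hS, hc⟩ := h
  exact ⟨S, hS, hc, trivial⟩

lemma isForestOn_sdiff {G : SimpleGraph V} {S U A : Finset V} (hU : ¬ Packs G 2 U)
    (hS : IsCore G S) (hSU : S ⊆ U) (hA : A ⊆ U \ S) : IsForestOn G A := by
  by_contra h
  exact hU (Packs.of_core hS hSU ((packs_one_of_not_isForestOn h).mono le_rfl hA))

lemma isCore_triangle {G : SimpleGraph V} {a b c : V} (hab : G.Adj a b) (hac : G.Adj a c)
    (hbc : G.Adj b c) : IsCore G {a, b, c} := by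
  refine ⟨⟨a, by simp⟩, fun v hv => ?_⟩
  simp only [mem_insert, mem_singleton] at hv
  rcases hv with rfl | rfl | rfl
  · exact two_le_degIn (a := b) (b := c) (by simp) (by simp) hbc.ne hab hac
  · exact two_le_degIn (a := a) (b := c) (by simp) (by simp) hac.ne hab.symm hbc
  · exact two_le_degIn (a := a) (b := b) (by simp) (by simp) hab.ne hac.symm hbc.symm

lemma IsCore.exists_isCycle {G : SimpleGraph V} {S : Finset V} (hS : IsCore G S) :
    ∃ (v : V) (c : G.Walk v v), c.IsCycle ∧ ∀ x ∈ c.support, x ∈ S := by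
  let f := (SimpleGraph.Embedding.induce (G := G) (S : Set V))
  have hnot : ¬ (G.induce (S : Set V)).IsAcyclic := by
    intro hac
    have : Nonempty (S : Set V) := by
      obtain ⟨x, hx⟩ := hS.1
      exact ⟨⟨x, hx⟩⟩
    obtain ⟨u, v, p, hp, hmax⟩ :=
      SimpleGraph.Walk.exists_isPath_forall_isPath_length_le_length (G.induce (S : Set V))
    have hnbr : ∀ w : (S : Set V), G.Adj v w → w = p.penultimate := by
      intro w hw
      have hadj : (G.induce (S : Set V)).Adj v w := hw
      refine hac.eq_penultimate_of_adj_end hp hadj ?_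
      by_contra hsupp
      have := hmax _ _ _ (hp.concat hsupp hadj)
      simp at this
    have h2 := hS.2 v v.2
    obtain ⟨x, hx, y, hy, hxy⟩ := one_lt_card.mp (lt_of_lt_of_le one_lt_two h2)
    simp only [mem_filter] at hx hy
    have h1 := hnbr ⟨x, hx.1⟩ hx.2
    have h2 := hnbr ⟨y, hy.1⟩ hy.2
    exact hxy (congrArg Subtype.val (h1.trans h2.symm))
  simp only [SimpleGraph.IsAcyclic, not_forall, not_not] at hnot
  obtain ⟨v, c, hc⟩ := hnot
  refine ⟨f v, c.map f.toHom, hc.map f.injective, fun x hx => ?_⟩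
  rw [SimpleGraph.Walk.support_map, List.mem_map] at hx
  obtain ⟨y, -, rfl⟩ := hx
  exact y.2

lemma Packs.exists_isCycle {G : SimpleGraph V} {k : ℕ} {U : Finset V} (h : Packs G k U) :
    ∃ (v : Fin k → V) (c : ∀ i, G.Walk (v i) (v i)), (∀ i, (c i).IsCycle) ∧
      (∀ i, ∀ x ∈ (c i).support, x ∈ U) ∧
      ∀ i j, i ≠ j → ∀ x, x ∈ (c i).support → x ∉ (c j).support := by
  induction k generalizing U with
  | zero => exact ⟨Fin.elim0, fun i => i.elim0, fun i => i.elim0, fun i => i.elim0, fun i => i.elim0⟩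
  | succ k ih =>
    obtain ⟨S, hSU, hS, hrest⟩ := h
    obtain ⟨w, d, hd, hdS⟩ := hS.exists_isCycle
    obtain ⟨v, c, hc, hcU, hdisj⟩ := ih hrest
    refine ⟨Fin.cons w v, Fin.cons d c, ?_, ?_, ?_⟩
    · exact Fin.cases hd hc
    · exact Fin.cases (fun x hx => hSU (hdS x hx)) fun i x hx => (mem_sdiff.mp (hcU i x hx)).1
    · refine Fin.cases (Fin.cases (fun h => (h rfl).elim) fun j _ x hx hx' => ?_) fun i =>
        Fin.cases (fun _ x hx hx' => ?_) fun j hij x hx hx' => ?_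
      · exact (mem_sdiff.mp (hcU j x hx')).2 (hdS x hx)
      · exact (mem_sdiff.mp (hcU i x hx)).2 (hdS x hx')
      · exact hdisj i j (fun h => hij (congrArg Fin.succ h)) x hx hx'

/-- `1`, `0` or `-1` according to whether `d` is at least `2k`, equal to `2k - 1`, or smaller. -/
def score (k d : ℕ) : ℤ :=
  if 2 * k ≤ d then 1 else if d + 2 ≤ 2 * k then -1 else 0

/-- The sum over `A` of the scores of the degrees into `U`. -/
noncomputable def total (G : SimpleGraph V) (k : ℕ) (A U : Finset V) : ℤ :=
  ∑ x ∈ A, score k (degIn G U x)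

lemma score_mono (k : ℕ) {d e : ℕ} (h : d ≤ e) : score k d ≤ score k e := by
  unfold score; split_ifs <;> omega

lemma score_le_one (k d : ℕ) : score k d ≤ 1 := by
  unfold score; split_ifs <;> omega

lemma score_succ_le (k d : ℕ) : score k (d + 1) ≤ score k d + 1 := by
  unfold score; split_ifs <;> omega

lemma total_le_card (G : SimpleGraph V) (k : ℕ) (A U : Finset V) : total G k A U ≤ A.card := by
  unfold total
  calc _ ≤ ∑ x ∈ A, (1 : ℤ) := sum_le_sum fun x _ => score_le_one k _
    _ = _ := by simp

lemma total_sdiff_add (G : SimpleGraph V) (k : ℕ) {S A : Finset V} (U : Finset V) (h : S ⊆ A) :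
    total G k (A \ S) U + total G k S U = total G k A U :=
  sum_sdiff h

lemma total_erase_add (G : SimpleGraph V) (k : ℕ) {A : Finset V} (U : Finset V) {v : V}
    (h : v ∈ A) : score k (degIn G U v) + total G k (A.erase v) U = total G k A U :=
  add_sum_erase A (fun x => score k (degIn G U x)) h

lemma total_le_total_erase {G : SimpleGraph V} {k : ℕ} {A U : Finset V} {v : V} (hv : v ∈ A)
    (hAU : A ⊆ U) (hA : degIn G A v ≤ 1) (hU : degIn G U v + 2 ≤ 2 * k) :
    total G k A U ≤ total G k (A.erase v) (U.erase v) := by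
  have hs : score k (degIn G U v) = -1 := by unfold score; split_ifs <;> omega
  rw [← total_erase_add G k U hv, hs]
  have hpt : ∀ x ∈ A.erase v, score k (degIn G U x) ≤
      score k (degIn G (U.erase v) x) + (degIn G {v} x : ℕ) := by
    intro x _
    rw [degIn_erase G (hAU hv) x, degIn_singleton]
    split_ifs
    · exact_mod_cast score_succ_le _ _
    · simp
  have hsum := sum_le_sum hpt
  rw [sum_add_distrib, ← Nat.cast_sum, sum_degIn_comm, sum_singleton] at hsum
  have := degIn_mono (le_refl G) (erase_subset v A) v
  unfold total
  have h1 : ((degIn G (A.erase v) v : ℕ) : ℤ) ≤ 1 := by exact_mod_cast this.trans hA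
  linarith

/-- The graph in which `y` has been made adjacent to all the neighbours of `x`. After deletion of
`x` this is the contraction of the edge `xy` onto `y`. -/
def contract (G : SimpleGraph V) (x y : V) : SimpleGraph V where
  Adj a b := G.Adj a b ∨ (a = y ∧ b ≠ y ∧ G.Adj x b) ∨ (b = y ∧ a ≠ y ∧ G.Adj x a)
  symm := ⟨fun a b h => by
    rcases h with h | h | h
    · exact Or.inl h.symm
    · exact Or.inr (Or.inr h)
    · exact Or.inr (Or.inl h)⟩
  loopless := ⟨fun a h => by
    rcases h with h | h | h
    · exact h.ne rfl
    · exact h.2.1 h.1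
    · exact h.2.1 h.1⟩

lemma le_contract (G : SimpleGraph V) (x y : V) : G ≤ contract G x y :=
  fun _ _ h => Or.inl h

lemma contract_adj_of_ne {G : SimpleGraph V} {x y a b : V} (ha : a ≠ y) (hb : b ≠ y) :
    (contract G x y).Adj a b ↔ G.Adj a b := by
  simp [contract, ha, hb]

lemma degIn_le_degIn_contract {G : SimpleGraph V} {x y z : V} {U : Finset V} (hy : y ∈ U)
    (hxy : x ≠ y) (hzy : z ≠ y) (h : ¬ (G.Adj x z ∧ G.Adj y z)) :
    degIn G U z ≤ degIn (contract G x y) (U.erase x) z := by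
  refine card_le_card_of_injOn (fun u => if u = x then y else u) ?_ ?_
  · intro u hu
    simp only [coe_filter, Set.mem_ofPred_eq, mem_erase] at hu ⊢
    split_ifs with hux
    · subst hux
      exact ⟨⟨hxy.symm, hy⟩, Or.inr (Or.inr ⟨rfl, hzy, hu.2.symm⟩)⟩
    · exact ⟨⟨hux, hu.1⟩, Or.inl hu.2⟩
  · intro u hu w hw huw
    simp only [coe_filter, Set.mem_ofPred_eq] at hu hw
    dsimp only at huw
    split_ifs at huw with h1 h2 h2
    · exact h1.trans h2.symm
    · subst h1 huw
      exact (h ⟨hu.2.symm, hw.2.symm⟩).elim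
    · subst h2 huw
      exact (h ⟨hw.2.symm, hu.2.symm⟩).elim
    · exact huw

lemma degIn_add_degIn_le_degIn_contract {G : SimpleGraph V} {x y : V} {U : Finset V} (hx : x ∈ U)
    (hy : y ∈ U) (hxy : G.Adj x y) (h : ∀ z ∈ U, ¬ (G.Adj x z ∧ G.Adj y z)) :
    degIn G U x + degIn G U y ≤ degIn (contract G x y) (U.erase x) y + 2 := by
  rw [degIn_erase G hy x, degIn_erase G hx y, if_pos hxy, if_pos hxy.symm]
  have hdisj : Disjoint ((U.erase y).filter fun u => G.Adj x u)
      ((U.erase x).filter fun u => G.Adj y u) := by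
    rw [Finset.disjoint_left]
    intro z hz hz'
    simp only [mem_filter, mem_erase] at hz hz'
    exact h z hz.1.2 ⟨hz.2, hz'.2⟩
  have hsub : ((U.erase y).filter fun u => G.Adj x u) ∪ ((U.erase x).filter fun u => G.Adj y u) ⊆
      (U.erase x).filter fun u => (contract G x y).Adj y u := by
    intro z hz
    simp only [mem_union, mem_filter, mem_erase] at hz ⊢
    rcases hz with hz | hz
    · exact ⟨⟨hz.2.ne', hz.1.2⟩, Or.inr (Or.inl ⟨rfl, hz.1.1, hz.2⟩)⟩
    · exact ⟨hz.1, Or.inl hz.2⟩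
  have := card_le_card hsub
  rw [card_union_of_disjoint hdisj] at this
  unfold degIn
  omega

lemma total_le_total_contract {G : SimpleGraph V} {k : ℕ} {x y : V} {A U : Finset V} (hx : x ∈ A)
    (hy : y ∈ A) (hAU : A ⊆ U) (hxy : G.Adj x y) (h : ∀ z ∈ U, ¬ (G.Adj x z ∧ G.Adj y z)) :
    total G k A U - score k (degIn G U x) - score k (degIn G U y) +
        score k (degIn G U x + degIn G U y - 2) ≤
      total (contract G x y) k (A.erase x) (U.erase x) := by
  have hyx : y ∈ A.erase x := mem_erase.mpr ⟨hxy.ne', hy⟩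
  rw [← total_erase_add G k U hx, ← total_erase_add G k U hyx,
    ← total_erase_add (contract G x y) k (U.erase x) hyx]
  have h1 : total G k ((A.erase x).erase y) U ≤
      total (contract G x y) k ((A.erase x).erase y) (U.erase x) := by
    refine sum_le_sum fun z hz => score_mono k ?_
    simp only [mem_erase] at hz
    exact degIn_le_degIn_contract (hAU hy) hxy.ne hz.1 (h z (hAU hz.2.2))
  have h2 := score_mono k (Nat.sub_le_iff_le_add.mpr
    (degIn_add_degIn_le_degIn_contract (hAU hx) (hAU hy) hxy h))
  linarith

lemma IsCore.exists_of_contract {G : SimpleGraph V} {x y : V} {S : Finset V} (hxy : G.Adj x y)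
    (hx : x ∉ S) (hy : y ∈ S) (hS : IsCore (contract G x y) S) :
    ∃ T ⊆ insert x S, IsCore G T := by
  by_contra! hforest
  have hbound := IsForestOn.sum_degIn_add_two_le hforest ⟨x, mem_insert_self x S⟩
  rw [sum_insert hx, ← add_sum_erase S _ hy, card_insert_of_notMem hx] at hbound
  have hother : ∀ z ∈ S.erase y, 2 ≤ degIn G (insert x S) z := by
    intro z hz
    simp only [mem_erase] at hz
    refine (hS.2 z hz.2).trans (card_le_card_of_injOn
      (fun u => if u = y then (if G.Adj z y then y else x) else u) ?_ ?_)
    · intro u hu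
      simp only [coe_filter, Set.mem_ofPred_eq, mem_insert] at hu ⊢
      have := hz.1
      have := hxy.ne
      rcases hu with ⟨huS, h | h | h⟩
      · split_ifs <;> simp_all
      · exact absurd h.1 hz.1
      · split_ifs with h1 h2
        · exact ⟨Or.inr hy, h2⟩
        · exact ⟨Or.inl rfl, h.2.2.symm⟩
        · exact absurd h.1 h1
    · intro u hu w hw huw
      simp only [coe_filter, Set.mem_ofPred_eq] at hu hw
      dsimp only at huw
      split_ifs at huw <;> simp_all
  have hsum := sum_le_sum hother
  rw [sum_const, smul_eq_mul, card_erase_of_mem hy] at hsum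
  have hsub : (S.filter fun u => (contract G x y).Adj y u) ⊆
      (S.erase y).filter (fun u => G.Adj x u) ∪ S.filter (fun u => G.Adj y u) := by
    intro u hu
    simp only [mem_filter, mem_union, mem_erase] at hu ⊢
    rcases hu with ⟨huS, h | h | h⟩
    · exact Or.inr ⟨huS, h⟩
    · exact Or.inl ⟨⟨h.2.1, huS⟩, h.2.2⟩
    · exact absurd rfl h.2.1
  have hcard := (card_le_card hsub).trans (card_union_le _ _)
  have hdeg : 2 ≤ degIn G (S.erase y) x + degIn G S y := (hS.2 y hy).trans hcard
  have h1 := degIn_insert G hx x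
  have h2 := degIn_insert G hx y
  have h3 := degIn_erase G hy x
  rw [if_pos hxy] at h3
  rw [if_pos hxy.symm] at h2
  have h4 : 0 < S.card := card_pos.mpr ⟨y, hy⟩
  simp only [SimpleGraph.irrefl, if_false] at h1
  omega

lemma IsCore.of_contract {G : SimpleGraph V} {x y : V} {S : Finset V} (hy : y ∉ S)
    (hS : IsCore (contract G x y) S) : IsCore G S := by
  refine ⟨hS.1, fun v hv => (hS.2 v hv).trans (card_le_card fun u hu => ?_)⟩
  simp only [mem_filter] at hu ⊢
  exact ⟨hu.1, (contract_adj_of_ne (ne_of_mem_of_not_mem hv hy)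
    (ne_of_mem_of_not_mem hu.1 hy)).mp hu.2⟩

lemma Packs.of_contract_of_notMem {G : SimpleGraph V} {x y : V} {k : ℕ} {U : Finset V}
    (hy : y ∉ U) (h : Packs (contract G x y) k U) : Packs G k U := by
  induction k generalizing U with
  | zero => trivial
  | succ k ih =>
    obtain ⟨S, hSU, hS, hrest⟩ := h
    exact ⟨S, hSU, hS.of_contract (fun h => hy (hSU h)), ih (fun h => hy (mem_sdiff.mp h).1) hrest⟩

lemma Packs.of_contract {G : SimpleGraph V} {x y : V} {k : ℕ} {U : Finset V} (hxy : G.Adj x y)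
    (hx : x ∈ U) (h : Packs (contract G x y) k (U.erase x)) : Packs G k U := by
  induction k generalizing U with
  | zero => trivial
  | succ k ih =>
    obtain ⟨S, hSU, hS, hrest⟩ := h
    have hxS : x ∉ S := fun h => notMem_erase x U (hSU h)
    have hSU' : S ⊆ U := hSU.trans (erase_subset x U)
    by_cases hy : y ∈ S
    · obtain ⟨T, hT, hcore⟩ := hS.exists_of_contract hxy hxS hy
      refine ⟨T, hT.trans (insert_subset hx hSU'), hcore, ?_⟩
      refine (Packs.of_contract_of_notMem (fun h => (mem_sdiff.mp h).2 hy) hrest).mono le_rfl ?_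
      intro u hu
      simp only [mem_sdiff, mem_erase] at hu ⊢
      refine ⟨hu.1.2, fun h => ?_⟩
      rcases mem_insert.mp (hT h) with h | h
      · exact hu.1.1 h
      · exact hu.2 h
    · refine ⟨S, hSU', hS.of_contract hy, ih (mem_sdiff.mpr ⟨hx, hxS⟩) ?_⟩
      rwa [erase_sdiff_comm] at hrest

lemma IsForestOn.sum_degIn_union_le {G : SimpleGraph V} {A B : Finset V}
    (h : IsForestOn G (A ∪ B)) (hAB : Disjoint A B) (hB : B.Nonempty) :
    ∑ x ∈ A, degIn G A x + 2 * ∑ x ∈ A, degIn G B x + ∑ x ∈ B, degIn G B x + 2 ≤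
      2 * (A.card + B.card) := by
  have hs := h.sum_degIn_add_two_le (hB.mono subset_union_right)
  rw [sum_union hAB, card_union_of_disjoint hAB, sum_congr rfl fun x _ => degIn_union G hAB x,
    sum_congr (s₁ := B) rfl fun x _ => degIn_union G hAB x, sum_add_distrib, sum_add_distrib,
    sum_degIn_comm G B A] at hs
  omega

lemma score_two_le {d : ℕ} (h : 2 ≤ d) : score 2 d ≤ d - 3 := by
  unfold score; split_ifs <;> omega

lemma degIn_singleton_le_one (G : SimpleGraph V) (x v : V) : degIn G {x} v ≤ 1 :=
  degIn_le_card G {x} v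

lemma degIn_triple (G : SimpleGraph V) {a b c : V} (hab : a ≠ b) (hac : a ≠ c) (hbc : b ≠ c)
    (x : V) : degIn G {a, b, c} x = degIn G {a} x + degIn G {b} x + degIn G {c} x := by
  rw [degIn_insert G (by simp [hab, hac]), degIn_insert G (by simp [hbc]), degIn_singleton,
    degIn_singleton, degIn_singleton]
  ring

lemma sum_degIn_self_singleton (G : SimpleGraph V) (x : V) :
    ∑ z ∈ {x}, degIn G {x} z = 0 := by
  simp [degIn_singleton]

lemma total_two_le {G : SimpleGraph V} {A U : Finset V} (h : ∀ x ∈ A, 2 ≤ degIn G U x) :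
    total G 2 A U ≤ ((∑ x ∈ A, degIn G U x : ℕ) : ℤ) - 3 * A.card := by
  unfold total
  calc _ ≤ ∑ x ∈ A, ((degIn G U x : ℤ) - 3) := sum_le_sum fun x hx => score_two_le (h x hx)
    _ = _ := by simp [sum_sub_distrib, mul_comm]

lemma total_two_sdiff_nonpos {G : SimpleGraph V} {a b c v w : V} {F U : Finset V}
    (hU : U = F ∪ {a, b, c}) (haF : a ∉ F) (hbF : b ∉ F) (hcF : c ∉ F) (hab : a ≠ b) (hac : a ≠ c)
    (hbc : G.Adj b c) (hF : IsForestOn G F) (hP : ¬ Packs G 2 U)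
    (hmin : ∀ x ∈ F, 2 ≤ degIn G U x) (hv : v ∈ F) (hw : w ∈ F) (hvw : G.Adj v w)
    (hleaf : degIn G F v ≤ 1) (hav : G.Adj a v) (haw : G.Adj a w) :
    total G 2 (F \ {v, w}) U ≤ 0 := by
  have hTF : Disjoint F {a, b, c} := by simp [haF, hbF, hcF]
  have hsub : ({v, w} : Finset V) ⊆ F := by simp [insert_subset_iff, hv, hw]
  have hbF' : b ∉ F \ {v, w} := fun h => hbF (mem_sdiff.mp h).1
  have hcF' : c ∉ F \ {v, w} := fun h => hcF (mem_sdiff.mp h).1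
  have hbcF : Disjoint (F \ {v, w}) {b, c} := by simp [hbF', hcF']
  have hwF : Disjoint (F \ {v, w}) {w} := by simp
  have hforest : IsForestOn G (F \ {v, w} ∪ {b, c}) := by
    refine isForestOn_sdiff hP (isCore_triangle hav haw hvw) ?_ ?_
    · simp [hU, insert_subset_iff, hv, hw]
    · intro x hx
      simp only [mem_union, mem_sdiff, mem_insert, mem_singleton, hU] at hx ⊢
      rcases hx with hx | rfl | rfl
      · exact ⟨Or.inl hx.1, fun h => h.elim (fun h => haF (h ▸ hx.1)) hx.2⟩
      · refine ⟨by simp, ?_⟩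
        rintro (h | h | h)
        · exact hab h.symm
        · exact hbF (h ▸ hv)
        · exact hbF (h ▸ hw)
      · refine ⟨by simp, ?_⟩
        rintro (h | h | h)
        · exact hac h.symm
        · exact hcF (h ▸ hv)
        · exact hcF (h ▸ hw)
  have h1 := hforest.sum_degIn_union_le hbcF ⟨b, by simp⟩
  have hpair : ∑ x ∈ {b, c}, degIn G {b, c} x = 2 := by
    rw [sum_pair hbc.ne, degIn_insert G (by simp [hbc.ne]), degIn_insert G (by simp [hbc.ne])]
    simp [degIn_singleton, hbc, hbc.symm]
  have h2 := (hF.mono (A := F \ {v, w} ∪ {w}) (by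
    intro x hx
    simp only [mem_union, mem_sdiff, mem_singleton] at hx
    rcases hx with hx | rfl
    · exact hx.1
    · exact hw)).sum_degIn_union_le hwF ⟨w, by simp⟩
  rw [sum_degIn_self_singleton] at h2
  rw [hpair, card_pair hbc.ne] at h1
  rw [card_singleton] at h2
  have hdeg : ∀ x ∈ F \ {v, w}, degIn G U x ≤
      degIn G (F \ {v, w}) x + degIn G {w} x + degIn G {b, c} x + 1 := by
    intro x hx
    have hxF := (mem_sdiff.mp hx).1
    have hxv : ¬ G.Adj x v := by
      intro h
      have hxw : w ≠ x := fun h => (mem_sdiff.mp hx).2 (by simp [h])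
      have := two_le_degIn hw hxF hxw hvw h.symm
      omega
    have hvw' : degIn G {v, w} x = degIn G {w} x := by
      rw [degIn_insert G (by simp [hvw.ne]), if_neg hxv, add_zero]
    have h3 := degIn_sdiff G hsub x
    have h4 := degIn_insert G (U := {b, c}) (x := a) (by simp [hab, hac]) x
    rw [hU, degIn_union G hTF, h3, hvw', h4]
    split_ifs <;> omega
  have hsum := sum_le_sum hdeg
  simp only [sum_add_distrib, sum_const, smul_eq_mul, mul_one] at hsum
  have := total_two_le (A := F \ {v, w}) (U := U) (G := G) fun x hx => hmin x (mem_sdiff.mp hx).1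
  omega

lemma total_two_lt_of_apex {G : SimpleGraph V} {a b c v : V} {F U : Finset V}
    (hU : U = F ∪ {a, b, c}) (haF : a ∉ F) (hbF : b ∉ F) (hcF : c ∉ F) (hab : G.Adj a b)
    (hac : G.Adj a c) (hbc : G.Adj b c) (hcard : 3 ≤ F.card) (hP : ¬ Packs G 2 U)
    (hmin : ∀ x ∈ F, 2 ≤ degIn G U x) (hv : v ∈ F) (hleaf : degIn G F v ≤ 1)
    (hav : G.Adj v a) (hbv : G.Adj v b) (hcv : G.Adj v c) : total G 2 F U < 2 := by
  by_contra! htot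
  have hTF : Disjoint F {a, b, c} := by simp [haF, hbF, hcF]
  have hforest : ∀ p q r : V, G.Adj p q → G.Adj v p → G.Adj v q → p ∈ U → q ∈ U → r ∈ U →
      r ≠ p → r ≠ q → r ∉ F → p ∉ F → q ∉ F →
      ∑ x ∈ F.erase v, degIn G (F.erase v) x + 2 * ∑ x ∈ F.erase v, degIn G {r} x ≤
        2 * (F.erase v).card := by
    intro p q r hpq hvp hvq hpU hqU hrU hrp hrq hrF hpF hqF
    have hf : IsForestOn G (F.erase v ∪ {r}) := by
      refine isForestOn_sdiff hP (isCore_triangle hvp hvq hpq) ?_ ?_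
      · simp only [insert_subset_iff, singleton_subset_iff]
        exact ⟨hU ▸ mem_union_left _ hv, hpU, hqU⟩
      · intro x hx
        simp only [mem_union, mem_erase, mem_singleton, mem_sdiff, mem_insert] at hx ⊢
        rcases hx with ⟨hxv, hx⟩ | rfl
        · refine ⟨hU ▸ mem_union_left _ hx, ?_⟩
          rintro (h | h | h)
          · exact hxv h
          · exact hpF (h ▸ hx)
          · exact hqF (h ▸ hx)
        · refine ⟨hrU, ?_⟩
          rintro (h | h | h)
          · exact hrF (h ▸ hv)
          · exact hrp h
          · exact hrq h
    have hrF' : r ∉ F.erase v := fun h => hrF (mem_of_mem_erase h)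
    have := hf.sum_degIn_union_le (by simpa using hrF') ⟨r, by simp⟩
    rw [sum_degIn_self_singleton, card_singleton] at this
    omega
  have haU : a ∈ U := by simp [hU]
  have hbU : b ∈ U := by simp [hU]
  have hcU : c ∈ U := by simp [hU]
  have ha := hforest b c a hbc hbv hcv hbU hcU haU hab.ne hac.ne haF hbF hcF
  have hb := hforest a c b hac hav hcv haU hcU hbU hab.ne' hbc.ne hbF haF hcF
  have hc := hforest a b c hab hav hbv haU hbU hcU hac.ne' hbc.ne' hcF haF hbF
  have hdeg : ∀ x ∈ F.erase v, degIn G U x = degIn G (F.erase v) x + degIn G {v} x +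
      (degIn G {a} x + degIn G {b} x + degIn G {c} x) := by
    intro x _
    rw [hU, degIn_union G hTF, degIn_triple G hab.ne hac.ne hbc.ne, degIn_erase G hv x,
      degIn_singleton G v]
  have hsum : ∑ x ∈ F.erase v, degIn G U x = _ := sum_congr rfl hdeg
  have hvsum : ∑ x ∈ F.erase v, degIn G {v} x = degIn G F v := by
    rw [sum_degIn_comm, sum_singleton, degIn_erase G hv v]
    simp
  simp only [sum_add_distrib, hvsum] at hsum
  have htwo := total_two_le (A := F.erase v) (U := U) (G := G)
    fun x hx => hmin x (mem_of_mem_erase hx)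
  have hvU : degIn G U v = degIn G F v + 3 := by
    rw [hU, degIn_union G hTF, degIn_triple G hab.ne hac.ne hbc.ne]
    simp [degIn_singleton, hav, hbv, hcv]
  have hscore : score 2 (degIn G U v) ≤ degIn G F v := by
    have := score_two_le (d := degIn G U v) (by omega)
    omega
  rw [← total_erase_add G 2 U hv] at htot
  obtain ⟨w, hw, hvw⟩ := degIn_pos.mp (show 0 < degIn G F v by omega)
  have hwv : w ∈ F.erase v := mem_erase.mpr ⟨hvw.ne', hw⟩
  have hzero : ∑ x ∈ F.erase v, degIn G (F.erase v) x = 0 := by omega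
  have hle : ∀ r, ∑ x ∈ F.erase v, degIn G {r} x ≤ (F.erase v).card := fun r => by
    simpa using sum_le_sum fun x (_ : x ∈ F.erase v) => degIn_singleton_le_one G r x
  have hall : ∀ r, (F.erase v).card ≤ ∑ x ∈ F.erase v, degIn G {r} x →
      ∀ x ∈ F.erase v, G.Adj x r := by
    intro r hr x hx
    by_contra hxr
    have hlt : ∑ x ∈ F.erase v, degIn G {r} x < ∑ x ∈ F.erase v, 1 :=
      sum_lt_sum (fun x _ => degIn_singleton_le_one G r x)
        ⟨x, hx, by simp [degIn_singleton, hxr]⟩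
    simp only [sum_const, smul_eq_mul, mul_one] at hlt
    omega
  have hla := hle a
  have hlb := hle b
  have hlc := hle c
  have hadja := hall a (by omega)
  have hadjb := hall b (by omega)
  have hadjc := hall c (by omega)
  have hcard' := card_erase_of_mem hv
  have hcard'' := card_erase_of_mem hwv
  obtain ⟨u, hu⟩ := card_pos.mp (show 0 < ((F.erase v).erase w).card by omega)
  simp only [mem_erase] at hu
  have huF : u ∈ F.erase v := mem_erase.mpr ⟨hu.2.1, hu.2.2⟩
  refine isForestOn_sdiff hP (isCore_triangle hvw hav (hadja w hwv)) ?_ ?_ _ subset_rfl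
    (isCore_triangle (hadjb u huF) (hadjc u huF) hbc)
  · simp only [insert_subset_iff, singleton_subset_iff]
    exact ⟨hU ▸ mem_union_left _ hv, hU ▸ mem_union_left _ hw, haU⟩
  · intro x hx
    have h1 : ∀ {z y}, z ∈ F → y ∉ F → y ≠ z := fun hz hy h => hy (h ▸ hz)
    simp only [mem_insert, mem_singleton, mem_sdiff, not_or] at hx ⊢
    rcases hx with rfl | rfl | rfl
    · exact ⟨hU ▸ mem_union_left _ hu.2.2, hu.2.1, hu.1, (h1 hu.2.2 haF).symm⟩
    · exact ⟨hbU, h1 hv hbF, h1 hw hbF, hab.ne'⟩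
    · exact ⟨hcU, h1 hv hcF, h1 hw hcF, hac.ne'⟩

lemma IsForestOn.contract_leaf {G : SimpleGraph V} {v w : V} {F : Finset V} (hF : IsForestOn G F)
    (hw : w ∈ F) (hvw : G.Adj v w) (hleaf : degIn G F v ≤ 1) :
    IsForestOn (contract G v w) (F.erase v) := by
  have honly : ∀ u ∈ F, u ≠ w → ¬ G.Adj v u := by
    intro u hu huw h
    have := two_le_degIn hw hu huw.symm hvw h
    omega
  intro S hS hcore
  refine hF S (hS.trans (erase_subset v F))
    ⟨hcore.1, fun x hx => (hcore.2 x hx).trans (card_le_card fun u hu => ?_)⟩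
  simp only [mem_filter] at hu ⊢
  refine ⟨hu.1, ?_⟩
  rcases hu.2 with h | h | h
  · exact h
  · exact absurd h.2.2 (honly u (mem_of_mem_erase (hS hu.1)) h.2.1)
  · exact absurd h.2.2 (honly x (mem_of_mem_erase (hS hx)) h.2.1)

theorem packs_two_of_triangle_of_isForestOn {G : SimpleGraph V} {a b c : V} {F U : Finset V}
    (hU : U = F ∪ {a, b, c}) (haF : a ∉ F) (hbF : b ∉ F) (hcF : c ∉ F) (hab : G.Adj a b)
    (hac : G.Adj a c) (hbc : G.Adj b c) (hF : IsForestOn G F) (hcard : 3 ≤ F.card)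
    (htot : 2 ≤ total G 2 F U) : Packs G 2 U := by
  induction hn : F.card using Nat.strong_induction_on generalizing G F U with
  | _ n ih =>
  subst hn
  have hFU : F ⊆ U := hU ▸ subset_union_left
  have hTF : Disjoint F {a, b, c} := by simp [haF, hbF, hcF]
  have hTU : ({a, b, c} : Finset V) ⊆ U := hU ▸ subset_union_right
  have haU : a ∈ U := hTU (by simp)
  have hbU : b ∈ U := hTU (by simp)
  have hcU : c ∈ U := hTU (by simp)
  have hUerase : ∀ v ∈ F, U.erase v = F.erase v ∪ {a, b, c} := by
    intro v hv
    rw [hU, erase_union_distrib, erase_eq_of_notMem (s := {a, b, c})]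
    exact Finset.disjoint_left.mp hTF hv
  by_contra hP
  have hsmall : ∀ v ∈ F, degIn G F v ≤ 1 → 3 ≤ degIn G U v := by
    intro v hv hleaf
    by_contra! hlt
    have hs : score 2 (degIn G U v) = -1 := by unfold score; split_ifs <;> omega
    have h1 := total_erase_add G 2 U hv
    have h2 := total_le_card G 2 (F.erase v) U
    have h3 := card_erase_add_one hv
    refine hP ((ih (F.erase v).card (by omega) (hUerase v hv)
      (fun h => haF (mem_of_mem_erase h)) (fun h => hbF (mem_of_mem_erase h))
      (fun h => hcF (mem_of_mem_erase h)) hab hac hbc (hF.mono (erase_subset v F)) (by omega)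
      (htot.trans (total_le_total_erase hv hFU hleaf (by omega))) rfl).mono le_rfl
      (erase_subset v U))
  have hmin : ∀ x ∈ F, 2 ≤ degIn G U x := by
    intro x hx
    by_contra! hlt
    have h1 := degIn_mono (le_refl G) hFU x
    have h2 := hsmall x hx (by omega)
    omega
  obtain ⟨v, hv, hleaf⟩ := hF.exists_degIn_le_one (card_pos.mp (by omega))
  have hvU := hsmall v hv hleaf
  have hsplit : ∀ x, degIn G U x = degIn G F x + degIn G {a, b, c} x := fun x => by
    rw [hU, degIn_union G hTF]
  have hvT := hsplit v
  have hthree : degIn G {a, b, c} v ≤ 2 := by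
    by_contra! hlt
    rw [degIn_triple G hab.ne hac.ne hbc.ne] at hlt
    simp only [degIn_singleton] at hlt
    have hall : G.Adj v a ∧ G.Adj v b ∧ G.Adj v c := by
      split_ifs at hlt <;> first | omega | exact ⟨by assumption, by assumption, by assumption⟩
    have := total_two_lt_of_apex hU haF hbF hcF hab hac hbc hcard hP hmin hv hleaf hall.1 hall.2.1
      hall.2.2
    omega
  obtain ⟨w, hw, hvw⟩ := degIn_pos.mp (show 0 < degIn G F v by omega)
  have hv3 : degIn G U v = 3 := by omega
  have hv0 : score 2 (degIn G U v) = 0 := by rw [hv3]; rfl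
  have hpair : total G 2 F U = total G 2 (F \ {v, w}) U + score 2 (degIn G U w) := by
    rw [← total_sdiff_add G 2 U (show {v, w} ⊆ F by simp [insert_subset_iff, hv, hw])]
    congr 1
    unfold total
    rw [sum_pair hvw.ne, hv0, zero_add]
  have hw1 := score_le_one 2 (degIn G U w)
  have hna : ¬ (G.Adj v a ∧ G.Adj w a) := by
    rintro ⟨h1, h2⟩
    have := total_two_sdiff_nonpos hU haF hbF hcF hab.ne hac.ne hbc hF hP hmin hv hw hvw hleaf
      h1.symm h2.symm
    omega
  have hnb : ¬ (G.Adj v b ∧ G.Adj w b) := by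
    rintro ⟨h1, h2⟩
    have := total_two_sdiff_nonpos (hU.trans (by rw [insert_comm])) hbF haF hcF hab.ne' hbc.ne hac
      hF hP hmin hv hw hvw hleaf h1.symm h2.symm
    omega
  have hnc : ¬ (G.Adj v c ∧ G.Adj w c) := by
    rintro ⟨h1, h2⟩
    have := total_two_sdiff_nonpos (hU.trans (by rw [pair_comm, insert_comm])) hcF haF hbF hac.ne'
      hbc.ne' hab hF hP hmin hv hw hvw hleaf h1.symm h2.symm
    omega
  have hdisj : ∀ z ∈ U, ¬ (G.Adj v z ∧ G.Adj w z) := by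
    intro z hz hvz
    rw [hU] at hz
    simp only [mem_union, mem_insert, mem_singleton] at hz
    rcases hz with hz | rfl | rfl | rfl
    · have := two_le_degIn hw hz hvz.2.ne hvw hvz.1
      omega
    · exact hna hvz
    · exact hnb hvz
    · exact hnc hvz
  have hwT : degIn G {a, b, c} w ≤ 1 := by
    have hvT2 : 2 ≤ degIn G {a, b, c} v := by omega
    rw [degIn_triple G hab.ne hac.ne hbc.ne] at hvT2 ⊢
    simp only [degIn_singleton] at hvT2 ⊢
    split_ifs at hvT2 ⊢ <;> first | omega | (exfalso; tauto)
  have h3 := card_erase_add_one hv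
  have hcard4 : 4 ≤ F.card := by
    by_contra! hlt
    have h4 := card_erase_add_one hw
    have h5 := degIn_le_card G (F.erase w) w
    have h6 := degIn_erase G hw w
    simp only [SimpleGraph.irrefl, if_false] at h6
    have h7 := hsplit w
    have h8 : score 2 (degIn G U w) ≤ 0 := by unfold score; split_ifs <;> omega
    have h9 := total_le_card G 2 (F \ {v, w}) U
    rw [card_sdiff_of_subset (by simp [insert_subset_iff, hv, hw]), card_pair hvw.ne] at h9
    omega
  have hcon := total_le_total_contract (k := 2) hv hw hFU hvw hdisj
  have hmono := score_mono 2 (show degIn G U w ≤ degIn G U v + degIn G U w - 2 by omega)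
  have hle := le_contract G v w
  exact hP (Packs.of_contract hvw (hFU hv) (ih (F.erase v).card (by omega) (hUerase v hv)
    (fun h => haF (mem_of_mem_erase h)) (fun h => hbF (mem_of_mem_erase h))
    (fun h => hcF (mem_of_mem_erase h)) (hle hab) (hle hac) (hle hbc)
    (hF.contract_leaf hw hvw hleaf) (by omega) (by omega) rfl))

lemma total_le_total_contract_of_lt {G : SimpleGraph V} {k : ℕ} {x y : V} {U : Finset V}
    (hx : x ∈ U) (hy : y ∈ U) (hxy : G.Adj x y) (h : ∀ z ∈ U, ¬ (G.Adj x z ∧ G.Adj y z))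
    (hx2 : 2 ≤ degIn G U x) (hy2 : 2 ≤ degIn G U y)
    (hlt : degIn G U x < 2 * k ∨ degIn G U y < 2 * k) :
    total G k U U ≤ total (contract G x y) k (U.erase x) (U.erase x) := by
  refine le_trans ?_ (total_le_total_contract hx hy subset_rfl hxy h)
  have h1 := score_mono k (show degIn G U x ≤ degIn G U x + degIn G U y - 2 by omega)
  have h2 := score_mono k (show degIn G U y ≤ degIn G U x + degIn G U y - 2 by omega)
  have h3 : ∀ d, d < 2 * k → score k d ≤ 0 := by
    intro d hd
    unfold score; split_ifs <;> omega
  rcases hlt with hlt | hlt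
  · have := h3 _ hlt
    omega
  · have := h3 _ hlt
    omega

lemma total_le_total_contract_add_one {G : SimpleGraph V} {k : ℕ} {x y : V} {U : Finset V}
    (hx : x ∈ U) (hy : y ∈ U) (hxy : G.Adj x y)
    (h : ∀ z ∈ U, ¬ (G.Adj x z ∧ G.Adj y z))
    (hx2 : 2 * k ≤ degIn G U x) (hy2 : 2 * k ≤ degIn G U y) :
    total G k U U ≤ total (contract G x y) k (U.erase x) (U.erase x) + 1 := by
  have h0 := total_le_total_contract (k := k) hx hy subset_rfl hxy h
  have h1 : ∀ d, 2 * k ≤ d → score k d = 1 := fun d hd => if_pos hd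
  rw [h1 _ hx2, h1 _ hy2, h1 _ (by omega)] at h0
  omega

lemma total_eq_card {G : SimpleGraph V} {k : ℕ} {A U : Finset V}
    (h : ∀ x ∈ A, 2 * k ≤ degIn G U x) : total G k A U = A.card := by
  unfold total
  have h1 : ∀ x ∈ A, score k (degIn G U x) = 1 := fun x hx => if_pos (h x hx)
  rw [sum_congr rfl h1]
  simp

lemma degIn_add_degIn_le_card {G : SimpleGraph V} {x y : V} {U : Finset V}
    (h : ∀ z ∈ U, ¬ (G.Adj x z ∧ G.Adj y z)) : degIn G U x + degIn G U y ≤ U.card := by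
  unfold degIn
  rw [← card_union_of_disjoint]
  · exact card_le_card (union_subset (filter_subset _ _) (filter_subset _ _))
  · rw [Finset.disjoint_left]
    intro z hz hz'
    simp only [mem_filter] at hz hz'
    exact h z hz.1 ⟨hz.2, hz'.2⟩

/-- A vertex set of total score at least five with respect to `k = 2`, with at least six vertices,
contains two disjoint cores. -/
theorem packs_two_of_five_le_total (G : SimpleGraph V) (U : Finset V)
    (htot : 5 ≤ total G 2 U U) (hcard : 6 ≤ U.card) : Packs G 2 U := by
  induction hn : U.card using Nat.strong_induction_on generalizing G U with
  | _ n ih =>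
  subst hn
  by_cases hlow : ∃ v ∈ U, degIn G U v ≤ 1
  · obtain ⟨v, hv, hdv⟩ := hlow
    have hs : score 2 (degIn G U v) = -1 := by unfold score; split_ifs <;> omega
    have h1 := total_erase_add G 2 U hv
    have h2 := total_le_card G 2 (U.erase v) U
    have h3 := card_erase_add_one hv
    have h4 := total_le_total_erase (k := 2) hv subset_rfl hdv (by omega)
    exact (ih _ (by omega) G (U.erase v) (by omega) (by omega) rfl).mono le_rfl (erase_subset _ _)
  push Not at hlow
  by_cases htri : ∃ a ∈ U, ∃ b ∈ U, ∃ c ∈ U, G.Adj a b ∧ G.Adj a c ∧ G.Adj b c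
  · obtain ⟨a, ha, b, hb, c, hc, hab, hac, hbc⟩ := htri
    have hT : {a, b, c} ⊆ U := by simp [insert_subset_iff, ha, hb, hc]
    have hTcard : ({a, b, c} : Finset V).card = 3 := card_eq_three.mpr
      ⟨a, b, c, hab.ne, hac.ne, hbc.ne, rfl⟩
    by_cases hF : IsForestOn G (U \ {a, b, c})
    · have h1 := total_sdiff_add G 2 U hT
      have h2 := total_le_card G 2 {a, b, c} U
      have h3 := card_sdiff_add_card_eq_card hT
      exact packs_two_of_triangle_of_isForestOn (sdiff_union_of_subset hT).symm (by simp) (by simp)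
        (by simp) hab hac hbc hF (by omega) (by omega)
    · exact Packs.of_core (isCore_triangle hab hac hbc) hT (packs_one_of_not_isForestOn hF)
  have hfree : ∀ x ∈ U, ∀ y ∈ U, G.Adj x y → ∀ z ∈ U, ¬ (G.Adj x z ∧ G.Adj y z) :=
    fun x hx y hy hxy z hz h => htri ⟨x, hx, y, hy, z, hz, hxy, h⟩
  have hcard7 : 7 ≤ U.card := by
    by_contra! hlt
    have hd3 : ∀ x ∈ U, 3 ≤ degIn G U x := by
      intro x hx
      by_contra! hd
      have hs : score 2 (degIn G U x) = -1 := by unfold score; split_ifs <;> omega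
      have h1 := total_erase_add G 2 U hx
      have h2 := total_le_card G 2 (U.erase x) U
      have h3 := card_erase_add_one hx
      omega
    obtain ⟨x, hx, hx4⟩ : ∃ x ∈ U, 4 ≤ degIn G U x := by
      by_contra! hd
      have : total G 2 U U ≤ 0 := sum_nonpos fun x hx => by
        have := hd x hx
        unfold score; split_ifs <;> omega
      omega
    obtain ⟨y, hy, hxy⟩ := degIn_pos.mp (show 0 < degIn G U x by omega)
    have h1 := hd3 y hy
    have h2 := degIn_add_degIn_le_card (hfree x hx y hy hxy)
    omega
  have hcon : ∀ x ∈ U, ∀ y ∈ U, G.Adj x y →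
      5 ≤ total (contract G x y) 2 (U.erase x) (U.erase x) → Packs G 2 U := by
    intro x hx y hy hxy h
    have h3 := card_erase_add_one hx
    exact Packs.of_contract hxy hx (ih _ (by omega) _ _ h (by omega) rfl)
  obtain ⟨z, hz⟩ : U.Nonempty := card_pos.mp (by omega)
  by_cases hlt : ∃ x ∈ U, degIn G U x < 2 * 2
  · obtain ⟨x, hx, hxlt⟩ := hlt
    have hx2 := hlow x hx
    obtain ⟨y, hy, hxy⟩ := degIn_pos.mp (show 0 < degIn G U x by omega)
    exact hcon x hx y hy hxy (htot.trans (total_le_total_contract_of_lt hx hy hxy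
      (hfree x hx y hy hxy) hx2 (hlow y hy) (Or.inl hxlt)))
  · push Not at hlt
    have hz2 := hlow z hz
    obtain ⟨y, hy, hzy⟩ := degIn_pos.mp (show 0 < degIn G U z by omega)
    have h1 := total_eq_card hlt
    have h2 := total_le_total_contract_add_one hz hy hzy (hfree z hz y hy hzy)
      (hlt z hz) (hlt y hy)
    exact hcon z hz y hy hzy (by omega)

/-- Deleting edges between vertices of degree greater than `2k` does not decrease any score. -/
lemma exists_sparse (G : SimpleGraph V) (k : ℕ) (U : Finset V) :
    ∃ H ≤ G, total G k U U ≤ total H k U U ∧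
      ∀ x ∈ U, ∀ y ∈ U, H.Adj x y → degIn H U x ≤ 2 * k ∨ degIn H U y ≤ 2 * k := by
  induction hn : ∑ x ∈ U, degIn G U x using Nat.strong_induction_on generalizing G with
  | _ n ih =>
  subst hn
  by_cases h : ∀ x ∈ U, ∀ y ∈ U, G.Adj x y → degIn G U x ≤ 2 * k ∨ degIn G U y ≤ 2 * k
  · exact ⟨G, le_rfl, le_rfl, h⟩
  push Not at h
  obtain ⟨x, hx, y, hy, hxy, hdx, hdy⟩ := h
  set H := G.deleteEdges {s(x, y)} with hH
  have hle : H ≤ G := SimpleGraph.deleteEdges_le _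
  have hadj : ∀ v w, H.Adj v w ↔ G.Adj v w ∧ ¬ ((v = x ∧ w = y) ∨ (v = y ∧ w = x)) := by
    intro v w
    simp [hH, SimpleGraph.deleteEdges_adj]
  have hends : ∀ v w, (v = x ∧ w = y) ∨ (v = y ∧ w = x) → degIn G U v ≤ degIn H U v + 1 := by
    intro v w hvw
    refine (card_le_card fun u hu => ?_).trans (card_insert_le w _)
    simp only [mem_filter, mem_insert, hadj] at hu ⊢
    by_cases huw : u = w
    · exact Or.inl huw
    · refine Or.inr ⟨hu.1, hu.2, ?_⟩
      have := hxy.ne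
      grind
  have hother : ∀ v, v ≠ x → v ≠ y → degIn G U v ≤ degIn H U v := by
    intro v hvx hvy
    refine card_le_card fun u hu => ?_
    simp only [mem_filter, hadj] at hu ⊢
    exact ⟨hu.1, hu.2, by tauto⟩
  have htot : total G k U U ≤ total H k U U := by
    have hheavy : ∀ v w, (v = x ∧ w = y) ∨ (v = y ∧ w = x) →
        score k (degIn G U v) ≤ score k (degIn H U v) := by
      intro v w hvw
      have h1 := hends v w hvw
      have h2 : 2 * k < degIn G U v := by rcases hvw with ⟨rfl, -⟩ | ⟨rfl, -⟩ <;> assumption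
      unfold score; split_ifs <;> omega
    refine sum_le_sum fun v _ => ?_
    by_cases hvx : v = x
    · exact hheavy v y (Or.inl ⟨hvx, rfl⟩)
    by_cases hvy : v = y
    · exact hheavy v x (Or.inr ⟨hvy, rfl⟩)
    exact score_mono k (hother v hvx hvy)
  have hlt : ∑ v ∈ U, degIn H U v < ∑ v ∈ U, degIn G U v := by
    refine sum_lt_sum (fun v _ => degIn_mono hle subset_rfl v) ⟨x, hx, card_lt_card ?_⟩
    refine Finset.ssubset_iff_subset_ne.mpr ⟨fun u hu => ?_, fun heq => ?_⟩
    · simp only [mem_filter] at hu ⊢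
      exact ⟨hu.1, hle hu.2⟩
    · have := heq.ge (mem_filter.mpr ⟨hy, hxy⟩)
      simp [hadj] at this
  obtain ⟨K, hK, h1, h2⟩ := ih _ hlt H rfl
  exact ⟨K, hK.trans hle, htot.trans h1, h2⟩

/-- The vertices outside `S` whose score relative to `k + 1` in `U` exceeds their score relative to
`k` in `U \ S`, provided that they have at most three neighbours in `S`. -/
noncomputable def critical (G : SimpleGraph V) (k : ℕ) (S U : Finset V) : Finset V :=
  (U \ S).filter fun x =>
    degIn G S x = 3 ∧ 2 * k + 1 ≤ degIn G U x ∧ degIn G U x ≤ 2 * k + 2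

lemma total_le_total_sdiff_add {G : SimpleGraph V} {k : ℕ} {S U : Finset V} (hSU : S ⊆ U)
    (h3 : ∀ x ∈ U \ S, degIn G S x ≤ 3) :
    total G (k + 1) (U \ S) U ≤ total G k (U \ S) (U \ S) + (critical G k S U).card := by
  unfold total critical
  rw [card_filter, Nat.cast_sum, ← sum_add_distrib]
  refine sum_le_sum fun x hx => ?_
  have h1 := h3 x hx
  have h2 := degIn_sdiff G hSU x
  unfold score
  split_ifs <;> omega

lemma total_le_total_sdiff {G : SimpleGraph V} {k : ℕ} {S U : Finset V} (hSU : S ⊆ U)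
    (h2 : ∀ x ∈ U \ S, degIn G S x ≤ 2) :
    total G (k + 1) (U \ S) U ≤ total G k (U \ S) (U \ S) := by
  have h0 := total_le_total_sdiff_add (k := k) hSU fun x hx => (h2 x hx).trans (by omega)
  have h1 : critical G k S U = ∅ := filter_eq_empty_iff.mpr fun x hx h => by
    have := h2 x hx
    omega
  simpa [h1] using h0

/-- A vertex set of large minimum degree contains a four-cycle through any of its vertices. -/
lemma exists_two_le_degIn_filter {G : SimpleGraph V} {D : ℕ} {U : Finset V} {v : V} (hv : v ∈ U)
    (hD : ∀ x ∈ U, D ≤ degIn G U x) (hcard : U.card ≤ D * (D - 1)) :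
    ∃ w ∈ U, w ≠ v ∧ 2 ≤ degIn G (U.filter fun u => G.Adj v u) w := by
  by_contra! hlt
  set N := U.filter fun u => G.Adj v u with hN
  have hNv : degIn G N v = N.card := by
    unfold degIn
    rw [hN, filter_filter]
    simp
  have h1 : N.card * D ≤ ∑ u ∈ N, degIn G U u := by
    rw [← smul_eq_mul]
    exact card_nsmul_le_sum _ _ _ fun u hu => hD u (mem_filter.mp hu).1
  have h2 : ∑ w ∈ U.erase v, degIn G N w ≤ (U.erase v).card * 1 := by
    rw [← smul_eq_mul]
    refine sum_le_card_nsmul _ _ _ fun w hw => ?_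
    have := hlt w (mem_of_mem_erase hw) (ne_of_mem_erase hw)
    omega
  rw [sum_degIn_comm, ← add_sum_erase U _ hv, hNv] at h1
  have h3 := card_erase_add_one hv
  have h4 : D ≤ N.card := hD v hv
  obtain _ | E := D
  · simp at hcard
    simp [hcard] at hv
  · have h5 := Nat.mul_le_mul_right E h4
    simp only [Nat.add_sub_cancel] at hcard
    nlinarith

lemma degIn_pair_le_one {G : SimpleGraph V} {a b x : V} (h : ¬ (G.Adj a x ∧ G.Adj b x)) :
    degIn G {a, b} x ≤ 1 := by
  refine card_le_one.mpr fun u hu w hw => ?_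
  simp only [mem_filter, mem_insert, mem_singleton, G.adj_comm x] at hu hw
  grind

/-- The induction step, reduced to the case of a vertex set containing a triangle. -/
theorem packs_of_triangle_case {m : ℕ} (hm : 2 ≤ m)
    (hprev : ∀ (G : SimpleGraph V) (U : Finset V), (m : ℤ) ^ 2 + 4 * m - 5 ≤ total G m U U →
      6 ≤ U.card → Packs G m U)
    (htri : ∀ (G : SimpleGraph V) (U : Finset V), (m : ℤ) ^ 2 + 4 * m - 1 ≤ total G (m + 1) U U →
      (∀ x ∈ U, ∀ y ∈ U, G.Adj x y → degIn G U x ≤ 2 * (m + 1) ∨ degIn G U y ≤ 2 * (m + 1)) →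
      (∃ a ∈ U, ∃ b ∈ U, ∃ c ∈ U, G.Adj a b ∧ G.Adj a c ∧ G.Adj b c) → Packs G (m + 1) U)
    (G : SimpleGraph V) (U : Finset V) (htot : (m : ℤ) ^ 2 + 4 * m - 1 ≤ total G (m + 1) U U) :
    Packs G (m + 1) U := by
  induction hn : U.card using Nat.strong_induction_on generalizing G U with
  | _ n ih =>
  subst hn
  obtain ⟨H, hHG, htotH, hsparse⟩ := exists_sparse G (m + 1) U
  refine Packs.mono hHG subset_rfl ?_
  replace htot := htot.trans htotH
  clear htotH
  by_cases hlow : ∃ v ∈ U, degIn H U v ≤ 1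
  · obtain ⟨v, hv, hdv⟩ := hlow
    have h3 := card_erase_add_one hv
    have h4 := total_le_total_erase (k := m + 1) hv subset_rfl hdv (by omega)
    exact (ih _ (by omega) H (U.erase v) (htot.trans h4) rfl).mono le_rfl (erase_subset _ _)
  push Not at hlow
  by_cases htriangle : ∃ a ∈ U, ∃ b ∈ U, ∃ c ∈ U, H.Adj a b ∧ H.Adj a c ∧ H.Adj b c
  · exact htri H U htot hsparse htriangle
  have hfree : ∀ x ∈ U, ∀ y ∈ U, H.Adj x y → ∀ z ∈ U, ¬ (H.Adj x z ∧ H.Adj y z) :=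
    fun x hx y hy hxy z hz h => htriangle ⟨x, hx, y, hy, z, hz, hxy, h⟩
  have hcon : ∀ x ∈ U, ∀ y ∈ U, H.Adj x y →
      (m : ℤ) ^ 2 + 4 * m - 1 ≤ total (contract H x y) (m + 1) (U.erase x) (U.erase x) →
      Packs H (m + 1) U := by
    intro x hx y hy hxy h
    have h3 := card_erase_add_one hx
    exact Packs.of_contract hxy hx (ih _ (by omega) _ _ h rfl)
  have hpos : 0 < U.card := by
    have := total_le_card H (m + 1) U U
    zify
    nlinarith
  obtain ⟨v, hv⟩ : U.Nonempty := card_pos.mp hpos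
  by_cases hlt : ∃ x ∈ U, degIn H U x < 2 * (m + 1)
  · obtain ⟨x, hx, hxlt⟩ := hlt
    have hx2 := hlow x hx
    obtain ⟨y, hy, hxy⟩ := degIn_pos.mp (show 0 < degIn H U x by omega)
    exact hcon x hx y hy hxy (htot.trans (total_le_total_contract_of_lt hx hy hxy
      (hfree x hx y hy hxy) hx2 (hlow y hy) (Or.inl hxlt)))
  push Not at hlt
  have htotal := total_eq_card hlt
  rcases htot.lt_or_eq with hgt | heq
  · have hv2 := hlow v hv
    obtain ⟨y, hy, hvy⟩ := degIn_pos.mp (show 0 < degIn H U v by omega)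
    have h2 := total_le_total_contract_add_one hv hy hvy (hfree v hv y hy hvy)
      (hlt v hv) (hlt y hy)
    exact hcon v hv y hy hvy (by omega)
  have hcard : U.card ≤ 2 * (m + 1) * (2 * (m + 1) - 1) := by
    rw [show 2 * (m + 1) - 1 = 2 * m + 1 by omega]
    zify
    nlinarith
  obtain ⟨w, hw, hwv, hw2⟩ := exists_two_le_degIn_filter hv hlt hcard
  obtain ⟨p, hp, q, hq, hpq⟩ := one_lt_card.mp (lt_of_lt_of_le one_lt_two hw2)
  simp only [mem_filter] at hp hq
  obtain ⟨⟨hp, hvp⟩, hwp⟩ := hp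
  obtain ⟨⟨hq, hvq⟩, hwq⟩ := hq
  have hdisj : Disjoint ({v, p} : Finset V) {w, q} := by
    have := hwp.ne
    have := hvq.ne
    simp [*]
    tauto
  have hS : {v, p} ∪ {w, q} ⊆ U := by
    simp [insert_subset_iff, *]
  have hcore : IsCore H ({v, p} ∪ {w, q}) := by
    refine ⟨⟨v, by simp⟩, fun x hx => ?_⟩
    simp only [mem_union, mem_insert, mem_singleton] at hx
    rcases hx with (rfl | rfl) | (rfl | rfl)
    · exact two_le_degIn (a := p) (b := q) (by simp) (by simp) hpq hvp hvq
    · exact two_le_degIn (a := v) (b := w) (by simp) (by simp) hwv.symm hvp.symm hwp.symm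
    · exact two_le_degIn (a := p) (b := q) (by simp) (by simp) hpq hwp hwq
    · exact two_le_degIn (a := v) (b := w) (by simp) (by simp) hwv.symm hvq.symm hwq.symm
  have hScard : ({v, p} ∪ {w, q} : Finset V).card = 4 := by
    rw [card_union_of_disjoint hdisj, card_pair hvp.ne, card_pair hwq.ne]
  refine Packs.of_core hcore hS (hprev H _ ?_ ?_)
  · have h1 := total_le_total_sdiff (G := H) (k := m) hS fun x hx => by
      have hxU := (mem_sdiff.mp hx).1
      rw [degIn_union H hdisj]
      have h1 := degIn_pair_le_one (hfree v hv p hp hvp x hxU)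
      have h2 := degIn_pair_le_one (hfree w hw q hq hwq x hxU)
      omega
    have h2 := total_sdiff_add H (m + 1) U hS
    have h3 := total_le_card H (m + 1) ({v, p} ∪ {w, q}) U
    rw [hScard] at h3
    push_cast at h3
    linarith
  · have h3 := card_sdiff_add_card_eq_card hS
    have h4 : 10 ≤ U.card := by
      zify
      nlinarith
    omega

lemma adj_of_degIn_triple {G : SimpleGraph V} {a b c x : V} (h : degIn G {a, b, c} x = 3) :
    G.Adj a x ∧ G.Adj b x ∧ G.Adj c x := by
  have heq := eq_of_subset_of_card_le (filter_subset (fun u => G.Adj x u) {a, b, c})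
    (card_le_three.trans h.ge)
  have hadj : ∀ u ∈ ({a, b, c} : Finset V), G.Adj u x := fun u hu =>
    (mem_filter.mp (heq.ge hu)).2.symm
  exact ⟨hadj a (by simp), hadj b (by simp), hadj c (by simp)⟩

lemma critical_triangle_subset {G : SimpleGraph V} {m : ℕ} {a b c : V} {U : Finset V} :
    critical G m {a, b, c} U ⊆ (U \ {a, b, c}).filter fun u => G.Adj a u := by
  intro x hx
  simp only [critical, mem_filter] at hx ⊢
  exact ⟨hx.1, (adj_of_degIn_triple hx.2.1).1⟩

lemma card_critical_add_two_le {G : SimpleGraph V} {m : ℕ} {a b c : V} {U : Finset V}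
    (ha : a ∈ U) (hb : b ∈ U) (hc : c ∈ U) (hab : G.Adj a b) (hac : G.Adj a c)
    (hbc : G.Adj b c) : (critical G m {a, b, c} U).card + 2 ≤ degIn G U a := by
  have hT : {a, b, c} ⊆ U := by simp [insert_subset_iff, *]
  rw [degIn_sdiff G hT a]
  exact add_le_add (card_le_card critical_triangle_subset)
    ((isCore_triangle hab hac hbc).2 a (by simp))

lemma total_sdiff_triangle_ge {G : SimpleGraph V} {m : ℕ} {a b c : V} {U : Finset V}
    (ha : a ∈ U) (hb : b ∈ U) (hc : c ∈ U) :
    total G (m + 1) U U ≤ total G m (U \ {a, b, c}) (U \ {a, b, c}) +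
      (critical G m {a, b, c} U).card + total G (m + 1) {a, b, c} U := by
  have hT : {a, b, c} ⊆ U := by simp [insert_subset_iff, *]
  rw [← total_sdiff_add G (m + 1) U hT]
  have := total_le_total_sdiff_add (G := G) (k := m) hT fun x _ =>
    (degIn_le_card G _ x).trans card_le_three
  linarith

/-- The triangle case of the induction step when no condition on the number of vertices is needed
for the smaller packing. -/
lemma packs_of_triangle {m : ℕ}
    (hprev : ∀ (G : SimpleGraph V) (U : Finset V), (m : ℤ) ^ 2 + 2 * m - 4 ≤ total G m U U →
      Packs G m U)
    (G : SimpleGraph V) (U : Finset V) (htot : (m : ℤ) ^ 2 + 4 * m - 1 ≤ total G (m + 1) U U)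
    {a b c : V} (ha : a ∈ U) (hb : b ∈ U) (hc : c ∈ U) (hab : G.Adj a b) (hac : G.Adj a c)
    (hbc : G.Adj b c) (hda : degIn G U a ≤ 2 * (m + 1)) : Packs G (m + 1) U := by
  have hT : {a, b, c} ⊆ U := by simp [insert_subset_iff, *]
  refine Packs.of_core (isCore_triangle hab hac hbc) hT (hprev G _ ?_)
  have h1 := card_critical_add_two_le (m := m) ha hb hc hab hac hbc
  have h2 := total_sdiff_triangle_ge (G := G) (m := m) ha hb hc
  have h3 := total_le_card G (m + 1) {a, b, c} U
  have h4 : ({a, b, c} : Finset V).card ≤ 3 := card_le_three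
  zify at h1 hda h4
  linarith

/-- A vertex of degree six in a triangle, all of whose triangles are expensive to delete, lies in
an isolated clique on seven vertices. -/
lemma isolated_clique_of_expensive {G : SimpleGraph V} {a b c : V} {U : Finset V}
    (ha : a ∈ U) (hb : b ∈ U) (hc : c ∈ U) (hab : G.Adj a b) (hac : G.Adj a c)
    (hbc : G.Adj b c) (hda : degIn G U a ≤ 6)
    (hexp : ∀ x ∈ U, ∀ y ∈ U, G.Adj a x → G.Adj a y → G.Adj x y →
      7 ≤ total G 3 {a, x, y} U + (critical G 2 {a, x, y} U).card) :
    degIn G U a = 6 ∧ ∀ x ∈ U, G.Adj a x →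
      degIn G U x = 6 ∧ ∀ y ∈ U, G.Adj a y → x ≠ y → G.Adj x y := by
  have hkey : ∀ x ∈ U, ∀ y ∈ U, G.Adj a x → G.Adj a y → G.Adj x y →
      degIn G U a = 6 ∧ 6 ≤ degIn G U x ∧ 6 ≤ degIn G U y ∧
        ∀ z ∈ U, G.Adj a z → z ≠ x → z ≠ y → G.Adj x z ∧ G.Adj y z ∧ degIn G U z ≤ 6 := by
    intro x hx y hy hax hay hxy
    have hT : {a, x, y} ⊆ U := by simp [insert_subset_iff, *]
    have h1 := card_critical_add_two_le (m := 2) ha hx hy hax hay hxy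
    have h2 := hexp x hx y hy hax hay hxy
    have h3 : total G 3 {a, x, y} U =
        score 3 (degIn G U a) + score 3 (degIn G U x) + score 3 (degIn G U y) := by
      unfold total
      rw [sum_insert (by simp [hax.ne, hay.ne]), sum_pair hxy.ne]
      ring
    have ha1 := score_le_one 3 (degIn G U a)
    have hx1 := score_le_one 3 (degIn G U x)
    have hy1 := score_le_one 3 (degIn G U y)
    have hheavy : ∀ d, 1 ≤ score 3 d → 6 ≤ d := by
      intro d hd
      unfold score at hd
      split_ifs at hd <;> omega
    have hda6 : degIn G U a = 6 := by omega
    refine ⟨hda6, hheavy _ (by omega), hheavy _ (by omega), fun z hz haz hzx hzy => ?_⟩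
    have hcard : ((U \ {a, x, y}).filter fun u => G.Adj a u).card ≤
        (critical G 2 {a, x, y} U).card := by
      have h4 := degIn_sdiff G hT a
      have h5 := (isCore_triangle hax hay hxy).2 a (by simp)
      change degIn G (U \ {a, x, y}) a ≤ _
      omega
    have hzc : z ∈ critical G 2 {a, x, y} U := by
      rw [eq_of_subset_of_card_le critical_triangle_subset hcard]
      simp [hz, haz, haz.ne', hzx, hzy]
    simp only [critical, mem_filter] at hzc
    obtain ⟨-, h3, -, h6⟩ := hzc
    obtain ⟨-, hxz, hyz⟩ := adj_of_degIn_triple h3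
    exact ⟨hxz, hyz, by omega⟩
  obtain ⟨hda6, hdb, hdc, hz⟩ := hkey b hb c hc hab hac hbc
  obtain ⟨z, hzU, haz, hzb, hzc⟩ : ∃ z ∈ U, G.Adj a z ∧ z ≠ b ∧ z ≠ c := by
    by_contra! hno
    have h1 : (U.filter fun u => G.Adj a u) ⊆ {b, c} := by
      intro u hu
      simp only [mem_filter, mem_insert, mem_singleton] at hu ⊢
      by_contra! hn
      exact hn.2 (hno u hu.1 hu.2 hn.1)
    have h2 := (card_le_card h1).trans card_le_two
    unfold degIn at hda6
    omega
  obtain ⟨hbz, hcz, -⟩ := hz z hzU haz hzb hzc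
  have hball : ∀ x ∈ U, G.Adj a x → x ≠ b → G.Adj b x := by
    intro x hx hax hxb
    by_cases hxc : x = c
    · exact hxc ▸ hbc
    · exact (hz x hx hax hxb hxc).1
  refine ⟨hda6, fun x hx hax => ⟨?_, fun y hy hay hxy => ?_⟩⟩
  · refine le_antisymm ?_ ?_
    · by_cases hxb : x = b
      · subst hxb
        exact ((hkey c hc z hzU hac haz hcz).2.2.2 x hx hax hbc.ne hzb.symm).2.2
      by_cases hxc : x = c
      · subst hxc
        exact ((hkey b hb z hzU hab haz hbz).2.2.2 x hx hax hbc.ne' hzc.symm).2.2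
      exact (hz x hx hax hxb hxc).2.2
    · by_cases hxb : x = b
      · exact hxb ▸ hdb
      · exact (hkey b hb x hx hab hax (hball x hx hax hxb)).2.2.1
  · by_cases hxb : x = b
    · subst hxb
      exact hball y hy hay hxy.symm
    by_cases hyb : y = b
    · subst hyb
      exact (hball x hx hax hxy).symm
    exact ((hkey b hb x hx hab hax (hball x hx hax hxb)).2.2.2 y hy hay hyb hxy.symm).2.1

lemma not_isForestOn_of_total_three_pos {G : SimpleGraph V} {W : Finset V}
    (h : 0 < total G 3 W W) : ¬ IsForestOn G W := by
  intro hW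
  have hne : W.Nonempty := by
    by_contra he
    rw [not_nonempty_iff_eq_empty] at he
    simp [he, total] at h
  have h1 := hW.sum_degIn_add_two_le hne
  have h2 : ∑ x ∈ W, (3 * score 3 (degIn G W x) + 3) ≤ ∑ x ∈ W, (degIn G W x : ℤ) := by
    refine sum_le_sum fun x _ => ?_
    unfold score
    split_ifs <;> omega
  rw [sum_add_distrib, ← mul_sum, sum_const, nsmul_eq_mul] at h2
  unfold total at h
  zify at h1
  linarith

/-- The triangle case of the induction step when `m + 1 = 3`. -/
lemma packs_three_of_triangle (G : SimpleGraph V) (U : Finset V) (htot : 11 ≤ total G 3 U U)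
    {a b c : V} (ha : a ∈ U) (hb : b ∈ U) (hc : c ∈ U) (hab : G.Adj a b) (hac : G.Adj a c)
    (hbc : G.Adj b c) (hda : degIn G U a ≤ 6) : Packs G 3 U := by
  by_cases hexp : ∀ x ∈ U, ∀ y ∈ U, G.Adj a x → G.Adj a y → G.Adj x y →
      7 ≤ total G 3 {a, x, y} U + (critical G 2 {a, x, y} U).card
  swap
  · push Not at hexp
    obtain ⟨x, hx, y, hy, hax, hay, hxy, hlt⟩ := hexp
    have hT : {a, x, y} ⊆ U := by simp [insert_subset_iff, *]
    have h1 := total_sdiff_triangle_ge (G := G) (m := 2) ha hx hy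
    have h2 := card_sdiff_add_card_eq_card hT
    have h3 : ({a, x, y} : Finset V).card ≤ 3 := card_le_three
    have h4 := total_le_card G 3 U U
    exact Packs.of_core (isCore_triangle hax hay hxy) hT
      (packs_two_of_five_le_total G _ (by linarith) (by omega))
  obtain ⟨hda6, hN⟩ := isolated_clique_of_expensive ha hb hc hab hac hbc hda hexp
  set N := U.filter fun u => G.Adj a u with hNdef
  have hmemN : ∀ {x}, x ∈ N ↔ x ∈ U ∧ G.Adj a x := fun {x} => mem_filter
  have haN : a ∉ N := fun h => (hmemN.mp h).2.ne rfl
  have hNcard : N.card = 6 := hda6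
  have hXU : insert a N ⊆ U := insert_subset ha (filter_subset _ _)
  have hXcard : (insert a N).card = 7 := by rw [card_insert_of_notMem haN, hNcard]
  have hclosed : ∀ x ∈ insert a N, degIn G (U \ insert a N) x = 0 := by
    intro x hx
    have h1 := degIn_sdiff G hXU x
    have h2 : degIn G U x = 6 := by
      rcases mem_insert.mp hx with rfl | hx
      · exact hda6
      · exact (hN x (hmemN.mp hx).1 (hmemN.mp hx).2).1
    have h3 : ((insert a N).erase x).card ≤ degIn G (insert a N) x := by
      refine card_le_card fun y hy => mem_filter.mpr ⟨mem_of_mem_erase hy, ?_⟩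
      obtain ⟨hyx, hy⟩ := mem_erase.mp hy
      rcases mem_insert.mp hx with rfl | hx <;> rcases mem_insert.mp hy with rfl | hy
      · exact absurd rfl hyx
      · exact (hmemN.mp hy).2
      · exact (hmemN.mp hx).2.symm
      · exact (hN x (hmemN.mp hx).1 (hmemN.mp hx).2).2 y (hmemN.mp hy).1 (hmemN.mp hy).2 hyx.symm
    rw [card_erase_of_mem hx, hXcard] at h3
    omega
  have hW : ¬ IsForestOn G (U \ insert a N) := by
    refine not_isForestOn_of_total_three_pos ?_
    have h1 := total_sdiff_add G 3 U hXU
    have h2 := total_le_card G 3 (insert a N) U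
    have h3 : total G 3 (U \ insert a N) (U \ insert a N) = total G 3 (U \ insert a N) U := by
      refine sum_congr rfl fun x hx => ?_
      have h4 := degIn_sdiff G hXU x
      have h5 : degIn G (insert a N) x = 0 := by
        by_contra hne
        obtain ⟨y, hy, hxy⟩ := degIn_pos.mp (Nat.pos_of_ne_zero hne)
        exact (degIn_pos.mpr ⟨x, hx, hxy.symm⟩).ne' (hclosed y hy)
      rw [h4, h5, add_zero]
    rw [hXcard] at h2
    push_cast at h2
    linarith
  have hbN : b ∈ N := hmemN.mpr ⟨hb, hab⟩
  have hcN : c ∈ N := hmemN.mpr ⟨hc, hac⟩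
  have hcard4 : 2 < (N \ {b, c}).card := by
    rw [card_sdiff_of_subset (by simp [insert_subset_iff, hbN, hcN]), card_pair hbc.ne]
    omega
  obtain ⟨x, hx, y, hy, z, hz, hxy, hxz, hyz⟩ := two_lt_card.mp hcard4
  simp only [mem_sdiff, mem_insert, mem_singleton, not_or] at hx hy hz
  have hadj : ∀ {u w}, u ∈ N → w ∈ N → u ≠ w → G.Adj u w := fun {u w} hu hw huw =>
    (hN u (hmemN.mp hu).1 (hmemN.mp hu).2).2 w (hmemN.mp hw).1 (hmemN.mp hw).2 huw
  have hne : ∀ {u}, u ∈ N → u ≠ a := fun hu h => haN (h ▸ hu)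
  have hNU : ∀ {u}, u ∈ N → u ∈ U := fun hu => (hmemN.mp hu).1
  refine Packs.of_core (isCore_triangle hab hac hbc) (by simp [insert_subset_iff, *])
    (Packs.of_core (isCore_triangle (hadj hx.1 hy.1 hxy) (hadj hx.1 hz.1 hxz)
      (hadj hy.1 hz.1 hyz)) ?_ ((packs_one_of_not_isForestOn hW).mono le_rfl ?_))
  · intro u hu
    simp only [mem_insert, mem_singleton] at hu
    simp only [mem_sdiff, mem_insert, mem_singleton, not_or]
    rcases hu with rfl | rfl | rfl
    · exact ⟨hNU hx.1, hne hx.1, hx.2⟩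
    · exact ⟨hNU hy.1, hne hy.1, hy.2⟩
    · exact ⟨hNU hz.1, hne hz.1, hz.2⟩
  · intro u hu
    simp only [mem_sdiff, mem_insert, mem_singleton, not_or] at hu ⊢
    have hu' : ∀ {w}, w ∈ N → u ≠ w := fun hw h => hu.2.2 (h ▸ hw)
    exact ⟨⟨hu.1, hu.2.1, hu' hbN, hu' hcN⟩, hu' hx.1, hu' hy.1, hu' hz.1⟩

theorem packs_of_le_total {k : ℕ} (hk : 3 ≤ k) (G : SimpleGraph V) (U : Finset V)
    (htot : (k : ℤ) ^ 2 + 2 * k - 4 ≤ total G k U U) : Packs G k U := by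
  induction k, hk using Nat.le_induction generalizing G U with
  | base =>
    refine packs_of_triangle_case (m := 2) le_rfl (fun G U h => packs_two_of_five_le_total G U
      (by norm_num at h; omega)) (fun G U h hs => ?_) G U (by norm_num at htot ⊢; omega)
    rintro ⟨a, ha, b, hb, c, hc, hab, hac, hbc⟩
    rcases hs a ha b hb hab with hd | hd
    · exact packs_three_of_triangle G U (by norm_num at h; omega) ha hb hc hab hac hbc hd
    · exact packs_three_of_triangle G U (by norm_num at h; omega) hb ha hc hab.symm hbc hac hd
  | succ m hm ih =>
    refine packs_of_triangle_case (m := m) (by omega) (fun G U h _ => ih G U ?_)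
      (fun G U h hs => ?_) G U (by push_cast at htot; linarith)
    · zify at hm
      linarith
    rintro ⟨a, ha, b, hb, c, hc, hab, hac, hbc⟩
    rcases hs a ha b hb hab with hd | hd
    · exact packs_of_triangle ih G U h ha hb hc hab hac hbc hd
    · exact packs_of_triangle ih G U h hb ha hc hab.symm hbc hac hd

lemma total_univ [Fintype V] (G : SimpleGraph V) [DecidableRel G.Adj] {k : ℕ} (hk : 1 ≤ k) :
    total G k univ univ = (Hset G k).card - (Lset G k).card := by
  unfold total Hset Lset
  rw [card_filter, card_filter, Nat.cast_sum, Nat.cast_sum, ← sum_sub_distrib]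
  refine sum_congr rfl fun v _ => ?_
  have hdeg : degIn G univ v = G.degree v := by
    rw [← G.card_neighborFinset_eq_degree, SimpleGraph.neighborFinset_eq_filter]
    unfold degIn
    congr
  rw [hdeg]
  unfold score
  split_ifs <;> omega

end

end DisjointCycles

theorem dirac_erdos {V : Type*} [Fintype V] (G : SimpleGraph V) [DecidableRel G.Adj]
    (k : ℕ) (hk : 3 ≤ k)
    (hHL : (Lset G k).card + (k ^ 2 + 2 * k - 4) ≤ (Hset G k).card) :
    HasDisjointCycles G k := by
  have htot := DisjointCycles.total_univ G (k := k) (by omega)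
  have h4 : 4 ≤ k ^ 2 + 2 * k := by nlinarith
  zify [h4] at hHL
  obtain ⟨v, c, hc, -, hdisj⟩ :=
    (DisjointCycles.packs_of_le_total hk G univ (by linarith)).exists_isCycle
  exact ⟨v, c, hc, hdisj⟩
end

section
/- Let k ≥ 3 be an integer and G a planar finite simple graph with |H_k(G)| − |L_k(G)| ≥ 5k − 7. Then G contains k pairwise vertex-disjoint cycles. (Dirac–Erdős planar theorem.) -/
open Finset unitInterval

/-- A drawing of `G` in the plane: vertices go to distinct points, each edge is drawn as a
simple continuous arc between the images of its endpoints, arcs of an edge in its two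
orientations coincide (up to reversal of the parametrization), the interior of an arc avoids
all vertex points, and interiors of arcs of distinct edges do not meet. -/
def IsPlanar {V : Type*} (G : SimpleGraph V) : Prop :=
  ∃ (f : V → ℝ × ℝ) (arc : ∀ u v : V, G.Adj u v → (I → ℝ × ℝ)),
    Function.Injective f ∧
    (∀ u v (h : G.Adj u v), Continuous (arc u v h)) ∧
    (∀ u v (h : G.Adj u v), Function.Injective (arc u v h)) ∧
    (∀ u v (h : G.Adj u v), arc u v h 0 = f u ∧ arc u v h 1 = f v) ∧
    (∀ u v (h : G.Adj u v) (t : I), arc u v h t = arc v u h.symm (symm t)) ∧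
    (∀ u v (h : G.Adj u v) (t : I), t ≠ 0 → t ≠ 1 → ∀ w : V, arc u v h t ≠ f w) ∧
    (∀ u v (h : G.Adj u v) (u' v' : V) (h' : G.Adj u' v'), s(u, v) ≠ s(u', v') →
      ∀ t t' : I, t ≠ 0 → t ≠ 1 → arc u v h t ≠ arc u' v' h' t')


/-! ## Lattice paths in the plane and the non-planarity of `K₅` -/

/-- Consecutive points of a lattice path: equal or at lattice distance one. -/
def LatticeStep (p q : ℤ × ℤ) : Prop := (p.1 - q.1).natAbs + (p.2 - q.2).natAbs ≤ 1

/-- Indicator that the upward ray from `a` (tilted slightly to the left) meets the unit step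
from `p` to `q`. -/
def upHit (a p q : ℤ × ℤ) : ZMod 2 :=
  if p.1 ≠ q.1 ∧ max p.1 q.1 = a.1 ∧ a.2 < p.2 then 1 else 0

/-- Indicator that the downward ray from `a` (tilted slightly to the right) meets the unit step
from `p` to `q`. -/
def downHit (a p q : ℤ × ℤ) : ZMod 2 :=
  if p.1 ≠ q.1 ∧ min p.1 q.1 = a.1 ∧ p.2 < a.2 then 1 else 0

/-- Indicator of the lexicographic order on lattice points. -/
def lexBit (p a : ℤ × ℤ) : ZMod 2 :=
  if p.1 < a.1 ∨ p.1 = a.1 ∧ p.2 < a.2 then 1 else 0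

theorem lexBit_add_lexBit {p q : ℤ × ℤ} (h : p ≠ q) : lexBit p q + lexBit q p = 1 := by
  have h' : p.1 ≠ q.1 ∨ p.2 ≠ q.2 := by
    by_contra! hc
    exact h (Prod.ext hc.1 hc.2)
  unfold lexBit
  split_ifs <;> first | rfl | omega

theorem upHit_add_downHit {a p q : ℤ × ℤ} (hs : LatticeStep p q) (hp : p ≠ a) (hq : q ≠ a) :
    upHit a p q + downHit a p q = lexBit p a + lexBit q a := by
  obtain ⟨a1, a2⟩ := a
  obtain ⟨p1, p2⟩ := p
  obtain ⟨q1, q2⟩ := q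
  simp only [LatticeStep, ne_eq, Prod.mk.injEq] at hs hp hq
  have e0 : (1 : ZMod 2) + 1 = 0 := rfl
  unfold upHit downHit lexBit
  simp only
  split_ifs <;> first | rfl | (exfalso; omega)

theorem LatticeStep.cases {a b : ℤ × ℤ} (h : LatticeStep a b) :
    b = a ∨ b = (a.1 + 1, a.2) ∨ b = (a.1 - 1, a.2) ∨ b = (a.1, a.2 + 1) ∨ b = (a.1, a.2 - 1) := by
  unfold LatticeStep at h
  simp only [Prod.ext_iff]
  omega

theorem upHit_add_downHit_of_steps {a b d e : ℤ × ℤ} (hs : LatticeStep a b)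
    (ht : LatticeStep d e) (had : a ≠ d) (hae : a ≠ e) (hbd : b ≠ d) (hbe : b ≠ e) :
    upHit a d e + upHit b d e + (downHit d a b + downHit e a b) = 0 := by
  obtain ⟨a1, a2⟩ := a
  obtain ⟨d1, d2⟩ := d
  simp only [ne_eq] at had hae hbd hbe
  rcases hs.cases with rfl | rfl | rfl | rfl | rfl <;>
  rcases ht.cases with rfl | rfl | rfl | rfl | rfl <;>
  simp only [Prod.mk.injEq] at had hae hbd hbe <;>
  simp [upHit, downHit] <;>
  split_ifs <;> first | rfl | (exfalso; omega)

theorem ZMod.add_self_two (x : ZMod 2) : x + x = 0 := CharTwo.add_self_eq_zero x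

/-- Over `ZMod 2` a sum of consecutive sums telescopes. -/
theorem sum_range_add_succ_zmod_two (g : ℕ → ZMod 2) (m : ℕ) :
    ∑ i ∈ range m, (g i + g (i + 1)) = g 0 + g m := by
  induction m with
  | zero => simp [ZMod.add_self_two]
  | succ m ih =>
    rw [sum_range_succ, ih]
    linear_combination ZMod.add_self_two (g m)

/-- A lattice path, given by its sequence of points. -/
structure LatticePath (a b : ℤ × ℤ) where
  /-- the number of steps -/
  len : ℕ
  /-- the points of the path -/
  pt : ℕ → ℤ × ℤ
  start : pt 0 = a
  finish : pt len = b
  step : ∀ i < len, LatticeStep (pt i) (pt (i + 1))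

/-- Two lattice paths without a common point. -/
def LatticePath.Avoids {a b d e : ℤ × ℤ} (P : LatticePath a b) (Q : LatticePath d e) : Prop :=
  ∀ i ≤ P.len, ∀ j ≤ Q.len, P.pt i ≠ Q.pt j

/-- Parity of the number of hits of a lattice path by the upward ray from `c`. -/
def LatticePath.up {a b : ℤ × ℤ} (P : LatticePath a b) (c : ℤ × ℤ) : ZMod 2 :=
  ∑ i ∈ range P.len, upHit c (P.pt i) (P.pt (i + 1))

/-- Parity of the number of hits of a lattice path by the downward ray from `c`. -/
def LatticePath.down {a b : ℤ × ℤ} (P : LatticePath a b) (c : ℤ × ℤ) : ZMod 2 :=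
  ∑ i ∈ range P.len, downHit c (P.pt i) (P.pt (i + 1))

theorem LatticePath.up_add_down {a b c : ℤ × ℤ} (P : LatticePath a b)
    (hc : ∀ i ≤ P.len, P.pt i ≠ c) : P.up c + P.down c = lexBit a c + lexBit b c := by
  unfold LatticePath.up LatticePath.down
  rw [← sum_add_distrib, sum_congr rfl (g := fun i => lexBit (P.pt i) c + lexBit (P.pt (i + 1)) c),
    sum_range_add_succ_zmod_two (fun i => lexBit (P.pt i) c), P.start, P.finish]
  intro i hi
  rw [mem_range] at hi
  exact upHit_add_downHit (P.step i hi) (hc i hi.le) (hc (i + 1) hi)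

theorem LatticePath.Avoids.up_add_down {a b d e : ℤ × ℤ} {P : LatticePath a b}
    {Q : LatticePath d e} (h : P.Avoids Q) :
    Q.up a + Q.up b + (P.down d + P.down e) = 0 := by
  have h1 : ∑ i ∈ range P.len, (Q.up (P.pt i) + Q.up (P.pt (i + 1))) = Q.up a + Q.up b := by
    rw [sum_range_add_succ_zmod_two (fun i => Q.up (P.pt i)), P.start, P.finish]
  have h2 : ∑ j ∈ range Q.len, (P.down (Q.pt j) + P.down (Q.pt (j + 1))) =
      P.down d + P.down e := by
    rw [sum_range_add_succ_zmod_two (fun i => P.down (Q.pt i)), Q.start, Q.finish]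
  rw [← h1, ← h2]
  unfold LatticePath.up LatticePath.down
  simp only [← sum_add_distrib]
  rw [sum_comm (s := range Q.len), ← sum_add_distrib]
  refine sum_eq_zero fun i hi => ?_
  rw [← sum_add_distrib]
  refine sum_eq_zero fun j hj => ?_
  rw [mem_range] at hi hj
  exact upHit_add_downHit_of_steps (P.step i hi) (Q.step j hj) (h _ hi.le _ hj.le)
    (h _ hi.le _ hj) (h _ hi _ hj.le) (h _ hi _ hj)

/-- Five lattice points cannot be joined pairwise by lattice paths such that the paths of
independent pairs avoid each other. -/
theorem not_latticePath_complete_five (x : Fin 5 → ℤ × ℤ) (P : ∀ i j, LatticePath (x i) (x j))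
    (h : ∀ i j k l, i ≠ k → i ≠ l → j ≠ k → j ≠ l → i ≠ j → k ≠ l → (P i j).Avoids (P k l)) :
    False := by
  have hne : ∀ i j, i ≠ j → x i ≠ x j := by
    intro i j hij
    obtain ⟨k, l, h1, h2, h3, h4, h5⟩ : ∃ k l : Fin 5, i ≠ k ∧ j ≠ l ∧ i ≠ l ∧ k ≠ j ∧ k ≠ l := by
      revert hij; revert i j; decide
    have := h i k j l hij h3 h4 h5 h1 h2 0 (Nat.zero_le _) 0 (Nat.zero_le _)
    rwa [(P i k).start, (P j l).start] at this
  have key : ∀ i j k l, i ≠ k ∧ i ≠ l ∧ j ≠ k ∧ j ≠ l ∧ i ≠ j ∧ k ≠ l →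
      (P k l).up (x i) + (P k l).up (x j) + (P i j).up (x k) + (P i j).up (x l) +
        (lexBit (x i) (x k) + lexBit (x j) (x k) + lexBit (x i) (x l) + lexBit (x j) (x l)) = 0 := by
    rintro i j k l ⟨h1, h2, h3, h4, h5, h6⟩
    have hA := h i j k l h1 h2 h3 h4 h5 h6
    have e1 := hA.up_add_down
    have e2 := (P i j).up_add_down (c := x k) fun s hs => by
      simpa only [(P k l).start] using hA s hs 0 (Nat.zero_le _)
    have e3 := (P i j).up_add_down (c := x l) fun s hs => by
      simpa only [(P k l).finish] using hA s hs _ le_rfl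
    linear_combination e1 - e2 - e3 + ZMod.add_self_two ((P i j).up (x k)) +
      ZMod.add_self_two ((P i j).up (x l))
  have lx : ∀ i j, i ≠ j → lexBit (x j) (x i) = 1 + lexBit (x i) (x j) := by
    intro i j hij
    linear_combination lexBit_add_lexBit (hne i j hij) - ZMod.add_self_two (lexBit (x i) (x j))
  have K (i j k l : Fin 5) (hd : i ≠ k ∧ i ≠ l ∧ j ≠ k ∧ j ≠ l ∧ i ≠ j ∧ k ≠ l) := key i j k l hd
  have s := congrArg₂ (· + ·)
    (congrArg₂ (· + ·)
    (congrArg₂ (· + ·) (congrArg₂ (· + ·) (K 0 1 2 3 (by decide)) (K 0 2 1 3 (by decide)))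
    (K 0 3 1 2 (by decide)))
    (congrArg₂ (· + ·) (congrArg₂ (· + ·) (K 0 1 2 4 (by decide)) (K 0 2 1 4 (by decide)))
    (K 0 4 1 2 (by decide))))
    (congrArg₂ (· + ·)
    (congrArg₂ (· + ·)
    (congrArg₂ (· + ·) (congrArg₂ (· + ·) (K 0 1 3 4 (by decide)) (K 0 3 1 4 (by decide)))
    (K 0 4 1 3 (by decide)))
    (congrArg₂ (· + ·) (congrArg₂ (· + ·) (K 0 2 3 4 (by decide)) (K 0 3 2 4 (by decide)))
    (K 0 4 2 3 (by decide))))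
    (congrArg₂ (· + ·) (congrArg₂ (· + ·) (K 1 2 3 4 (by decide)) (K 1 3 2 4 (by decide)))
    (K 1 4 2 3 (by decide))))
  simp only [lx 1 2 (by decide), lx 1 3 (by decide), lx 1 4 (by decide), lx 2 3 (by decide),
    lx 2 4 (by decide), lx 3 4 (by decide)] at s
  ring_nf at s
  reduce_mod_char at s
  exact one_ne_zero s

/-- The lattice point at the lower left of a point of the plane, after scaling by `N`. -/
noncomputable def latticeFloor (N : ℝ) (z : ℝ × ℝ) : ℤ × ℤ := (⌊N * z.1⌋, ⌊N * z.2⌋)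

theorem abs_floor_sub_le_one (x : ℝ) : |(⌊x⌋ : ℝ) - x| ≤ 1 := by
  rw [abs_le]
  constructor <;> linarith [Int.floor_le x, Int.lt_floor_add_one x]

theorem natAbs_floor_sub_floor_le_one {x y : ℝ} (h : |x - y| < 1) :
    (⌊x⌋ - ⌊y⌋).natAbs ≤ 1 := by
  have h1 : ⌊x⌋ < ⌊y⌋ + 2 := by
    rw [← Int.cast_lt (R := ℝ)]; push_cast
    linarith [Int.floor_le x, Int.lt_floor_add_one y, (abs_lt.1 h).2]
  have h2 : ⌊y⌋ < ⌊x⌋ + 2 := by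
    rw [← Int.cast_lt (R := ℝ)]; push_cast
    linarith [Int.floor_le y, Int.lt_floor_add_one x, (abs_lt.1 h).1]
  omega

/-- A continuous path, scaled by `N`, is followed at bounded distance by a lattice path. -/
theorem exists_latticePath {a b : ℝ × ℝ} (γ : Path a b) {N : ℝ} (hN : 0 < N) :
    ∃ P : LatticePath (latticeFloor N a) (latticeFloor N b), ∀ i ≤ P.len, ∃ t : I,
      |((P.pt i).1 : ℝ) - N * (γ t).1| ≤ 2 ∧ |((P.pt i).2 : ℝ) - N * (γ t).2| ≤ 2 := by
  have huc : UniformContinuous γ := CompactSpace.uniformContinuous_of_continuous γ.continuous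
  obtain ⟨δ, hδ, hγ⟩ := Metric.uniformContinuous_iff.1 huc (1 / N) (by positivity)
  obtain ⟨n, hn⟩ := exists_nat_one_div_lt hδ
  set τ : ℕ → I := fun i => Set.projIcc 0 1 zero_le_one ((i : ℝ) / (n + 1)) with hτ
  have hpos : (0 : ℝ) < n + 1 := by positivity
  have hstep : ∀ i, dist (γ (τ i)) (γ (τ (i + 1))) < 1 / N := by
    intro i
    refine hγ (lt_of_le_of_lt ?_ hn)
    have := (LipschitzWith.projIcc (zero_le_one (α := ℝ))).dist_le_mul ((i : ℝ) / (n + 1))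
      (((i + 1 : ℕ) : ℝ) / (n + 1))
    refine this.trans ?_
    rw [Real.dist_eq, ← sub_div, abs_div, abs_of_pos hpos]
    simp
  have hcoord : ∀ i, |N * (γ (τ i)).1 - N * (γ (τ (i + 1))).1| < 1 ∧
      |N * (γ (τ i)).2 - N * (γ (τ (i + 1))).2| < 1 := by
    intro i
    have := hstep i
    rw [Prod.dist_eq, max_lt_iff, Real.dist_eq, Real.dist_eq, lt_div_iff₀ hN, lt_div_iff₀ hN] at this
    rw [← mul_sub, ← mul_sub, abs_mul, abs_mul, abs_of_pos hN, mul_comm N, mul_comm N]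
    exact this
  set g : ℕ → ℤ × ℤ := fun i => latticeFloor N (γ (τ i)) with hg
  have hgs : ∀ i, ((g i).1 - (g (i + 1)).1).natAbs ≤ 1 ∧ ((g i).2 - (g (i + 1)).2).natAbs ≤ 1 :=
    fun i => ⟨natAbs_floor_sub_floor_le_one (hcoord i).1, natAbs_floor_sub_floor_le_one (hcoord i).2⟩
  refine ⟨⟨2 * (n + 1), fun k => if k % 2 = 0 then g (k / 2) else ((g (k / 2 + 1)).1, (g (k / 2)).2),
    ?_, ?_, ?_⟩, ?_⟩
  · simp [hg, hτ]
  · have h1 : τ (n + 1) = 1 := by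
      simp only [hτ, Nat.cast_add, Nat.cast_one, div_self hpos.ne']
      exact Set.projIcc_right (zero_le_one (α := ℝ))
    simp [hg, h1]
  · intro k _
    obtain ⟨m, rfl | rfl⟩ := Nat.even_or_odd' k
    · have e1 : (2 * m + 1) % 2 = 1 := by omega
      have e2 : (2 * m + 1) / 2 = m := by omega
      have := (hgs m).1
      simpa [e1, e2, LatticeStep] using this
    · have e1 : (2 * m + 1) % 2 = 1 := by omega
      have e2 : (2 * m + 1) / 2 = m := by omega
      have e3 : (2 * m + 1 + 1) % 2 = 0 := by omega
      have e4 : (2 * m + 1 + 1) / 2 = m + 1 := by omega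
      have := (hgs m).2
      simpa [e1, e2, e3, e4, LatticeStep] using this
  · intro k _
    refine ⟨τ (k / 2), ?_⟩
    have f1 := abs_floor_sub_le_one (N * (γ (τ (k / 2))).1)
    have f2 := abs_floor_sub_le_one (N * (γ (τ (k / 2))).2)
    have f3 := abs_floor_sub_le_one (N * (γ (τ (k / 2 + 1))).1)
    have f4 := (hcoord (k / 2)).1
    simp only [hg, latticeFloor]
    split_ifs
    · exact ⟨f1.trans one_le_two, f2.trans one_le_two⟩
    · refine ⟨?_, f2.trans one_le_two⟩
      rw [abs_le] at *
      rw [abs_lt] at f4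
      constructor <;> linarith

theorem exists_pos_le_dist_of_disjoint {a b c d : ℝ × ℝ} (γ : Path a b) (η : Path c d)
    (h : ∀ s t, γ s ≠ η t) : ∃ ε > 0, ∀ s t, ε ≤ dist (γ s) (η t) := by
  have hc : Continuous fun p : I × I => dist (γ p.1) (η p.2) := by fun_prop
  obtain ⟨p, -, hp⟩ := isCompact_univ.exists_isMinOn Set.univ_nonempty hc.continuousOn
  exact ⟨_, dist_pos.2 (h p.1 p.2), fun s t => isMinOn_iff.1 hp (s, t) (Set.mem_univ _)⟩

/-- The complete graph on five vertices has no drawing in the plane in which independent edges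
are disjoint. -/
theorem not_path_complete_five (x : Fin 5 → ℝ × ℝ) (γ : ∀ i j, Path (x i) (x j))
    (h : ∀ i j k l, i ≠ k → i ≠ l → j ≠ k → j ≠ l → i ≠ j → k ≠ l → ∀ s t, γ i j s ≠ γ k l t) :
    False := by
  have h1 : ∀ q : Fin 5 × Fin 5 × Fin 5 × Fin 5, ∃ ε > 0, q.1 ≠ q.2.2.1 → q.1 ≠ q.2.2.2 →
      q.2.1 ≠ q.2.2.1 → q.2.1 ≠ q.2.2.2 → q.1 ≠ q.2.1 → q.2.2.1 ≠ q.2.2.2 →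
      ∀ s t, ε ≤ dist (γ q.1 q.2.1 s) (γ q.2.2.1 q.2.2.2 t) := by
    rintro ⟨i, j, k, l⟩
    by_cases hq : i ≠ k ∧ i ≠ l ∧ j ≠ k ∧ j ≠ l ∧ i ≠ j ∧ k ≠ l
    · obtain ⟨ε, hε, hd⟩ := exists_pos_le_dist_of_disjoint (γ i j) (γ k l)
        (h i j k l hq.1 hq.2.1 hq.2.2.1 hq.2.2.2.1 hq.2.2.2.2.1 hq.2.2.2.2.2)
      exact ⟨ε, hε, fun _ _ _ _ _ _ => hd⟩
    · exact ⟨1, one_pos, fun a b c d e f => absurd ⟨a, b, c, d, e, f⟩ hq⟩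
  choose ε hε hd using h1
  obtain ⟨q₀, hq₀⟩ := Finite.exists_min ε
  have hpos := hε q₀
  have hN : 0 < 5 / ε q₀ := by positivity
  choose P hP using fun i j => exists_latticePath (γ i j) hN
  refine not_latticePath_complete_five _ P fun i j k l h1 h2 h3 h4 h5 h6 m hm n hn heq => ?_
  obtain ⟨s, hs1, hs2⟩ := hP i j m hm
  obtain ⟨t, ht1, ht2⟩ := hP k l n hn
  rw [heq] at hs1 hs2
  have hle := (hq₀ (i, j, k, l)).trans (hd (i, j, k, l) h1 h2 h3 h4 h5 h6 s t)
  have aux : ∀ {u v w : ℝ}, |w - 5 / ε q₀ * u| ≤ 2 → |w - 5 / ε q₀ * v| ≤ 2 →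
      dist u v < ε q₀ := by
    intro u v w hu hv
    have hm : |5 / ε q₀ * (u - v)| ≤ 4 := by
      rw [abs_le] at *
      constructor <;> linarith
    rw [abs_mul, abs_of_pos hN, div_mul_eq_mul_div, div_le_iff₀ hpos] at hm
    rw [Real.dist_eq]
    linarith
  refine absurd hle (not_le.2 ?_)
  rw [Prod.dist_eq]
  exact max_lt (aux hs1 ht1) (aux hs2 ht2)

/-! ## Models of `K₅` -/

/-- The set `W` of vertices of `G` carries a model of `K₅`: five pairwise disjoint and pairwise
adjacent connected branch sets. -/
def HasCompleteFiveMinor {V : Type*} (G : SimpleGraph V) (W : Finset V) : Prop :=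
  ∃ B : Fin 5 → Set V, (∀ i, B i ⊆ W) ∧ (∀ i, (G.induce (B i)).Preconnected) ∧
    (∀ i j, i ≠ j → Disjoint (B i) (B j)) ∧ ∀ i j, i ≠ j → ∃ u ∈ B i, ∃ v ∈ B j, G.Adj u v

/-- The part of a drawing that belongs to the vertex set `A`. -/
def drawingOn {V : Type*} {G : SimpleGraph V} (f : V → ℝ × ℝ)
    (arc : ∀ u v : V, G.Adj u v → (I → ℝ × ℝ)) (A : Set V) : Set (ℝ × ℝ) :=
  Set.image f A ∪ {z | ∃ u ∈ A, ∃ v ∈ A, ∃ h : G.Adj u v, ∃ t, arc u v h t = z}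

theorem drawingOn_mono {V : Type*} {G : SimpleGraph V} {f : V → ℝ × ℝ}
    {arc : ∀ u v : V, G.Adj u v → (I → ℝ × ℝ)} {A B : Set V} (h : A ⊆ B) :
    drawingOn f arc A ⊆ drawingOn f arc B := by
  rintro z (⟨v, hv, rfl⟩ | ⟨u, hu, v, hv, e, t, rfl⟩)
  · exact Or.inl ⟨v, h hv, rfl⟩
  · exact Or.inr ⟨u, h hu, v, h hv, e, t, rfl⟩

theorem joinedIn_drawingOn_of_adj {V : Type*} {G : SimpleGraph V} {f : V → ℝ × ℝ}
    {arc : ∀ u v : V, G.Adj u v → (I → ℝ × ℝ)} (hc : ∀ u v h, Continuous (arc u v h))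
    (he : ∀ u v h, arc u v h 0 = f u ∧ arc u v h 1 = f v) {A : Set V} {u v : V} (hu : u ∈ A)
    (hv : v ∈ A) (h : G.Adj u v) : JoinedIn (drawingOn f arc A) (f u) (f v) :=
  ⟨⟨⟨arc u v h, hc u v h⟩, (he u v h).1, (he u v h).2⟩,
    fun t => Or.inr ⟨u, hu, v, hv, h, t, rfl⟩⟩

theorem joinedIn_drawingOn {V : Type*} {G : SimpleGraph V} {f : V → ℝ × ℝ}
    {arc : ∀ u v : V, G.Adj u v → (I → ℝ × ℝ)} (hc : ∀ u v h, Continuous (arc u v h))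
    (he : ∀ u v h, arc u v h 0 = f u ∧ arc u v h 1 = f v) {A : Set V}
    (hA : (G.induce A).Preconnected) {u v : V} (hu : u ∈ A) (hv : v ∈ A) :
    JoinedIn (drawingOn f arc A) (f u) (f v) := by
  obtain ⟨p⟩ := hA ⟨u, hu⟩ ⟨v, hv⟩
  have key : ∀ {a b : A} (_ : (G.induce A).Walk a b), JoinedIn (drawingOn f arc A) (f a) (f b) := by
    intro a b p
    induction p with
    | nil => exact JoinedIn.refl (Or.inl ⟨_, Subtype.coe_prop _, rfl⟩)
    | @cons a b c h _ ih => exact (joinedIn_drawingOn_of_adj hc he a.2 b.2 h).trans ih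
  exact key p

/-- A graph drawn in the plane has no `K₅` minor. -/
theorem IsPlanar.not_hasCompleteFiveMinor {V : Type*} {G : SimpleGraph V} (hG : IsPlanar G)
    (W : Finset V) : ¬ HasCompleteFiveMinor G W := by
  rintro ⟨B, -, hconn, hdisj, hadj⟩
  obtain ⟨f, arc, hinj, hc, -, he, hsymm, hv, hcross⟩ := hG
  have hends : ∀ u v h t, (t = 0 → arc u v h t = f u) ∧ (t = 1 → arc u v h t = f v) :=
    fun u v h t => ⟨fun ht => ht ▸ (he u v h).1, fun ht => ht ▸ (he u v h).2⟩
  have hD : ∀ {A C : Set V}, Disjoint A C → Disjoint (drawingOn f arc A) (drawingOn f arc C) := by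
    intro A C hAC
    have hvert : ∀ {A C : Set V}, Disjoint A C → ∀ w ∈ C, f w ∉ drawingOn f arc A := by
      rintro A C hAC w hw (⟨v, hv, heq⟩ | ⟨u, hu, v, hv', h, t, heq⟩)
      · exact Set.disjoint_left.1 hAC hv (hinj heq ▸ hw)
      · by_cases h0 : t = 0
        · rw [(hends u v h t).1 h0] at heq
          exact Set.disjoint_left.1 hAC hu (hinj heq ▸ hw)
        by_cases h1 : t = 1
        · rw [(hends u v h t).2 h1] at heq
          exact Set.disjoint_left.1 hAC hv' (hinj heq ▸ hw)
        exact hv u v h t h0 h1 w heq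
    rw [Set.disjoint_left]
    rintro z hz (⟨v, hv, rfl⟩ | ⟨u, hu, v, hv', h, t, rfl⟩)
    · exact hvert hAC v hv hz
    by_cases h0 : t = 0
    · rw [(hends u v h t).1 h0] at hz
      exact hvert hAC u hu hz
    by_cases h1 : t = 1
    · rw [(hends u v h t).2 h1] at hz
      exact hvert hAC v hv' hz
    rcases hz with ⟨w, hw, heq⟩ | ⟨u', hu', v', hvB, h', t', heq⟩
    · exact hv u v h t h0 h1 w heq.symm
    · refine hcross u v h u' v' h' (fun hs => ?_) t t' h0 h1 heq.symm
      rcases Sym2.eq_iff.1 hs with ⟨rfl, -⟩ | ⟨rfl, -⟩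
      · exact Set.disjoint_left.1 hAC hu' hu
      · exact Set.disjoint_left.1 hAC hvB hu
  have hne : ∀ i, ∃ v, v ∈ B i := by
    intro i
    obtain ⟨j, hj⟩ : ∃ j, i ≠ j := ⟨i + 1, by revert i; decide⟩
    obtain ⟨u, hu, -⟩ := hadj i j hj
    exact ⟨u, hu⟩
  choose b hb using hne
  have hpath : ∀ i j, ∃ γ : Path (f (b i)) (f (b j)), ∀ t, γ t ∈ drawingOn f arc (B i ∪ B j) := by
    intro i j
    by_cases hij : i = j
    · subst hij
      exact ⟨Path.refl _, fun _ => Or.inl ⟨_, Or.inl (hb i), rfl⟩⟩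
    obtain ⟨u, hu, v, hv, h⟩ := hadj i j hij
    have h1 := (joinedIn_drawingOn hc he (hconn i) (hb i) hu).mono
      (drawingOn_mono (Set.subset_union_left (t := B j)))
    have h2 := (joinedIn_drawingOn hc he (hconn j) hv (hb j)).mono
      (drawingOn_mono (Set.subset_union_right (s := B i)))
    have h3 := joinedIn_drawingOn_of_adj hc he (A := B i ∪ B j) (Or.inl hu) (Or.inr hv) h
    have h4 := (h1.trans h3).trans h2
    exact ⟨h4.somePath, h4.somePath_mem⟩
  choose γ hγ using hpath
  refine not_path_complete_five _ γ fun i j k l h1 h2 h3 h4 _ _ s t heq => ?_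
  have hd : Disjoint (B i ∪ B j) (B k ∪ B l) := by
    rw [Set.disjoint_union_left, Set.disjoint_union_right, Set.disjoint_union_right]
    exact ⟨⟨hdisj i k h1, hdisj i l h2⟩, hdisj j k h3, hdisj j l h4⟩
  exact Set.disjoint_left.1 (hD hd) (hγ i j s) (heq ▸ hγ k l t)

/-! ## Degrees inside vertex sets and dense sets -/

section DenseSets

open scoped Classical

variable {V : Type*} {G : SimpleGraph V} {S T W : Finset V}

/-- The number of neighbours of `v` in the finite set `W`. -/
noncomputable def degOn (G : SimpleGraph V) (W : Finset V) (v : V) : ℕ := #{u ∈ W | G.Adj v u}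

theorem degOn_sdiff_add (h : S ⊆ T) (v : V) : degOn G (T \ S) v + degOn G S v = degOn G T v := by
  unfold degOn
  rw [← card_union_of_disjoint (disjoint_filter_filter sdiff_disjoint), ← filter_union,
    sdiff_union_of_subset h]

theorem degOn_insert {x : V} (hx : x ∉ S) (v : V) :
    degOn G (insert x S) v = degOn G S v + if G.Adj v x then 1 else 0 := by
  unfold degOn
  rw [filter_insert]
  split_ifs
  · exact card_insert_of_notMem (by simp [hx])
  · rfl

theorem degOn_lt_card {v : V} (hv : v ∈ S) : degOn G S v < #S :=
  card_lt_card (filter_ssubset.2 ⟨v, hv, G.loopless.irrefl v⟩)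

theorem degOn_pos_iff {v : V} : 0 < degOn G S v ↔ ∃ u ∈ S, G.Adj v u := by
  simp [degOn, card_pos, Finset.Nonempty]

theorem sum_degOn_comm (S T : Finset V) : ∑ v ∈ S, degOn G T v = ∑ v ∈ T, degOn G S v := by
  simp only [degOn, card_filter]
  rw [sum_comm]
  simp only [G.adj_comm]

theorem sum_degOn_sdiff (h : S ⊆ T) :
    ∑ v ∈ T \ S, degOn G (T \ S) v + 2 * ∑ v ∈ S, degOn G T v =
      ∑ v ∈ T, degOn G T v + ∑ v ∈ S, degOn G S v := by
  have h1 : ∑ v ∈ T \ S, degOn G T v + ∑ v ∈ S, degOn G T v = ∑ v ∈ T, degOn G T v :=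
    sum_sdiff h
  have h2 : ∑ v ∈ T \ S, degOn G T v =
      ∑ v ∈ T \ S, degOn G (T \ S) v + ∑ v ∈ T \ S, degOn G S v := by
    rw [← sum_add_distrib]
    exact sum_congr rfl fun v _ => (degOn_sdiff_add h v).symm
  have h3 : ∑ v ∈ S, degOn G T v = ∑ v ∈ S, degOn G (T \ S) v + ∑ v ∈ S, degOn G S v := by
    rw [← sum_add_distrib]
    exact sum_congr rfl fun v _ => (degOn_sdiff_add h v).symm
  have h4 := sum_degOn_comm (G := G) (T \ S) S
  omega

theorem degree_induce (v : (S : Set V)) : (G.induce (S : Set V)).degree v = degOn G S v := by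
  rw [← SimpleGraph.card_neighborFinset_eq_degree, degOn,
    ← card_map (Function.Embedding.subtype _)]
  congr 1
  ext u
  simp [and_comm]

theorem sum_degOn_eq (S : Finset V) :
    ∑ v ∈ S, degOn G S v = 2 * #(G.induce (S : Set V)).edgeFinset := by
  rw [← SimpleGraph.sum_degrees_eq_twice_card_edges, ← sum_coe_sort S]
  exact sum_congr rfl fun v _ => (degree_induce v).symm

theorem even_sum_degOn (S : Finset V) : Even (∑ v ∈ S, degOn G S v) :=
  ⟨_, (sum_degOn_eq S).trans (two_mul _)⟩

/-- A nonempty vertex set which spans at least as many edges as it has elements. -/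
def IsDense (G : SimpleGraph V) (S : Finset V) : Prop :=
  S.Nonempty ∧ 2 * #S ≤ ∑ v ∈ S, degOn G S v

theorem isDense_of_two_le_degOn (hS : S.Nonempty) (h : ∀ v ∈ S, 2 ≤ degOn G S v) :
    IsDense G S :=
  ⟨hS, by simpa [mul_comm] using card_nsmul_le_sum S _ 2 h⟩

/-- A dense set contains the vertices of a cycle. -/
theorem IsDense.exists_isCycle (h : IsDense G S) :
    ∃ (v : V) (c : G.Walk v v), c.IsCycle ∧ ∀ x ∈ c.support, x ∈ S := by
  have hS : ¬ (G.induce (S : Set V)).IsAcyclic := by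
    intro hac
    obtain ⟨s, hs⟩ := h.1
    have : Nonempty (S : Set V) := ⟨⟨s, hs⟩⟩
    obtain ⟨F, hF, -, hT⟩ := SimpleGraph.connected_top.exists_isTree_le_of_le_of_isAcyclic
      (le_top (a := G.induce (S : Set V))) hac
    have h1 := hT.card_edgeFinset
    have h2 : #(G.induce (S : Set V)).edgeFinset ≤ #F.edgeFinset :=
      card_le_card (SimpleGraph.edgeFinset_mono hF)
    have h3 := h.2
    rw [sum_degOn_eq] at h3
    have h4 : Fintype.card (S : Set V) = #S := by simp
    omega
  simp only [SimpleGraph.IsAcyclic, not_forall, not_not] at hS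
  obtain ⟨v, c, hc⟩ := hS
  let f : G.induce (S : Set V) →g G := ⟨Subtype.val, fun h => h⟩
  refine ⟨f v, c.map f, hc.map Subtype.val_injective, fun x hx => ?_⟩
  · rw [SimpleGraph.Walk.support_map, List.mem_map] at hx
    obtain ⟨y, -, rfl⟩ := hx
    exact y.2

/-- The set `W` contains `k` pairwise disjoint dense sets. -/
def HasDisjointDense (G : SimpleGraph V) : ℕ → Finset V → Prop
  | 0, _ => True
  | k + 1, W => ∃ S ⊆ W, IsDense G S ∧ HasDisjointDense G k (W \ S)

theorem HasDisjointDense.mono {k : ℕ} (h : HasDisjointDense G k S) (hST : S ⊆ T) :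
    HasDisjointDense G k T := by
  induction k generalizing S T with
  | zero => trivial
  | succ k ih =>
    obtain ⟨R, hR, hd, hk⟩ := h
    exact ⟨R, hR.trans hST, hd, ih hk (sdiff_subset_sdiff hST subset_rfl)⟩

theorem HasDisjointDense.exists_isCycle {k : ℕ} (h : HasDisjointDense G k W) :
    ∃ (v : Fin k → V) (c : ∀ i, G.Walk (v i) (v i)), (∀ i, (c i).IsCycle) ∧
      (∀ i j, i ≠ j → ∀ x, x ∈ (c i).support → x ∉ (c j).support) ∧
      ∀ i, ∀ x ∈ (c i).support, x ∈ W := by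
  induction k generalizing W with
  | zero => exact ⟨Fin.elim0, fun i => i.elim0, fun i => i.elim0, fun i => i.elim0, fun i => i.elim0⟩
  | succ k ih =>
    obtain ⟨S, hS, hd, hk⟩ := h
    obtain ⟨v₀, c₀, hc₀, hs₀⟩ := hd.exists_isCycle
    obtain ⟨v, c, hc, hdis, hs⟩ := ih hk
    refine ⟨Fin.cons v₀ v, Fin.cases c₀ c, Fin.cases hc₀ hc, ?_, ?_⟩
    · refine Fin.cases (Fin.cases (fun h => absurd rfl h) fun j _ x hx hx' => ?_) fun i =>
        Fin.cases (fun _ x hx hx' => ?_) fun j hij => hdis i j fun h => hij (congrArg Fin.succ h)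
      · exact (mem_sdiff.1 (hs j x hx')).2 (hs₀ x hx)
      · exact (mem_sdiff.1 (hs i x hx)).2 (hs₀ x hx')
    · exact Fin.cases (fun x hx => hS (hs₀ x hx)) fun i x hx => (mem_sdiff.1 (hs i x hx)).1

theorem HasDisjointDense.hasDisjointCycles {k : ℕ} (h : HasDisjointDense G k W) :
    HasDisjointCycles G k := by
  obtain ⟨v, c, hc, hd, -⟩ := h.exists_isCycle
  exact ⟨v, c, hc, hd⟩

/-! ### Triangle-free graphs -/

theorem IsDense.exists_minimal (h : IsDense G W) :
    ∃ S ⊆ W, IsDense G S ∧ ∀ T ⊆ W, IsDense G T → #S ≤ #T := by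
  obtain ⟨S, hS, hmin⟩ := exists_min_image {S ∈ W.powerset | IsDense G S} card
    ⟨W, by simp [h]⟩
  simp only [mem_filter, mem_powerset] at hS hmin
  exact ⟨S, hS.1, hS.2, fun T hT hd => hmin T ⟨hT, hd⟩⟩

/-- A dense set of minimum size induces a `2`-regular graph. -/
theorem IsDense.degOn_eq_two_of_minimal (h : IsDense G S)
    (hmin : ∀ T ⊆ S, IsDense G T → #S ≤ #T) {u : V} (hu : u ∈ S) : degOn G S u = 2 := by
  obtain ⟨m, hm⟩ := even_sum_degOn (G := G) S
  have hd := h.2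
  have h3 : 3 ≤ #S := by
    have hlt : ∑ v ∈ S, (degOn G S v + 1) ≤ ∑ v ∈ S, #S := sum_le_sum fun v => degOn_lt_card
    rw [sum_add_distrib, sum_const, sum_const, smul_eq_mul, smul_eq_mul] at hlt
    have := card_pos.2 h.1
    nlinarith
  have key : ∀ v ∈ S, m + 2 ≤ degOn G S v + #S := by
    intro v hv
    have hle := degOn_lt_card (G := G) hv
    have h1 := sum_degOn_sdiff (G := G) (singleton_subset_iff.2 hv)
    simp only [sum_singleton] at h1
    have hc : #(S \ {v}) + 1 = #S := by
      rw [← erase_eq, card_erase_add_one hv]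
    have h5 : degOn G {v} v = 0 := by
      have := degOn_lt_card (G := G) (mem_singleton_self v)
      rw [card_singleton] at this
      omega
    by_contra! hlt
    have := hmin (S \ {v}) sdiff_subset ⟨card_pos.1 (by omega), by omega⟩
    omega
  have hsum : ∑ v ∈ S, (m + 2) ≤ ∑ v ∈ S, (degOn G S v + #S) := sum_le_sum key
  rw [sum_const, sum_add_distrib, sum_const, hm, smul_eq_mul, smul_eq_mul] at hsum
  have hm' : m = #S := by
    obtain ⟨s, rfl⟩ : ∃ s, m = #S + s := ⟨m - #S, by omega⟩
    have : #S * s ≤ 2 * s := by nlinarith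
    have : s = 0 := by
      by_contra h0
      have := Nat.le_of_mul_le_mul_right this (Nat.pos_of_ne_zero h0)
      omega
    omega
  have heq : ∑ v ∈ S, 2 = ∑ v ∈ S, degOn G S v := by
    rw [hm, hm', sum_const, smul_eq_mul, mul_two]
  exact ((sum_eq_sum_iff_of_le fun v hv => by have := key v hv; omega).1 heq u hu).symm

/-- A vertex set without triangles in which all degrees are at least `2 * k` contains `k`
disjoint dense sets. -/
theorem hasDisjointDense_of_triangleFree (k : ℕ) (hW : W.Nonempty)
    (hdeg : ∀ v ∈ W, 2 * k ≤ degOn G W v)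
    (htri : ∀ a ∈ W, ∀ b ∈ W, ∀ c ∈ W, G.Adj a b → G.Adj a c → ¬ G.Adj b c) :
    HasDisjointDense G k W := by
  induction k generalizing W with
  | zero => trivial
  | succ k ih =>
    obtain ⟨S, hS, hd, hmin⟩ := (isDense_of_two_le_degOn (G := G) hW fun v hv => by
      have := hdeg v hv; omega).exists_minimal
    have htwo : ∀ u ∈ S, degOn G S u = 2 := fun u hu =>
      hd.degOn_eq_two_of_minimal (fun T hT => hmin T (hT.trans hS)) hu
    have hout : ∀ v ∈ W \ S, degOn G S v ≤ 2 := by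
      intro v hv
      by_contra! h3
      obtain ⟨hvW, hvS⟩ := mem_sdiff.1 hv
      obtain ⟨s, hs⟩ := hd.1
      obtain ⟨u, hu, huv⟩ : ∃ u ∈ S, ¬ G.Adj v u := by
        by_contra! hall
        obtain ⟨w, hw, hsw⟩ := degOn_pos_iff.1 (by rw [htwo s hs]; exact two_pos)
        exact htri v hvW s (hS hs) w (hS hw) (hall s hs) (hall w hw) hsw
      obtain ⟨w, hw, huw⟩ := degOn_pos_iff.1 (by rw [htwo u hu]; exact two_pos)
      have hR : {u, w} ⊆ insert v S := by
        intro z hz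
        rcases mem_insert.1 hz with rfl | hz
        · exact mem_insert_of_mem hu
        · rw [mem_singleton.1 hz]; exact mem_insert_of_mem hw
      have h1 := sum_degOn_sdiff (G := G) hR
      have h2 := sum_degOn_sdiff (G := G) (subset_insert v S)
      have hvS' : insert v S \ S = {v} := by
        ext z; simp only [mem_sdiff, mem_insert, mem_singleton]
        constructor
        · tauto
        · rintro rfl; tauto
      have hvv : degOn G {v} v = 0 := by
        have := degOn_lt_card (G := G) (mem_singleton_self v)
        rw [card_singleton] at this
        omega
      rw [hvS', sum_singleton, hvv] at h2
      have h4 : ∑ z ∈ S, degOn G S z = 2 * #S := by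
        rw [sum_congr rfl htwo, sum_const, smul_eq_mul, mul_comm]
      have h5 : ∑ z ∈ S, degOn G (insert v S) z = 2 * #S + degOn G S v := by
        simp only [degOn_insert hvS, sum_add_distrib, h4]
        simp only [degOn, card_filter, G.adj_comm]
      have huw' := huw.ne
      rw [sum_pair huw', sum_pair huw', degOn_insert hvS u, degOn_insert hvS w, htwo u hu, htwo w hw,
        if_neg (fun h => huv h.symm)] at h1
      have hif : (if G.Adj w v then 1 else 0) ≤ 1 := by split_ifs <;> omega
      have h6 : 1 ≤ degOn G {u, w} u := degOn_pos_iff.2 ⟨w, by simp, huw⟩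
      have h7 : 1 ≤ degOn G {u, w} w := degOn_pos_iff.2 ⟨u, by simp, huw.symm⟩
      have hcard : #(insert v S \ {u, w}) + 2 = #S + 1 := by
        rw [← card_pair huw', card_sdiff_add_card_eq_card hR, card_insert_of_notMem hvS]
      have hSc := degOn_lt_card (G := G) hu
      rw [htwo u hu] at hSc
      have := hmin (insert v S \ {u, w}) (sdiff_subset.trans (insert_subset hvW hS))
        ⟨card_pos.1 (by omega), by omega⟩
      omega
    refine ⟨S, hS, hd, ?_⟩
    rcases Nat.eq_zero_or_pos k with rfl | hk
    · trivial
    obtain ⟨s, hs⟩ := hd.1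
    have h1 := degOn_sdiff_add (G := G) hS
    refine ih ?_ (fun v hv => ?_) fun a ha b hb c hc => htri a (sdiff_subset ha) b
      (sdiff_subset hb) c (sdiff_subset hc)
    · have := h1 s
      rw [htwo s hs] at this
      have h2 := hdeg s (hS hs)
      obtain ⟨w, hw, -⟩ := degOn_pos_iff.1 (show 0 < degOn G (W \ S) s by omega)
      exact ⟨w, hw⟩
    · have := h1 v
      have h2 := hdeg v (sdiff_subset hv)
      have h3 := hout v hv
      omega

/-! ### `K₅` minors from joins of an edge and a cycle -/

theorem SimpleGraph.Walk.IsCycle.exists_three_branch_sets {v₀ : V} {c : G.Walk v₀ v₀}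
    (hc : c.IsCycle) : ∃ p ∈ c.support, ∃ q ∈ c.support, G.Adj p q ∧ ∃ D : Set V,
      (∀ x ∈ D, x ∈ c.support) ∧ p ∉ D ∧ q ∉ D ∧ (G.induce D).Preconnected ∧
      (∃ u ∈ D, G.Adj p u) ∧ ∃ u ∈ D, G.Adj q u := by
  match c, hc with
  | .nil, hc => exact absurd hc SimpleGraph.Walk.not_isCycle_nil
  | .cons h1 .nil, _ => exact absurd h1 (G.loopless.irrefl _)
  | .cons (v := v₁) h1 (.cons (v := v₂) h2 r), hc =>
    rw [SimpleGraph.Walk.cons_isCycle_iff, SimpleGraph.Walk.cons_isPath_iff] at hc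
    obtain ⟨⟨hr, hv₁⟩, hedge⟩ := hc
    have hsub : ∀ x ∈ r.reverse.support, x ∈ r.support := by
      simp
    have hr' := hr.reverse
    generalize r.reverse = r' at hr' hsub
    cases r' with
    | nil => exact absurd (by simp [Sym2.eq_swap]) hedge
    | cons h3 t =>
      rw [SimpleGraph.Walk.cons_isPath_iff] at hr'
      refine ⟨v₀, by simp, v₁, by simp, h1, {x | x ∈ t.support}, fun x hx => ?_, hr'.2,
        fun hx => hv₁ (hsub _ (by simp [show v₁ ∈ t.support from hx])),
        t.connected_induce_support.preconnected, ⟨_, t.start_mem_support, h3⟩,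
        ⟨_, t.end_mem_support, h2⟩⟩
      have := hsub x (by simp [show x ∈ t.support from hx])
      simp [this]

theorem hasCompleteFiveMinor_of_isDense {a b : V} (ha : a ∈ W) (hb : b ∈ W) (hab : G.Adj a b)
    (hd : IsDense G {v ∈ W | G.Adj a v ∧ G.Adj b v}) : HasCompleteFiveMinor G W := by
  obtain ⟨v, c, hc, hs⟩ := hd.exists_isCycle
  obtain ⟨p, hp, q, hq, hpq, D, hD, hpD, hqD, hconn, ⟨s, hsD, hps⟩, ⟨t, htD, hqt⟩⟩ :=
    hc.exists_three_branch_sets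
  have hs' : ∀ x ∈ c.support, x ∈ W ∧ G.Adj a x ∧ G.Adj b x := fun x hx => by
    simpa using hs x hx
  have hp' := hs' p hp
  have hq' := hs' q hq
  have hD' := fun x hx => hs' x (hD x hx)
  have haD : a ∉ D := fun h => G.loopless.irrefl _ (hD' a h).2.1
  have hbD : b ∉ D := fun h => G.loopless.irrefl _ (hD' b h).2.2
  have hsing : ∀ x : V, (G.induce {x}).Preconnected := fun x u v => by
    rw [Subsingleton.elim u v]
  have has := (hD' s hsD).2.1
  have hbs := (hD' s hsD).2.2
  refine ⟨![{a}, {b}, {p}, {q}, D], fun i => ?_, fun i => ?_, fun i j hij => ?_,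
    fun i j hij => ?_⟩
  · fin_cases i
    · simpa using ha
    · simpa using hb
    · simpa using hp'.1
    · simpa using hq'.1
    · exact fun x hx => (hD' x hx).1
  · fin_cases i
    exacts [hsing a, hsing b, hsing p, hsing q, hconn]
  · have h1 := hab.ne
    have h2 := hp'.2.1.ne
    have h3 := hp'.2.2.ne
    have h4 := hq'.2.1.ne
    have h5 := hq'.2.2.ne
    have h6 := hpq.ne
    fin_cases i <;> fin_cases j <;> first | exact absurd rfl hij | skip
    all_goals simp [haD, hbD, hpD, hqD, h1, h2, h3, h4, h5, h6, h1.symm, h2.symm, h3.symm,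
      h4.symm, h5.symm, h6.symm]
  · have h1 := hab
    obtain ⟨-, h2, h3⟩ := hp'
    obtain ⟨-, h4, h5⟩ := hq'
    fin_cases i <;> fin_cases j <;> first | exact absurd rfl hij | skip
    all_goals simp [hab, h2, h3, h4, h5, hpq, hab.symm, h2.symm, h3.symm, h4.symm, h5.symm,
      hpq.symm]
    exacts [⟨s, hsD, has⟩, ⟨s, hsD, hbs⟩, ⟨s, hsD, hps⟩, ⟨t, htD, hqt⟩, ⟨s, hsD, has.symm⟩,
      ⟨s, hsD, hbs.symm⟩, ⟨s, hsD, hps.symm⟩, ⟨t, htD, hqt.symm⟩]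

/-- Without a `K₅` minor, some triangle has at most one common neighbour. -/
theorem exists_triangle_card_common_le_one (hG : ¬ HasCompleteFiveMinor G W) {a b c : V}
    (ha : a ∈ W) (hb : b ∈ W) (hc : c ∈ W) (hab : G.Adj a b) (hac : G.Adj a c)
    (hbc : G.Adj b c) : ∃ x ∈ W, ∃ y ∈ W, ∃ z ∈ W, G.Adj x y ∧ G.Adj x z ∧ G.Adj y z ∧
      #{v ∈ W | G.Adj v x ∧ G.Adj v y ∧ G.Adj v z} ≤ 1 := by
  by_contra! hall
  refine hG (hasCompleteFiveMinor_of_isDense ha hb hab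
    (isDense_of_two_le_degOn ⟨c, by simp [hc, hac, hbc]⟩ fun v hv => ?_))
  simp only [mem_filter] at hv
  refine le_trans (Nat.succ_le_of_lt (hall a ha b hb v hv.1 hab hv.2.1 hv.2.2))
    (card_le_card fun u hu => ?_)
  simp only [mem_filter] at hu ⊢
  exact ⟨⟨hu.1, hu.2.1.symm, hu.2.2.1.symm⟩, hu.2.2.2.symm⟩

theorem HasCompleteFiveMinor.mono (h : HasCompleteFiveMinor G S) (hST : S ⊆ T) :
    HasCompleteFiveMinor G T := by
  obtain ⟨B, hB, h⟩ := h
  exact ⟨B, fun i => (hB i).trans (coe_subset.2 hST), h⟩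

/-! ### Contracting an edge -/

/-- The graph obtained from `G` by contracting the vertex `x` into the vertex `y`; the vertex `x`
is not removed. -/
def SimpleGraph.contractInto (G : SimpleGraph V) (x y : V) : SimpleGraph V where
  Adj u v := u ≠ v ∧ (G.Adj u v ∨ u = y ∧ G.Adj x v ∨ v = y ∧ G.Adj x u)
  symm := ⟨fun _ _ h => ⟨h.1.symm, h.2.imp (fun h => h.symm) Or.symm⟩⟩
  loopless := ⟨fun _ h => h.1 rfl⟩

theorem SimpleGraph.contractInto_adj {x y u v : V} : (G.contractInto x y).Adj u v ↔
    u ≠ v ∧ (G.Adj u v ∨ u = y ∧ G.Adj x v ∨ v = y ∧ G.Adj x u) := Iff.rfl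

variable {x y z : V}

theorem preconnected_induce_of_reachable {C : SimpleGraph V} {A B : Set V}
    (hA : (C.induce A).Preconnected) (hAB : A ⊆ B)
    (h : ∀ a (ha : a ∈ A) b (hb : b ∈ A), C.Adj a b →
      (G.induce B).Reachable ⟨a, hAB ha⟩ ⟨b, hAB hb⟩)
    (hB : ∀ v (hv : v ∈ B), ∃ u, ∃ hu : u ∈ A, (G.induce B).Reachable ⟨v, hv⟩ ⟨u, hAB hu⟩) :
    (G.induce B).Preconnected := by
  have key : ∀ {a b : A} (_ : (C.induce A).Walk a b),
      (G.induce B).Reachable ⟨a, hAB a.2⟩ ⟨b, hAB b.2⟩ := by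
    intro a b p
    induction p with
    | nil => rfl
    | @cons a b c e _ ih => exact (h a a.2 b b.2 e).trans ih
  rintro ⟨u, hu⟩ ⟨v, hv⟩
  obtain ⟨u', hu', h1⟩ := hB u hu
  obtain ⟨v', hv', h2⟩ := hB v hv
  obtain ⟨p⟩ := hA ⟨u', hu'⟩ ⟨v', hv'⟩
  exact (h1.trans (key p)).trans h2.symm

theorem HasCompleteFiveMinor.of_contractInto (hx : x ∈ W) (hxy : G.Adj x y)
    (h : HasCompleteFiveMinor (G.contractInto x y) (W.erase x)) : HasCompleteFiveMinor G W := by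
  obtain ⟨B, hB, hconn, hdisj, hadj⟩ := h
  have hxB : ∀ i, x ∉ B i := fun i hi => by simpa using hB i hi
  have hmem : ∀ i v, v ∈ (if y ∈ B i then insert x (B i) else B i) ↔
      v ∈ B i ∨ y ∈ B i ∧ v = x := by
    intro i v
    split_ifs with h <;> simp [h, or_comm]
  refine ⟨fun i => if y ∈ B i then insert x (B i) else B i, fun i v hv => ?_, fun i => ?_,
    fun i j hij => ?_, fun i j hij => ?_⟩
  · rcases (hmem i v).1 hv with hv | ⟨-, rfl⟩
    · exact erase_subset _ _ (hB i hv)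
    · exact hx
  · have hsub : B i ⊆ if y ∈ B i then insert x (B i) else B i :=
      fun v hv => (hmem i v).2 (Or.inl hv)
    have hvia : ∀ (hy : y ∈ B i) b (hb : b ∈ B i), G.Adj x b →
        (G.induce (if y ∈ B i then insert x (B i) else B i)).Reachable
          ⟨y, hsub hy⟩ ⟨b, hsub hb⟩ := by
      intro hy b hb hxb
      have hx' : x ∈ (if y ∈ B i then insert x (B i) else B i) := (hmem i x).2 (Or.inr ⟨hy, rfl⟩)
      have h1 : (G.induce (if y ∈ B i then insert x (B i) else B i)).Adj ⟨y, hsub hy⟩ ⟨x, hx'⟩ :=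
        hxy.symm
      have h2 : (G.induce (if y ∈ B i then insert x (B i) else B i)).Adj ⟨x, hx'⟩ ⟨b, hsub hb⟩ :=
        hxb
      exact h1.reachable.trans h2.reachable
    refine preconnected_induce_of_reachable (hconn i) hsub ?_ ?_
    · rintro a ha b hb ⟨-, h | ⟨rfl, h⟩ | ⟨rfl, h⟩⟩
      · exact SimpleGraph.Adj.reachable (G := G.induce _) (u := ⟨a, hsub ha⟩) (v := ⟨b, hsub hb⟩) h
      · exact hvia ha b hb h
      · exact (hvia hb a ha h).symm
    · intro v hv
      rcases (hmem i v).1 hv with hv' | ⟨hy, rfl⟩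
      · exact ⟨v, hv', SimpleGraph.Reachable.refl _⟩
      · exact ⟨y, hy, SimpleGraph.Adj.reachable (G := G.induce _) (u := ⟨v, hv⟩)
          (v := ⟨y, hsub hy⟩) hxy⟩
  · have hd := Set.disjoint_left.1 (hdisj i j hij)
    rw [Set.disjoint_left]
    intro v hv hv'
    rcases (hmem i v).1 hv with hv | ⟨hy, rfl⟩ <;> rcases (hmem j _).1 hv' with hv' | ⟨hy', hx'⟩
    · exact hd hv hv'
    · exact hxB i (hx' ▸ hv)
    · exact hxB j hv'
    · exact hd hy hy'
  · obtain ⟨u, hu, v, hv, -, h | ⟨rfl, h⟩ | ⟨rfl, h⟩⟩ := hadj i j hij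
    · exact ⟨u, (hmem i u).2 (Or.inl hu), v, (hmem j v).2 (Or.inl hv), h⟩
    · exact ⟨x, (hmem i x).2 (Or.inr ⟨hu, rfl⟩), v, (hmem j v).2 (Or.inl hv), h⟩
    · exact ⟨u, (hmem i u).2 (Or.inl hu), x, (hmem j x).2 (Or.inr ⟨hv, rfl⟩), h.symm⟩

theorem degOn_erase_add (hx : x ∈ W) (v : V) :
    degOn G (W.erase x) v + (if G.Adj v x then 1 else 0) = degOn G W v := by
  rw [← degOn_insert (notMem_erase x W), insert_erase hx]

theorem degOn_contractInto_of_notMem (hy : y ∉ S) {v : V} (hv : v ∈ S) :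
    degOn (G.contractInto x y) S v = degOn G S v := by
  unfold degOn
  congr 1
  refine filter_congr fun u hu => ?_
  rw [SimpleGraph.contractInto_adj]
  constructor
  · rintro ⟨-, h | ⟨rfl, -⟩ | ⟨rfl, -⟩⟩
    exacts [h, absurd hv hy, absurd hu hy]
  · exact fun h => ⟨h.ne, Or.inl h⟩

theorem IsDense.of_contractInto_of_notMem (h : IsDense (G.contractInto x y) S) (hy : y ∉ S) :
    IsDense G S :=
  ⟨h.1, h.2.trans_eq (sum_congr rfl fun _ => degOn_contractInto_of_notMem hy)⟩

theorem IsDense.insert_of_contractInto (h : IsDense (G.contractInto x y) S) (hy : y ∈ S)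
    (hx : x ∉ S) (hxy : G.Adj x y) : IsDense G (insert x S) := by
  refine ⟨insert_nonempty _ _, ?_⟩
  have h1 : ∑ v ∈ insert x S, degOn G (insert x S) v =
      ∑ v ∈ S, degOn G S v + 2 * degOn G S x := by
    rw [sum_insert hx, degOn_insert hx, if_neg (G.loopless.irrefl x)]
    simp only [degOn_insert hx, sum_add_distrib]
    simp only [degOn, card_filter, G.adj_comm]
    ring
  have hex : degOn G (S.erase y) x + 1 = degOn G S x := by
    rw [← degOn_erase_add hy, if_pos hxy]
  have h2 : degOn (G.contractInto x y) S y ≤ degOn G S y + degOn G (S.erase y) x := by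
    unfold degOn
    refine le_trans (card_le_card fun u hu => ?_) (card_union_le _ _)
    simp only [mem_filter, SimpleGraph.contractInto_adj, mem_union, mem_erase] at hu ⊢
    obtain ⟨huS, hne, h | ⟨-, h⟩ | ⟨rfl, -⟩⟩ := hu
    · exact Or.inl ⟨huS, h⟩
    · exact Or.inr ⟨⟨hne.symm, huS⟩, h⟩
    · exact absurd rfl hne
  have h3 : ∀ v ∈ S.erase y, degOn (G.contractInto x y) S v ≤
      degOn G S v + if G.Adj x v then 1 else 0 := by
    intro v hv
    have hvy := ne_of_mem_erase hv
    have h4 : degOn (G.contractInto x y) (S.erase y) v = degOn G (S.erase y) v :=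
      degOn_contractInto_of_notMem (notMem_erase _ _) hv
    rw [← degOn_erase_add hy (G := G.contractInto x y), ← degOn_erase_add hy (G := G), h4, add_assoc]
    refine Nat.add_le_add_left ?_ _
    have : (G.contractInto x y).Adj v y → G.Adj v y ∨ G.Adj x v := by
      rintro ⟨-, h | ⟨rfl, -⟩ | ⟨-, h⟩⟩
      exacts [Or.inl h, absurd rfl hvy, Or.inr h]
    split_ifs <;> first | omega | tauto
  have h5 := sum_le_sum h3
  rw [sum_add_distrib, ← card_filter] at h5
  change _ ≤ _ + degOn G (S.erase y) x at h5
  have h6 := h.2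
  rw [← add_sum_erase _ _ hy] at h6
  rw [h1, card_insert_of_notMem hx, ← add_sum_erase _ _ hy]
  omega

theorem HasDisjointDense.of_contractInto {k : ℕ} (hx : x ∉ S) (hxy : G.Adj x y)
    (h : HasDisjointDense (G.contractInto x y) k S) : HasDisjointDense G k (insert x S) := by
  have hnot : ∀ {k : ℕ} {S : Finset V}, y ∉ S → HasDisjointDense (G.contractInto x y) k S →
      HasDisjointDense G k S := by
    intro k
    induction k with
    | zero => exact fun _ _ => trivial
    | succ k ih =>
      rintro S hy ⟨R, hR, hd, hk⟩
      exact ⟨R, hR, hd.of_contractInto_of_notMem fun h => hy (hR h),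
        ih (fun h => hy (sdiff_subset h)) hk⟩
  induction k generalizing S with
  | zero => trivial
  | succ k ih =>
    obtain ⟨R, hR, hd, hk⟩ := h
    by_cases hy : y ∈ R
    · refine ⟨insert x R, insert_subset_insert x hR,
        hd.insert_of_contractInto hy (fun h => hx (hR h)) hxy, ?_⟩
      refine (hnot (fun h => (mem_sdiff.1 h).2 hy) hk).mono fun v hv => ?_
      have hvx : v ≠ x := fun h => hx (h ▸ sdiff_subset hv)
      simp only [mem_sdiff, mem_insert, not_or] at hv ⊢
      exact ⟨Or.inr hv.1, hvx, hv.2⟩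
    · refine ⟨R, hR.trans (subset_insert _ _), hd.of_contractInto_of_notMem hy, ?_⟩
      rw [insert_sdiff_of_notMem _ fun h => hx (hR h)]
      exact ih (fun h => hx (sdiff_subset h)) hk

/-! ### The score of a vertex set -/

/-- The contribution of a vertex of degree `d` to the score. -/
def vertexScore (k d : ℕ) : ℤ := if 2 * k ≤ d then 1 else if d + 2 ≤ 2 * k then -1 else 0

theorem vertexScore_le_one (k d : ℕ) : vertexScore k d ≤ 1 := by
  unfold vertexScore; split_ifs <;> omega

theorem vertexScore_mono (k : ℕ) {d e : ℕ} (h : d ≤ e) : vertexScore k d ≤ vertexScore k e := by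
  unfold vertexScore; split_ifs <;> omega

/-- The number of vertices of high degree minus the number of vertices of low degree. -/
noncomputable def score (G : SimpleGraph V) (k : ℕ) (W : Finset V) : ℤ :=
  ∑ v ∈ W, vertexScore k (degOn G W v)

theorem score_sub_le_score_erase {k : ℕ} (hx : x ∈ W) :
    score G k W - vertexScore k (degOn G W x) -
      #{v ∈ W.erase x | G.Adj v x ∧ degOn G W v ≤ 2 * k} ≤ score G k (W.erase x) := by
  unfold score
  rw [← add_sum_erase _ _ hx, card_filter, add_sub_cancel_left]
  push_cast
  rw [← sum_sub_distrib]
  refine sum_le_sum fun v _ => ?_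
  have h := degOn_erase_add (G := G) hx v
  unfold vertexScore
  by_cases hvx : G.Adj v x <;> simp only [hvx, if_true, if_false, true_and, false_and] at h ⊢ <;>
    split_ifs <;> omega

theorem score_le_score_erase_of_degOn_le_one {k : ℕ} (hk : 2 ≤ k) (hx : x ∈ W)
    (hd : degOn G W x ≤ 1) : score G k W ≤ score G k (W.erase x) := by
  have h := score_sub_le_score_erase (G := G) (k := k) hx
  have h1 : #{v ∈ W.erase x | G.Adj v x ∧ degOn G W v ≤ 2 * k} ≤ degOn G W x := by
    refine card_le_card fun v hv => ?_
    simp only [mem_filter, mem_erase] at hv ⊢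
    exact ⟨hv.1.2, hv.2.1.symm⟩
  have h2 : vertexScore k (degOn G W x) = -1 := by
    unfold vertexScore
    split_ifs <;> omega
  omega

theorem score_le_score_contractInto {k : ℕ} (hx : x ∈ W) (hy : y ∈ W) (hxy : G.Adj x y)
    (h2 : 2 ≤ degOn G W x) (hxk : degOn G W x < 2 * k)
    (hcom : ∀ z ∈ W, G.Adj x z → ¬ G.Adj y z) :
    score G k W ≤ score (G.contractInto x y) k (W.erase x) := by
  have hy' : y ∈ W.erase x := mem_erase.2 ⟨hxy.ne', hy⟩
  have hy1 : degOn G W y ≤ degOn (G.contractInto x y) (W.erase x) y := by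
    have h3 : degOn G (W.erase x) y + degOn G (W.erase y) x ≤
        degOn (G.contractInto x y) (W.erase x) y := by
      unfold degOn
      rw [← card_union_of_disjoint]
      · refine card_le_card fun u hu => ?_
        simp only [mem_filter, SimpleGraph.contractInto_adj, mem_union, mem_erase] at hu ⊢
        rcases hu with ⟨hu, h⟩ | ⟨hu, h⟩
        · exact ⟨hu, h.ne, Or.inl h⟩
        · exact ⟨⟨h.ne', hu.2⟩, hu.1.symm, Or.inr (Or.inl ⟨trivial, h⟩)⟩
      · refine disjoint_left.2 fun u hu hu' => ?_
        simp only [mem_filter, mem_erase] at hu hu'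
        exact hcom u hu.1.2 hu'.2 hu.2
    have h4 := degOn_erase_add (G := G) hx y
    have h5 := degOn_erase_add (G := G) hy x
    rw [if_pos hxy.symm] at h4
    rw [if_pos hxy] at h5
    omega
  have hv1 : ∀ v ∈ W.erase x, degOn G W v ≤ degOn (G.contractInto x y) (W.erase x) v := by
    intro v hv
    by_cases hvy : v = y
    · exact hvy ▸ hy1
    have h4 : degOn (G.contractInto x y) ((W.erase x).erase y) v =
        degOn G ((W.erase x).erase y) v :=
      degOn_contractInto_of_notMem (notMem_erase _ _) (mem_erase.2 ⟨hvy, hv⟩)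
    have h5 := degOn_erase_add (G := G) hx v
    have h6 := degOn_erase_add (G := G) hy' v
    have h7 := degOn_erase_add (G := G.contractInto x y) hy' v
    have h8 := hcom v (mem_of_mem_erase hv)
    have h9 : (G.contractInto x y).Adj v y ↔ G.Adj v y ∨ G.Adj v x := by
      rw [SimpleGraph.contractInto_adj, G.adj_comm v x]
      simp [hvy]
    rw [G.adj_comm x, G.adj_comm y] at h8
    split_ifs at h5 h6 h7 <;> first | omega | tauto
  unfold score
  rw [← add_sum_erase _ _ hx]
  have h3 : vertexScore k (degOn G W x) ≤ 0 := by
    unfold vertexScore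
    split_ifs <;> omega
  have h4 := sum_le_sum fun v hv => vertexScore_mono k (hv1 v hv)
  omega

theorem degOn_triple (hxy : x ≠ y) (hxz : x ≠ z) (hyz : y ≠ z) (v : V) :
    degOn G {x, y, z} v = (if G.Adj v x then 1 else 0) + (if G.Adj v y then 1 else 0) +
      if G.Adj v z then 1 else 0 := by
  rw [degOn_insert (by simp [hxy, hxz]), degOn_insert (by simp [hyz]), degOn, filter_singleton]
  split_ifs <;> simp

theorem sum_degOn_triangle (hxy : G.Adj x y) (hxz : G.Adj x z) (hyz : G.Adj y z) :
    ∑ v ∈ {x, y, z}, degOn G {x, y, z} v = 6 := by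
  rw [sum_insert (by simp [hxy.ne, hxz.ne]), sum_pair hyz.ne]
  simp [degOn_triple hxy.ne hxz.ne hyz.ne, hxy, hxz, hyz, hxy.symm, hxz.symm, hyz.symm]

theorem isDense_triangle (hxy : G.Adj x y) (hxz : G.Adj x z) (hyz : G.Adj y z) :
    IsDense G {x, y, z} :=
  ⟨by simp, by
    rw [sum_degOn_triangle hxy hxz hyz, card_eq_three.2 ⟨x, y, z, hxy.ne, hxz.ne, hyz.ne, rfl⟩]⟩

theorem triple_subset (hx : x ∈ W) (hy : y ∈ W) (hz : z ∈ W) : {x, y, z} ⊆ W := by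
  simp [insert_subset_iff, hx, hy, hz]

theorem score_sub_le_score_sdiff_triple {k : ℕ} (hx : x ∈ W) (hy : y ∈ W) (hz : z ∈ W)
    (hxy : x ≠ y) (hxz : x ≠ z) (hyz : y ≠ z) :
    score G (k + 1) W - 3 - #{v ∈ W | G.Adj v x ∧ G.Adj v y ∧ G.Adj v z} ≤
      score G k (W \ {x, y, z}) := by
  have hT := triple_subset hx hy hz
  have h1 : ∀ v ∈ W \ {x, y, z}, vertexScore (k + 1) (degOn G W v) -
      (if G.Adj v x ∧ G.Adj v y ∧ G.Adj v z then 1 else 0) ≤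
        vertexScore k (degOn G (W \ {x, y, z}) v) := by
    intro v _
    have h2 := degOn_sdiff_add (G := G) hT v
    rw [degOn_triple hxy hxz hyz] at h2
    unfold vertexScore
    split_ifs at h2 ⊢ <;> first | omega | tauto
  have h2 := sum_le_sum h1
  have h3 : ∑ v ∈ {x, y, z}, vertexScore (k + 1) (degOn G W v) ≤ 3 := by
    refine (sum_le_card_nsmul _ _ 1 fun v _ => vertexScore_le_one _ _).trans ?_
    rw [card_eq_three.2 ⟨x, y, z, hxy, hxz, hyz, rfl⟩]
    norm_num
  have h4 : #{v ∈ W \ {x, y, z} | G.Adj v x ∧ G.Adj v y ∧ G.Adj v z} ≤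
      #{v ∈ W | G.Adj v x ∧ G.Adj v y ∧ G.Adj v z} :=
    card_le_card (filter_subset_filter _ sdiff_subset)
  have h5 := sum_sdiff (f := fun v => vertexScore (k + 1) (degOn G W v)) hT
  rw [sum_sub_distrib, sum_boole] at h2
  unfold score
  omega

/-- If the complement of a triangle is not dense, then the triangle has large degree sum. -/
theorem card_add_score_le_of_not_isDense (hx : x ∈ W) (hy : y ∈ W) (hz : z ∈ W)
    (hxy : G.Adj x y) (hxz : G.Adj x z) (hyz : G.Adj y z) (hdeg : ∀ v ∈ W, 2 ≤ degOn G W v)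
    (hs : 4 ≤ score G 2 W) (hd : ¬ IsDense G (W \ {x, y, z})) :
    #W + 5 + score G 2 W ≤
      (degOn G W x + vertexScore 2 (degOn G W x)) + (degOn G W y + vertexScore 2 (degOn G W y)) +
        (degOn G W z + vertexScore 2 (degOn G W z)) := by
  have hT := triple_subset hx hy hz
  have hcard := card_sdiff_add_card_eq_card hT
  rw [card_eq_three.2 ⟨x, y, z, hxy.ne, hxz.ne, hyz.ne, rfl⟩] at hcard
  have hsum : ∀ f : V → ℤ, ∑ v ∈ {x, y, z}, f v = f x + (f y + f z) := fun f => by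
    rw [sum_insert (by simp [hxy.ne, hxz.ne]), sum_pair hyz.ne]
  have h1 := sum_sdiff (f := fun v => vertexScore 2 (degOn G W v)) hT
  have h2 := sum_sdiff (f := fun v => (degOn G W v : ℤ)) hT
  have h3 := sum_degOn_sdiff (G := G) hT
  rw [sum_degOn_triangle hxy hxz hyz] at h3
  zify at h3
  rw [hsum] at h1 h2 h3
  have h4 : ∑ v ∈ W \ {x, y, z}, (3 + vertexScore 2 (degOn G W v)) ≤
      ∑ v ∈ W \ {x, y, z}, (degOn G W v : ℤ) := by
    refine sum_le_sum fun v hv => ?_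
    have := hdeg v (sdiff_subset hv)
    unfold vertexScore
    split_ifs <;> omega
  rw [sum_add_distrib, sum_const, nsmul_eq_mul] at h4
  have hs' : score G 2 W = ∑ v ∈ W, vertexScore 2 (degOn G W v) := rfl
  have hne : (W \ {x, y, z}).Nonempty := by
    by_contra hne
    rw [not_nonempty_iff_eq_empty] at hne
    rw [hne, sum_empty] at h1
    have := vertexScore_le_one 2 (degOn G W x)
    have := vertexScore_le_one 2 (degOn G W y)
    have := vertexScore_le_one 2 (degOn G W z)
    omega
  obtain ⟨m, hm⟩ := even_sum_degOn (G := G) (W \ {x, y, z})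
  have h5 : ∑ v ∈ W \ {x, y, z}, degOn G (W \ {x, y, z}) v < 2 * #(W \ {x, y, z}) := by
    by_contra! h
    exact hd ⟨hne, h⟩
  zify at h5 hm hcard
  omega

theorem hasDisjointDense_of_reductions {k : ℕ} (hk : 2 ≤ k) (hG : ¬ HasCompleteFiveMinor G W)
    (hs : 4 * (k : ℤ) - 4 ≤ score G k W)
    (ih : ∀ (G' : SimpleGraph V) (W' : Finset V), #W' < #W → ¬ HasCompleteFiveMinor G' W' →
      4 * (k : ℤ) - 4 ≤ score G' k W' → HasDisjointDense G' k W')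
    (hred : (∀ x ∈ W, 2 ≤ degOn G W x) → (∀ x ∈ W, ∀ y ∈ W, G.Adj x y → degOn G W x < 2 * k →
      ∃ z ∈ W, G.Adj x z ∧ G.Adj y z) → (∃ x ∈ W, ∃ y ∈ W, ∃ z ∈ W, G.Adj x y ∧ G.Adj x z ∧
        G.Adj y z ∧ #{v ∈ W | G.Adj v x ∧ G.Adj v y ∧ G.Adj v z} ≤ 1) →
      HasDisjointDense G k W) : HasDisjointDense G k W := by
  by_contra hnot
  by_cases h2 : ∀ x ∈ W, 2 ≤ degOn G W x
  swap
  · push Not at h2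
    obtain ⟨x, hx, hd⟩ := h2
    exact hnot ((ih G _ (card_erase_lt_of_mem hx) (fun h => hG (h.mono (erase_subset _ _)))
      (hs.trans (score_le_score_erase_of_degOn_le_one hk hx (by omega)))).mono
        (erase_subset _ _))
  by_cases htri : ∀ x ∈ W, ∀ y ∈ W, G.Adj x y → degOn G W x < 2 * k →
      ∃ z ∈ W, G.Adj x z ∧ G.Adj y z
  swap
  · push Not at htri
    obtain ⟨x, hx, y, hy, hxy, hxk, hcom⟩ := htri
    have h := (ih (G.contractInto x y) _ (card_erase_lt_of_mem hx)
      (fun h => hG (h.of_contractInto hx hxy))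
      (hs.trans (score_le_score_contractInto hx hy hxy (h2 x hx) hxk hcom))).of_contractInto
      (notMem_erase x W) hxy
    rw [insert_erase hx] at h
    exact hnot h
  refine hnot (hred h2 htri ?_)
  by_contra hno
  have hfree : ∀ a ∈ W, ∀ b ∈ W, ∀ c ∈ W, G.Adj a b → G.Adj a c → ¬ G.Adj b c :=
    fun a ha b hb c hc hab hac hbc =>
      hno (exists_triangle_card_common_le_one hG ha hb hc hab hac hbc)
  have hW : W.Nonempty := by
    by_contra hW
    rw [not_nonempty_iff_eq_empty.1 hW, score, sum_empty] at hs
    omega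
  refine hnot (hasDisjointDense_of_triangleFree k hW (fun v hv => ?_) hfree)
  by_contra! hvk
  obtain ⟨y, hy, hvy⟩ := degOn_pos_iff.1 (two_pos.trans_le (h2 v hv))
  obtain ⟨z, hz, hvz, hyz⟩ := htri v hv y hy hvy hvk
  exact hfree v hv y hy z hz hvy hvz hyz

theorem hasDisjointDense_two (hG : ¬ HasCompleteFiveMinor G W) (hs : 4 ≤ score G 2 W) :
    HasDisjointDense G 2 W := by
  induction hn : #W using Nat.strong_induction_on generalizing G W with
  | _ n ih =>
  have ih' : ∀ (G' : SimpleGraph V) (W' : Finset V), #W' < #W → ¬ HasCompleteFiveMinor G' W' →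
      4 ≤ score G' 2 W' → HasDisjointDense G' 2 W' :=
    fun G' W' hlt hG' hs' => ih _ (hn ▸ hlt) hG' hs' rfl
  refine hasDisjointDense_of_reductions le_rfl hG (by simpa using hs)
    (fun G' W' hlt hG' hs' => ih' G' W' hlt hG' (by simpa using hs'))
    fun hdeg hcom ⟨a, ha, b, hb, c, hc, hab, hac, hbc, htip⟩ => ?_
  by_contra hnot
  have hbig : ∀ {x y z : V}, x ∈ W → y ∈ W → z ∈ W → G.Adj x y → G.Adj x z → G.Adj y z →
      #W + 5 + score G 2 W ≤ (degOn G W x + vertexScore 2 (degOn G W x)) +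
        (degOn G W y + vertexScore 2 (degOn G W y)) +
          (degOn G W z + vertexScore 2 (degOn G W z)) :=
    fun hx hy hz hxy hxz hyz => card_add_score_le_of_not_isDense hx hy hz hxy hxz hyz hdeg hs
      fun hd => hnot ⟨_, triple_subset hx hy hz, isDense_triangle hxy hxz hyz,
        _, subset_rfl, hd, trivial⟩
  have hfour : ∀ x ∈ W, 4 ≤ degOn G W x := by
    intro x hx
    by_contra! hxd
    by_cases hp : ∃ p ∈ W, G.Adj x p ∧ degOn G W p ≤ 4
    · obtain ⟨p, hp, hxp, hpd⟩ := hp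
      obtain ⟨q, hq, hxq, hpq⟩ := hcom x hx p hp hxp (by omega)
      have h1 := hbig hx hp hq hxp hxq hpq
      have h2 := degOn_lt_card (G := G) hq
      have h3 := hdeg x hx
      have h4 := vertexScore_le_one 2 (degOn G W p)
      have h5 := vertexScore_le_one 2 (degOn G W q)
      have h6 : vertexScore 2 (degOn G W x) ≤ (degOn G W x : ℤ) - 3 := by
        unfold vertexScore
        split_ifs <;> omega
      omega
    · push Not at hp
      have h1 := score_sub_le_score_erase (G := G) (k := 2) hx
      have h2 : #{v ∈ W.erase x | G.Adj v x ∧ degOn G W v ≤ 2 * 2} = 0 := by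
        rw [card_eq_zero, filter_eq_empty_iff]
        rintro v hv ⟨hvx, hvd⟩
        have := hp v (mem_of_mem_erase hv) hvx.symm
        omega
      have h3 : vertexScore 2 (degOn G W x) ≤ 0 := by
        unfold vertexScore
        split_ifs <;> omega
      exact hnot ((ih' G _ (card_erase_lt_of_mem hx)
        (fun h => hG (h.mono (erase_subset _ _))) (by omega)).mono (erase_subset _ _))
  have hone : ∀ x ∈ W, vertexScore 2 (degOn G W x) = 1 := fun x hx => if_pos (hfour x hx)
  have hscore : score G 2 W = #W := by
    rw [score, sum_congr rfl hone, sum_const, nsmul_one]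
  have h1 := hbig ha hb hc hab hac hbc
  rw [hone a ha, hone b hb, hone c hc, hscore] at h1
  have hT := triple_subset ha hb hc
  have hcard := card_sdiff_add_card_eq_card hT
  rw [card_eq_three.2 ⟨a, b, c, hab.ne, hac.ne, hbc.ne, rfl⟩] at hcard
  have h2 : ∑ v ∈ {a, b, c}, degOn G W v =
      ∑ v ∈ W \ {a, b, c}, degOn G {a, b, c} v + 6 := by
    rw [sum_degOn_comm, ← sum_sdiff hT, sum_degOn_triangle hab hac hbc]
  rw [sum_insert (by simp [hab.ne, hac.ne]), sum_pair hbc.ne] at h2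
  have h3 : ∀ v ∈ W \ {a, b, c}, degOn G {a, b, c} v ≤
      2 + if G.Adj v a ∧ G.Adj v b ∧ G.Adj v c then 1 else 0 := by
    intro v _
    rw [degOn_triple hab.ne hac.ne hbc.ne]
    split_ifs <;> first | omega | tauto
  have h4 := sum_le_sum h3
  rw [sum_add_distrib, ← card_filter, sum_const, smul_eq_mul] at h4
  have h5 : #{v ∈ W \ {a, b, c} | G.Adj v a ∧ G.Adj v b ∧ G.Adj v c} ≤
      #{v ∈ W | G.Adj v a ∧ G.Adj v b ∧ G.Adj v c} :=
    card_le_card (filter_subset_filter _ sdiff_subset)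
  omega

theorem hasDisjointDense_of_score {k : ℕ} (hk : 2 ≤ k) (hG : ¬ HasCompleteFiveMinor G W)
    (hs : 4 * (k : ℤ) - 4 ≤ score G k W) : HasDisjointDense G k W := by
  induction k, hk using Nat.le_induction generalizing G W with
  | base => exact hasDisjointDense_two hG (by simpa using hs)
  | succ k hk ihk =>
    induction hn : #W using Nat.strong_induction_on generalizing G W with
    | _ n ih =>
    refine hasDisjointDense_of_reductions (hk.trans k.le_succ) hG hs
      (fun G' W' hlt hG' hs' => ih _ (hn ▸ hlt) hG' hs' rfl)
      fun _ _ ⟨a, ha, b, hb, c, hc, hab, hac, hbc, htip⟩ => ?_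
    have h := score_sub_le_score_sdiff_triple (G := G) (k := k) ha hb hc hab.ne hac.ne hbc.ne
    push_cast at hs
    exact ⟨_, triple_subset ha hb hc, isDense_triangle hab hac hbc,
      ihk (fun h => hG (h.mono sdiff_subset)) (by omega)⟩

theorem score_univ [Fintype V] [DecidableRel G.Adj] {k : ℕ} (hk : 1 ≤ k) :
    score G k univ = #(Hset G k) - #(Lset G k) := by
  have hdeg : ∀ v, degOn G univ v = G.degree v := fun v => by
    rw [← SimpleGraph.card_neighborFinset_eq_degree, SimpleGraph.neighborFinset_eq_filter]
    unfold degOn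
    congr!
  rw [score, Hset, Lset, card_filter, card_filter]
  push_cast
  rw [← sum_sub_distrib]
  refine sum_congr rfl fun v _ => ?_
  rw [hdeg, vertexScore]
  split_ifs <;> omega

end DenseSets

theorem dirac_erdos_planar {V : Type*} [Fintype V] (G : SimpleGraph V) [DecidableRel G.Adj]
    (k : ℕ) (hk : 3 ≤ k) (hplanar : IsPlanar G)
    (hHL : (Lset G k).card + (5 * k - 7) ≤ (Hset G k).card) :
    HasDisjointCycles G k := by
  have hs := score_univ (G := G) (k := k) (by omega)
  exact (hasDisjointDense_of_score (by omega) (hplanar.not_hasCompleteFiveMinor univ)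
    (by omega)).hasDisjointCycles
end
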